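/- arXiv:0911.4340 — 4 statements merged into one kernel-verified Lean document; each statement's English description precedes it below -/
import Mathlib

section
/- Let n be a positive integer and let G be an n-isobicyclic group with canonical generators x and y. Then there exist coprime positive integers s and t with n = st, elements x_S, x_T in ⟨x⟩ and y_S, y_T in ⟨y⟩ with x = x_S·x_T, y = y_S·y_T, where x_S and y_S have order s and x_T and y_T have order t, and an integer λ, such that: (i) T := ⟨x_T, y_T⟩ is an abelian normal subgroup of G of order t²; (ii) S := ⟨x_S, y_S⟩ is a nilpotent subgroup of G of order s² with S ∩ T = 1 (so G = T ⋊ S internally); (iii) x_S⁻¹·x_T·x_S = x_T, y_S⁻¹·y_T·y_S = y_T, x_S⁻¹·y_T·x_S = y_T^λ, and y_S⁻¹·x_T·y_S = x_T^λ. -/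
open scoped Pointwise


theorem ito_abelian {G : Type*} [Group G] (A B : Subgroup G)
    (hA : ∀ a ∈ A, ∀ b ∈ A, a * b = b * a) (hB : ∀ a ∈ B, ∀ b ∈ B, a * b = b * a)
    (hAB : ∀ g : G, ∃ a ∈ A, ∃ b ∈ B, g = a * b) :
    ∀ g ∈ commutator G, ∀ h ∈ commutator G, g * h = h * g := by
  have hBA : ∀ g : G, ∃ b ∈ B, ∃ a ∈ A, g = b * a := by
    intro g
    obtain ⟨a, ha, b, hb, h⟩ := hAB g⁻¹
    exact ⟨b⁻¹, B.inv_mem hb, a⁻¹, A.inv_mem ha, by rw [← inv_inv g, h, mul_inv_rev]⟩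
  set K : Set G := {g | ∃ a ∈ A, ∃ b ∈ B, g = a * b * a⁻¹ * b⁻¹} with hK
  have cA : ∀ k ∈ K, ∀ a ∈ A, a * k * a⁻¹ ∈ K := by
    rintro _ ⟨a, ha, b, hb, rfl⟩ c hc
    obtain ⟨d, hd, b', hb', h⟩ := hBA (c * b * c⁻¹)
    -- c b c⁻¹ = d b', d in B, b' in A
    obtain ⟨a2, ha2, b2, hb2, h2⟩ := hAB (c * b * c⁻¹)
    refine ⟨a2⁻¹ * a * a2, A.mul_mem (A.mul_mem (A.inv_mem ha2) ha) ha2, d, hd, ?_⟩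
    have e1 : a2⁻¹ * a * a2 = a := by rw [mul_assoc, hA a ha a2 ha2]; group
    rw [e1]
    have e2 : c * (a * b * a⁻¹ * b⁻¹) * c⁻¹ = a * (c * b * c⁻¹) * a⁻¹ * (c * b * c⁻¹)⁻¹ := by
      have := hA c hc a ha
      have e3 : c * (a * b * a⁻¹ * b⁻¹) * c⁻¹ = (c * a * c⁻¹) * (c * b * c⁻¹) * (c * a * c⁻¹)⁻¹ * (c * b * c⁻¹)⁻¹ := by group
      rw [e3, this]; group
    rw [e2, h]
    have := hA b' hb' a⁻¹ (A.inv_mem ha)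
    calc a * (d * b') * a⁻¹ * (d * b')⁻¹ = a * d * (b' * a⁻¹) * b'⁻¹ * d⁻¹ := by group
      _ = _ := by rw [this]; group
  have cB : ∀ k ∈ K, ∀ a ∈ B, a * k * a⁻¹ ∈ K := by
    rintro _ ⟨a, ha, b, hb, rfl⟩ c hc
    obtain ⟨d, hd, b', hb', h⟩ := hAB (c * a * c⁻¹)
    refine ⟨d, hd, b, hb, ?_⟩
    have e2 : c * (a * b * a⁻¹ * b⁻¹) * c⁻¹ = (c * a * c⁻¹) * b * (c * a * c⁻¹)⁻¹ * b⁻¹ := by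
      have := hB c hc b hb
      have e3 : c * (a * b * a⁻¹ * b⁻¹) * c⁻¹ = (c * a * c⁻¹) * (c * b * c⁻¹) * (c * a * c⁻¹)⁻¹ * (c * b * c⁻¹)⁻¹ := by group
      rw [e3, this]; group
    rw [e2, h]
    have := hB b' hb' b hb
    calc d * b' * b * (d * b')⁻¹ * b⁻¹ = d * (b' * b) * b'⁻¹ * d⁻¹ * b⁻¹ := by group
      _ = _ := by rw [this]; group
  -- commuting
  have key0 : ∀ k ∈ K, ∀ c ∈ A, ∀ d ∈ B,
      (c⁻¹ * d⁻¹ * c * d) * k = k * (c⁻¹ * d⁻¹ * c * d) := by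
    rintro _ ⟨a, ha, b, hb, rfl⟩ c hc d hd
    -- conj by c*d equals conj by d*c
    obtain ⟨a3, ha3, b3, hb3, h3⟩ := hAB (d * a * d⁻¹)
    obtain ⟨b2, hb2, a2, ha2, h2⟩ := hBA (c * b * c⁻¹)
    have q1 : ∀ a' ∈ A, c * (a' * b * a'⁻¹ * b⁻¹) * c⁻¹ = a' * b2 * a'⁻¹ * b2⁻¹ := by
      intro a' ha'
      have e3 : c * (a' * b * a'⁻¹ * b⁻¹) * c⁻¹ = (c * a' * c⁻¹) * (c * b * c⁻¹) * (c * a' * c⁻¹)⁻¹ * (c * b * c⁻¹)⁻¹ := by group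
      rw [e3, h2, hA c hc a' ha']
      have := hA a2 ha2 a'⁻¹ (A.inv_mem ha')
      calc a' * c * c⁻¹ * (b2 * a2) * (a' * c * c⁻¹)⁻¹ * (b2 * a2)⁻¹ = a' * b2 * (a2 * a'⁻¹) * a2⁻¹ * b2⁻¹ := by group
        _ = _ := by rw [this]; group
    have q2 : ∀ b' ∈ B, d * (a * b' * a⁻¹ * b'⁻¹) * d⁻¹ = a3 * b' * a3⁻¹ * b'⁻¹ := by
      intro b' hb'
      have e3 : d * (a * b' * a⁻¹ * b'⁻¹) * d⁻¹ = (d * a * d⁻¹) * (d * b' * d⁻¹) * (d * a * d⁻¹)⁻¹ * (d * b' * d⁻¹)⁻¹ := by group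
      rw [e3, h3, hB d hd b' hb']
      have := hB b3 hb3 b' hb'
      calc a3 * b3 * (b' * d * d⁻¹) * (a3 * b3)⁻¹ * (b' * d * d⁻¹)⁻¹ = a3 * (b3 * b') * b3⁻¹ * a3⁻¹ * b'⁻¹ := by group
        _ = _ := by rw [this]; group
    have r1 : c * (d * (a * b * a⁻¹ * b⁻¹) * d⁻¹) * c⁻¹ = d * (c * (a * b * a⁻¹ * b⁻¹) * c⁻¹) * d⁻¹ := by
      rw [q2 b hb, q1 a3 ha3, q1 a ha, q2 b2 hb2]
    generalize a * b * a⁻¹ * b⁻¹ = k at r1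
    -- c d k (cd)⁻¹ = d c k (dc)⁻¹ ; need commuting with (cd c⁻¹d⁻¹)... use inverse swap
    have : c⁻¹ * d⁻¹ * (c * (d * k * d⁻¹) * c⁻¹) * d * c = c⁻¹ * d⁻¹ * (d * (c * k * c⁻¹) * d⁻¹) * d * c := by rw [r1]
    have t : c⁻¹ * d⁻¹ * (d * (c * k * c⁻¹) * d⁻¹) * d * c = k := by group
    rw [t] at this
    calc (c⁻¹ * d⁻¹ * c * d) * k = (c⁻¹ * d⁻¹ * (c * (d * k * d⁻¹) * c⁻¹) * d * c) * (c⁻¹ * d⁻¹ * c * d) := by group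
        _ = _ := by rw [this]
  have key : ∀ k ∈ K, ∀ l ∈ K, k * l = l * k := by
    rintro k hk _ ⟨c, hc, d, hd, rfl⟩
    have := key0 k hk c⁻¹ (A.inv_mem hc) d⁻¹ (B.inv_mem hd)
    simp only [inv_inv] at this
    exact this.symm
  have hN : (Subgroup.closure K).Normal := by
    have : ∀ g : G, ∀ k ∈ K, g * k * g⁻¹ ∈ K := by
      intro g k hk
      obtain ⟨a, ha, b, hb, rfl⟩ := hAB g
      have := cA _ (cB k hk b hb) a ha
      convert this using 1
      group
    constructor
    intro k hk g
    induction hk using Subgroup.closure_induction with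
    | mem k hk => exact Subgroup.subset_closure (this g k hk)
    | one => simp
    | mul k l _ _ h1 h2 =>
      have := Subgroup.mul_mem _ h1 h2
      convert this using 1
      group
    | inv k _ h =>
      have := Subgroup.inv_mem _ h
      convert this using 1
      group
  have hle : commutator G ≤ Subgroup.closure K := by
    rw [commutator_def, Subgroup.commutator_le]
    intro g _ h _
    obtain ⟨a, ha, b, hb, rfl⟩ := hAB g
    obtain ⟨c, hc, d, hd, rfl⟩ := hAB h
    have com : ∀ a ∈ A, ∀ b ∈ B, ((a : G) : G ⧸ Subgroup.closure K) * b = b * a := by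
      intro a ha b hb
      rw [← mul_inv_eq_one, mul_inv_rev, ← QuotientGroup.mk_inv, ← QuotientGroup.mk_inv,
        ← QuotientGroup.mk_mul, ← QuotientGroup.mk_mul, ← QuotientGroup.mk_mul,
        QuotientGroup.eq_one_iff]
      exact Subgroup.subset_closure ⟨a, ha, b, hb, by group⟩
    rw [← QuotientGroup.eq_one_iff, commutatorElement_def, QuotientGroup.mk_mul,
      QuotientGroup.mk_mul, QuotientGroup.mk_inv, QuotientGroup.mk_inv, mul_inv_eq_one,
      mul_inv_eq_iff_eq_mul]
    simp only [QuotientGroup.mk_mul]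
    have h1 := com a ha d hd
    have h2 := com c hc b hb
    have h3 : (a : G ⧸ Subgroup.closure K) * c = c * a := by
      rw [← QuotientGroup.mk_mul, hA a ha c hc, QuotientGroup.mk_mul]
    have h4 : (b : G ⧸ Subgroup.closure K) * d = d * b := by
      rw [← QuotientGroup.mk_mul, hB b hb d hd, QuotientGroup.mk_mul]
    generalize (a : G ⧸ Subgroup.closure K) = a at *
    generalize (b : G ⧸ Subgroup.closure K) = b at *
    generalize (c : G ⧸ Subgroup.closure K) = c at *
    generalize (d : G ⧸ Subgroup.closure K) = d at *
    calc a * b * (c * d) = a * (b * c) * d := by group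
      _ = (a * c) * (b * d) := by rw [← h2]; group
      _ = c * (a * d) * b := by rw [h3, h4]; group
      _ = c * d * (a * b) := by rw [h1]; group
  have hcom : IsMulCommutative (Subgroup.closure K) := Subgroup.isMulCommutative_closure key
  intro g hg h hh
  have := hcom.is_comm.comm ⟨g, hle hg⟩ ⟨h, hle hh⟩
  exact congrArg Subtype.val this

theorem exists_hom_of_lt {P : Type*} [Group P] [Finite P] (p : ℕ) [Fact p.Prime]
    (hP : IsPGroup p P) (L : Subgroup P) (hL : L ≠ ⊤) :
    ∃ ψ : P →* Multiplicative (ZMod p), (∀ l ∈ L, ψ l = 1) ∧ ∃ g, ψ g ≠ 1 := by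
  obtain ⟨M, hM, hLM⟩ := (eq_top_or_exists_le_coatom L).resolve_left hL
  have := hP.isNilpotent
  have hMn : M.Normal := Subgroup.NormalizerCondition.normal_of_coatom M
    Group.normalizerCondition_of_isNilpotent hM
  have hidx : Nat.card (P ⧸ M) = p := by
    obtain ⟨k, hk⟩ := (hP.to_quotient M).exists_card_eq
    have h1 : Nat.card (P ⧸ M) ≠ 1 := by
      intro h
      exact hM.1 (Subgroup.index_eq_one.mp h)
    have hdvd : p ∣ Nat.card (P ⧸ M) := by
      rw [hk]; apply dvd_pow_self; rintro rfl; exact h1 (by simpa using hk)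
    obtain ⟨z, hz⟩ := exists_prime_orderOf_dvd_card' p hdvd
    have : Subgroup.comap (QuotientGroup.mk' M) (Subgroup.zpowers z) = ⊤ := by
      apply hM.2
      refine lt_of_le_of_ne ?_ ?_
      · intro m hm
        rw [Subgroup.mem_comap, QuotientGroup.mk'_apply, (QuotientGroup.eq_one_iff m).mpr hm]
        exact Subgroup.one_mem _
      · intro h
        obtain ⟨w, rfl⟩ := QuotientGroup.mk_surjective z
        have : w ∈ M := by
          rw [h]; exact Subgroup.mem_zpowers _
        rw [(QuotientGroup.eq_one_iff w).mpr this, orderOf_one] at hz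
        exact (Fact.out : p.Prime).one_lt.ne hz
    have h2 : Subgroup.zpowers z = ⊤ := by
      rw [eq_top_iff]
      intro w _
      obtain ⟨w, rfl⟩ := QuotientGroup.mk_surjective w
      have : w ∈ Subgroup.comap (QuotientGroup.mk' M) (Subgroup.zpowers z) := by
        rw [this]; trivial
      exact this
    rw [← hz, ← Nat.card_zpowers, h2, Subgroup.card_top]
  have e : (P ⧸ M) ≃* Multiplicative (ZMod p) := mulEquivOfPrimeCardEq (p := p) hidx (by simp)
  refine ⟨e.toMonoidHom.comp (QuotientGroup.mk' M), ?_, ?_⟩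
  · intro l hl
    simp [(QuotientGroup.eq_one_iff l).mpr (hLM hl)]
  · obtain ⟨g, hg⟩ : ∃ g, g ∉ M := by
      by_contra! h
      exact hM.1 (eq_top_iff.mpr fun g _ => h g)
    refine ⟨g, ?_⟩
    simpa using hg

theorem exists_fun_of_lt {G : Type*} [Group G] [Finite G] (p : ℕ) [Fact p.Prime]
    (P : Subgroup G) (hP : IsPGroup p P) (L : Subgroup G) (hL : ¬ P ≤ L) :
    ∃ φ : G → ZMod p, (∀ z ∈ P, ∀ w ∈ P, φ (z * w) = φ z + φ w) ∧
      (∀ z ∈ P, ∀ k : ℤ, φ (z ^ k) = k * φ z) ∧ (∀ l ∈ L, l ∈ P → φ l = 0) ∧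
      ∃ z ∈ P, φ z ≠ 0 := by
  classical
  obtain ⟨ψ, h1, ⟨z, hzP⟩, hz⟩ := exists_hom_of_lt p hP (L.subgroupOf P) (by
    rwa [Ne, Subgroup.subgroupOf_eq_top])
  refine ⟨fun z => if h : z ∈ P then (ψ ⟨z, h⟩).toAdd else 0, ?_, ?_, ?_, z, hzP, ?_⟩
  · intro z hz w hw
    have : (⟨z * w, P.mul_mem hz hw⟩ : P) = ⟨z, hz⟩ * ⟨w, hw⟩ := rfl
    simp only [hz, hw, P.mul_mem hz hw, dif_pos, this, map_mul, toAdd_mul]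
  · intro z hz k
    have : (⟨z ^ k, P.zpow_mem hz k⟩ : P) = ⟨z, hz⟩ ^ k := rfl
    simp only [hz, P.zpow_mem hz k, dif_pos, this, map_zpow, toAdd_zpow, zsmul_eq_mul]
  · intro l hl hlP
    simp only [hlP, dif_pos]
    rw [h1 ⟨l, hlP⟩ (Subgroup.mem_subgroupOf.mpr hl)]; rfl
  · simp only [hzP, dif_pos]
    exact fun h => hz (by simpa using h)
theorem comm_mem {G : Type*} [Group G] (a b : G) : a⁻¹ * b⁻¹ * a * b ∈ commutator G := by
  have : ∀ x y : G, x * y * x⁻¹ * y⁻¹ ∈ commutator G := fun x y =>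
    Subgroup.commutator_mem_commutator (Subgroup.mem_top x) (Subgroup.mem_top y)
  simpa using this a⁻¹ b⁻¹

theorem comm_pow_coprime {G : Type*} [Group G] {p m : ℕ} (hm : Nat.Coprime m p) {c : G}
    {k : ℕ} (hc : c ^ p ^ k = 1) (hc' : c ^ m = 1) : c = 1 := by
  have h1 := orderOf_dvd_of_pow_eq_one hc
  have h2 := orderOf_dvd_of_pow_eq_one hc'
  have := Nat.eq_one_of_dvd_coprimes (hm.pow_right k) h2 h1
  exact orderOf_eq_one_iff.mp this

theorem hilbert_like {G : Type*} [Group G] {p m : ℕ} (hm : Nat.Coprime m p)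
    (K : Subgroup G) (hK : ∀ a ∈ K, ∀ b ∈ K, a * b = b * a)
    (hKp : ∀ a ∈ K, ∃ k : ℕ, a ^ p ^ k = 1)
    (g v : G) (hg : g ^ m = 1)
    (hc : ∀ k : ℕ, v⁻¹ * ((g ^ k)⁻¹ * v * g ^ k) ∈ K) :
    ∃ d ∈ K, g * (v * d) = v * d * g := by
  set c : ℕ → G := fun k => v⁻¹ * ((g ^ k)⁻¹ * v * g ^ k) with hcdef
  have c0 : c 0 = 1 := by simp [hcdef]
  have cm : c m = 1 := by simp [hcdef, hg]
  have hσ : ∀ k, g⁻¹ * c k * g = (c 1)⁻¹ * c (k + 1) := by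
    intro k
    simp only [hcdef, pow_succ]
    group
  obtain ⟨D, hD0, hDs⟩ : ∃ D : ℕ → G, D 0 = 1 ∧ ∀ k, D (k + 1) = D k * c k :=
    ⟨fun k => Nat.rec 1 (fun k d => d * c k) k, rfl, fun k => rfl⟩
  have hDK : ∀ k, D k ∈ K := by
    intro k
    induction k with
    | zero => rw [hD0]; exact K.one_mem
    | succ k ih => rw [hDs]; exact K.mul_mem ih (hc k)
  have hσD : ∀ k, g⁻¹ * D k * g = D (k + 1) * ((c 1)⁻¹) ^ k := by
    intro k
    induction k with
    | zero => simp [hD0, hDs, c0]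
    | succ k ih =>
      rw [hDs k]
      have : g⁻¹ * (D k * c k) * g = (g⁻¹ * D k * g) * (g⁻¹ * c k * g) := by group
      rw [this, ih, hσ, hDs (k + 1), pow_succ]
      have := hK _ (hc (k + 1)) (((c 1)⁻¹) ^ k * (c 1)⁻¹)
        (K.mul_mem (K.pow_mem (K.inv_mem (hc 1)) k) (K.inv_mem (hc 1)))
      change c (k + 1) * _ = _ * c (k + 1) at this
      rw [mul_assoc (D (k + 1)) (c (k + 1)), this]
      simp only [mul_assoc]
  have h1 : g⁻¹ * D m * g = D m * ((c 1)⁻¹) ^ m := by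
    rw [hσD, hDs, cm, mul_one]
  obtain ⟨k, hk⟩ := hKp (c 1) (hc 1)
  obtain ⟨m', hm'⟩ : ∃ m' : ℕ, c 1 ^ (m * m') = c 1 := by
    have : Nat.Coprime (orderOf (c 1)) m :=
      Nat.Coprime.coprime_dvd_left (orderOf_dvd_of_pow_eq_one hk) ((hm.pow_right k).symm)
    obtain ⟨m', h⟩ := exists_pow_eq_self_of_coprime this.symm
    exact ⟨m', by rw [pow_mul, h]⟩
  refine ⟨D m ^ m', K.pow_mem (hDK m) _, ?_⟩
  have h2 : g⁻¹ * D m ^ m' * g = D m ^ m' * (c 1)⁻¹ := by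
    have e : g⁻¹ * D m ^ m' * g = (g⁻¹ * D m * g) ^ m' := by
      have := conj_pow (a := g⁻¹) (b := D m) (i := m')
      simpa using this.symm
    rw [e, h1, Commute.mul_pow, ← pow_mul, inv_pow, hm']
    exact hK _ (hDK m) _ (K.pow_mem (K.inv_mem (hc 1)) m)
  have h3 : g⁻¹ * v * g = v * c 1 := by simp only [hcdef, pow_one]; group
  have h4 : g⁻¹ * (v * D m ^ m') * g = v * D m ^ m' := by
    have : g⁻¹ * (v * D m ^ m') * g = (g⁻¹ * v * g) * (g⁻¹ * D m ^ m' * g) := by group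
    rw [this, h3, h2, hK (D m ^ m') (K.pow_mem (hDK m) _) (c 1)⁻¹ (K.inv_mem (hc 1)),
      mul_assoc, mul_inv_cancel_left]
  calc g * (v * D m ^ m') = g * (g⁻¹ * (v * D m ^ m') * g) := by rw [h4]
    _ = _ := by group

theorem core_lemma {G : Type*} [Group G] [Finite G] (p : ℕ) [hp : Fact p.Prime]
    (P : Subgroup G) (hP : IsPGroup p P) (hcP : commutator G ≤ P)
    (hab : ∀ a ∈ commutator G, ∀ b ∈ commutator G, a * b = b * a)
    (u v g h : G) (hu : u ∈ P) (hv : v ∈ P) (hgen : ∀ z ∈ P, ∃ i j : ℤ, z = u ^ i * v ^ j)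
    (hvu : v ∉ Subgroup.zpowers u) (hgu : g * u = u * g) (hhv : h * v = v * h)
    (m : ℕ) (hm : Nat.Coprime m p) (hgm : g ^ m = 1)
    (α : G ≃* G) (hαu : α u = v) (hαv : α v = u) (hαg : α g = h) :
    (∀ z ∈ P, g * z = z * g) ∨ P ≤ commutator G := by
  have hPn : ∀ z ∈ P, ∀ c : G, c⁻¹ * z * c ∈ P := by
    intro z hz c
    have : z * (z⁻¹ * c⁻¹ * z * c) ∈ P := P.mul_mem hz (hcP (comm_mem z c))
    convert this using 1
    group
  obtain ⟨i, j, hij⟩ := hgen _ (hPn v hv g)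
  have hαij : h⁻¹ * u * h = v ^ i * u ^ j := by
    have := congrArg α hij
    simpa [hαu, hαv, hαg] using this
  -- p ∣ i
  have hpi : (i : ZMod p) = 0 := by
    obtain ⟨φ, hmul, hpow, h0, z, hz, hz0⟩ := exists_fun_of_lt p P hP (Subgroup.zpowers u)
      (fun h => hvu (h hv))
    have hφu : φ u = 0 := h0 u (Subgroup.mem_zpowers u) hu
    have hφv : φ v ≠ 0 := by
      obtain ⟨a, b, rfl⟩ := hgen z hz
      rw [hmul _ (P.zpow_mem hu a) _ (P.zpow_mem hv b), hpow u hu, hpow v hv, hφu] at hz0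
      intro h; simp [h] at hz0
    have hconj : ∀ z ∈ P, ∀ c ∈ P, φ (c⁻¹ * z * c) = φ z := by
      intro z hz c hc
      have := hpow c hc (-1)
      rw [hmul _ (P.mul_mem (P.inv_mem hc) hz) _ hc, hmul _ (P.inv_mem hc) _ hz]
      rw [zpow_neg_one] at this
      rw [this]; push_cast; ring
    have e1 : h⁻¹ * (g⁻¹ * v * g) * h = (v ^ i * u ^ j) ^ i * v ^ j := by
      rw [hij]
      have : h⁻¹ * (u ^ i * v ^ j) * h = (h⁻¹ * u * h) ^ i * (h⁻¹ * v * h) ^ j := by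
        have h1 := conj_zpow (a := h⁻¹) (b := u) (i := i)
        have h2 := conj_zpow (a := h⁻¹) (b := v) (i := j)
        rw [inv_inv] at h1 h2
        rw [h1, h2]; group
      rw [this, hαij, mul_assoc h⁻¹ v h, ← hhv]; group
    have hc : h⁻¹ * g⁻¹ * h * g ∈ P := hcP (comm_mem h g)
    have hc' : g⁻¹ * h⁻¹ * g * h ∈ P := hcP (comm_mem g h)
    have e2 : φ (h⁻¹ * (g⁻¹ * v * g) * h) = φ (g⁻¹ * v * g) := by
      have hw : g⁻¹ * (h⁻¹ * v * h) * g = g⁻¹ * v * g := by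
        rw [mul_assoc h⁻¹ v h, ← hhv]; group
      rw [← hw, ← hconj _ (hPn _ (hPn v hv h) g) _ hc']
      congr 1
      rw [hw]
      have hv' : h * v * h⁻¹ = v := by rw [hhv]; group
      have : (g⁻¹ * h⁻¹ * g * h)⁻¹ * (g⁻¹ * v * g) * (g⁻¹ * h⁻¹ * g * h)
        = h⁻¹ * g⁻¹ * (h * v * h⁻¹) * g * h := by group
      rw [this, hv']; group
    rw [e1, hij] at e2
    have m1 : v ^ i * u ^ j ∈ P := P.mul_mem (P.zpow_mem hv _) (P.zpow_mem hu _)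
    rw [hmul _ (P.zpow_mem m1 i) _ (P.zpow_mem hv j), hpow _ m1, hmul _ (P.zpow_mem hv i) _ (P.zpow_mem hu j),
      hmul _ (P.zpow_mem hu i) _ (P.zpow_mem hv j), hpow _ hv, hpow _ hv, hpow _ hu, hpow _ hu, hφu] at e2
    have e3 : (i : ZMod p) * (i * φ v) = 0 := by linear_combination e2
    rcases mul_eq_zero.mp e3 with h | h
    · exact h
    · exact (mul_eq_zero.mp h).resolve_right hφv
  by_cases hj : (j : ZMod p) = 1
  · left
    by_contra hcon
    have hnle : ¬ P ≤ Subgroup.centralizer {g} := by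
      intro hle
      exact hcon fun z hz => (Subgroup.mem_centralizer_singleton_iff.mp (hle hz)).symm
    obtain ⟨φ, hmul, hpow, h0, z, hz, hz0⟩ := exists_fun_of_lt p P hP _ hnle
    have hφu : φ u = 0 := h0 u (Subgroup.mem_centralizer_singleton_iff.mpr hgu.symm) hu
    have hφσv : φ (g⁻¹ * v * g) = φ v := by
      rw [hij, hmul _ (P.zpow_mem hu i) _ (P.zpow_mem hv j), hpow _ hv, hpow _ hu, hφu, hj]; ring
    have hφσ : ∀ z ∈ P, φ (g⁻¹ * z * g) = φ z := by
      intro z hz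
      obtain ⟨a, b, rfl⟩ := hgen z hz
      have : g⁻¹ * (u ^ a * v ^ b) * g = (g⁻¹ * u * g) ^ a * (g⁻¹ * v * g) ^ b := by
        have h1 := conj_zpow (a := g⁻¹) (b := u) (i := a)
        have h2 := conj_zpow (a := g⁻¹) (b := v) (i := b)
        rw [inv_inv] at h1 h2
        rw [h1, h2]; group
      have hu' : g⁻¹ * u * g = u := by rw [mul_assoc, ← hgu]; group
      rw [this, hu', hmul _ (P.zpow_mem hu a) _ (P.zpow_mem (hPn v hv g) b), hpow _ (hPn v hv g),
        hφσv, hmul _ (P.zpow_mem hu a) _ (P.zpow_mem hv b), hpow v hv]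
    have hφσk : ∀ k : ℕ, φ ((g ^ k)⁻¹ * v * g ^ k) = φ v := by
      intro k
      induction k with
      | zero => simp
      | succ k ih =>
        rw [← ih, ← hφσ _ (hPn v hv (g ^ k))]
        congr 1
        rw [pow_succ]; group
    have φinv : ∀ z ∈ P, φ z⁻¹ = - φ z := by
      intro z hz
      have := hpow z hz (-1)
      rw [zpow_neg_one] at this
      rw [this]; push_cast; ring
    have φone : φ 1 = 0 := by simpa using hpow 1 P.one_mem 0
    let K : Subgroup G :=
      { carrier := {z | z ∈ commutator G ∧ φ z = 0}
        mul_mem' := by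
          rintro a b ⟨ha, ha'⟩ ⟨hb, hb'⟩
          exact ⟨Subgroup.mul_mem _ ha hb, by rw [hmul _ (hcP ha) _ (hcP hb), ha', hb', add_zero]⟩
        one_mem' := ⟨Subgroup.one_mem _, φone⟩
        inv_mem' := by
          rintro a ⟨ha, ha'⟩
          exact ⟨Subgroup.inv_mem _ ha, by rw [φinv a (hcP ha), ha', neg_zero]⟩ }
    obtain ⟨d, hd, hgd⟩ := hilbert_like hm K (fun a ha b hb => hab a ha.1 b hb.1)
      (by
        intro a ha
        obtain ⟨k, hk⟩ := hP ⟨a, hcP ha.1⟩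
        exact ⟨k, congrArg Subtype.val hk⟩) g v hgm (by
        intro k
        refine ⟨?_, ?_⟩
        · have : _ := comm_mem v (g ^ k)
          convert this using 1
          group
        · rw [hmul _ (P.inv_mem hv) _ (hPn v hv _), hφσk, φinv v hv]; ring)
    have hφv : φ v = 0 := by
      have := h0 (v * d) (Subgroup.mem_centralizer_singleton_iff.mpr hgd.symm)
        (P.mul_mem hv (hcP hd.1))
      rwa [hmul _ hv _ (hcP hd.1), hd.2, add_zero] at this
    obtain ⟨a, b, rfl⟩ := hgen z hz
    rw [hmul _ (P.zpow_mem hu a) _ (P.zpow_mem hv b), hpow u hu, hpow v hv, hφu, hφv] at hz0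
    simp at hz0
  · right
    by_contra hcon
    obtain ⟨φ, hmul, hpow, h0, z, hz, hz0⟩ := exists_fun_of_lt p P hP _ hcon
    have k1 : v⁻¹ * (u ^ i * v ^ j) ∈ commutator G := by
      rw [← hij]
      have : _ := comm_mem v g
      convert this using 1
      group
    have k2 : u⁻¹ * (v ^ i * u ^ j) ∈ commutator G := by
      rw [← hαij]
      have : _ := comm_mem u h
      convert this using 1
      group
    have φinv : ∀ z ∈ P, φ z⁻¹ = - φ z := by
      intro z hz
      have := hpow z hz (-1)
      rw [zpow_neg_one] at this
      rw [this]; push_cast; ring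
    have gen : ∀ a ∈ P, ∀ b ∈ P, b⁻¹ * (a ^ i * b ^ j) ∈ commutator G → φ b = 0 := by
      intro a ha b hb hc
      have := h0 _ hc (hcP hc)
      rw [hmul _ (P.inv_mem hb) _ (P.mul_mem (P.zpow_mem ha i) (P.zpow_mem hb j)),
        hmul _ (P.zpow_mem ha i) _ (P.zpow_mem hb j), hpow a ha, hpow b hb, φinv b hb, hpi] at this
      have : ((j : ZMod p) - 1) * φ b = 0 := by linear_combination this
      exact (mul_eq_zero.mp this).resolve_left (sub_ne_zero.mpr hj)
    obtain ⟨a, b, rfl⟩ := hgen z hz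
    rw [hmul _ (P.zpow_mem hu a) _ (P.zpow_mem hv b), hpow u hu, hpow v hv, gen u hu v hv k1,
      gen v hv u hu k2] at hz0
    simp at hz0

structure IsoBi {G : Type*} [Group G] (n : ℕ) (x y : G) (α : G ≃* G) : Prop where
  npos : 0 < n
  ox : orderOf x = n
  oy : orderOf y = n
  gen : ∀ g : G, ∃ i j : ℤ, g = x ^ i * y ^ j
  inter : ∀ i j : ℤ, x ^ i * y ^ j = 1 → x ^ i = 1 ∧ y ^ j = 1
  ax : α x = y
  ay : α y = x

namespace IsoBi

variable {G : Type*} [Group G] {n : ℕ} {x y : G} {α : G ≃* G}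

theorem symm (H : IsoBi n x y α) : IsoBi n y x α where
  npos := H.npos
  ox := H.oy
  oy := H.ox
  gen := fun g => by
    obtain ⟨i, j, h⟩ := H.gen g⁻¹
    exact ⟨-j, -i, by rw [← inv_inv g, h, mul_inv_rev, zpow_neg, zpow_neg]⟩
  inter := fun i j h => by
    have : x ^ (-j) * y ^ (-i) = 1 := by
      rw [zpow_neg, zpow_neg, ← mul_inv_rev, h, inv_one]
    have := H.inter _ _ this
    simpa [and_comm] using this
  ax := H.ay
  ay := H.ax

theorem abel (H : IsoBi n x y α) :
    ∀ a ∈ commutator G, ∀ b ∈ commutator G, a * b = b * a := by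
  have hz : ∀ z : G, ∀ a ∈ Subgroup.zpowers z, ∀ b ∈ Subgroup.zpowers z, a * b = b * a := by
    rintro z _ ⟨i, rfl⟩ _ ⟨j, rfl⟩
    exact (Commute.zpow_zpow_self z i j)
  refine ito_abelian (Subgroup.zpowers x) (Subgroup.zpowers y) (hz x) (hz y) ?_
  intro g
  obtain ⟨i, j, h⟩ := H.gen g
  exact ⟨_, ⟨i, rfl⟩, _, ⟨j, rfl⟩, h⟩

theorem inj (H : IsoBi n x y α) (i j k l : ℤ) (h : x ^ i * y ^ j = x ^ k * y ^ l) :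
    x ^ i = x ^ k ∧ y ^ j = y ^ l := by
  have : x ^ (-k + i) * y ^ (j + -l) = 1 := by
    rw [zpow_add, zpow_add, mul_assoc, ← mul_assoc (x ^ i), h, zpow_neg, zpow_neg]
    group
  obtain ⟨h1, h2⟩ := H.inter _ _ this
  rw [zpow_add, zpow_neg, inv_mul_eq_one] at h1
  rw [zpow_add, zpow_neg, mul_inv_eq_one] at h2
  exact ⟨h1.symm, h2⟩

theorem prod_inj (H : IsoBi n x y α) (A B : Subgroup G) (hA : A ≤ Subgroup.zpowers x)
    (hB : B ≤ Subgroup.zpowers y) :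
    Function.Injective (fun z : A × B => (z.1 : G) * (z.2 : G)) := by
  rintro ⟨⟨a, ha⟩, ⟨b, hb⟩⟩ ⟨⟨c, hc⟩, ⟨d, hd⟩⟩ h
  obtain ⟨i, rfl⟩ := hA ha
  obtain ⟨j, rfl⟩ := hB hb
  obtain ⟨k, rfl⟩ := hA hc
  obtain ⟨l, rfl⟩ := hB hd
  obtain ⟨h1, h2⟩ := H.inj i j k l h
  simp only [Prod.mk.injEq, Subtype.mk.injEq]
  exact ⟨h1, h2⟩

theorem card [Finite G] (H : IsoBi n x y α) : Nat.card G = n ^ 2 := by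
  have : Function.Bijective
      (fun z : Subgroup.zpowers x × Subgroup.zpowers y => (z.1 : G) * (z.2 : G)) := by
    refine ⟨H.prod_inj _ _ le_rfl le_rfl, ?_⟩
    intro g
    obtain ⟨i, j, h⟩ := H.gen g
    exact ⟨⟨⟨_, i, rfl⟩, ⟨_, j, rfl⟩⟩, h.symm⟩
  rw [← Nat.card_congr (Equiv.ofBijective _ this), Nat.card_prod, Nat.card_zpowers,
    Nat.card_zpowers, H.ox, H.oy, sq]

theorem exists_sylow [Finite G] (H : IsoBi n x y α) (p e m : ℕ) [hp : Fact p.Prime]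
    (hn : n = p ^ e * m) (hm : Nat.Coprime m p) :
    ∃ P : Sylow p G, x ^ m ∈ P ∧ y ^ m ∈ P ∧
      ∀ z ∈ P, ∃ i j : ℤ, z = (x ^ m) ^ i * (y ^ m) ^ j := by
  have hmpos : 0 < m := Nat.pos_of_ne_zero (by rintro rfl; have := H.npos; simp [hn] at this)
  have ho : ∀ z : G, orderOf z = n → orderOf (z ^ m) = p ^ e := by
    intro z hz
    rw [orderOf_pow_of_dvd hmpos.ne' (by rw [hz, hn]; exact Dvd.intro_left _ rfl), hz, hn,
      Nat.mul_div_cancel _ hmpos]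
  have hpz : ∀ z : G, orderOf z = n → IsPGroup p (Subgroup.zpowers (z ^ m)) := by
    intro z hz
    apply IsPGroup.of_card (n := e)
    rw [Nat.card_zpowers, ho z hz]
  obtain ⟨P0, hP0⟩ := (hpz x H.ox).exists_le_sylow
  obtain ⟨Q, hQ⟩ := (hpz y H.oy).exists_le_sylow
  obtain ⟨g, rfl⟩ := MulAction.exists_smul_eq G P0 Q
  have hmem : ∀ (g z : G), z ∈ g • P0 ↔ g⁻¹ * z * g ∈ P0 := by
    intro g z
    change z ∈ ((g • P0 : Sylow p G) : Subgroup G) ↔ _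
    rw [Sylow.coe_subgroup_smul, Subgroup.mem_pointwise_smul_iff_inv_smul_mem]
    simp [MulAut.smul_def]
    rfl
  have hx1 : x ^ m ∈ P0 := hP0 (Subgroup.mem_zpowers _)
  have hy1 : y ^ m ∈ g • P0 := hQ (Subgroup.mem_zpowers _)
  obtain ⟨a, b, rfl⟩ := H.symm.gen g
  have hx2 : x ^ m ∈ x ^ b • P0 := by
    rw [hmem]
    have : (x ^ b)⁻¹ * x ^ m * x ^ b = x ^ m := by
      rw [← zpow_natCast]; group
    rwa [this]
  have hy2 : y ^ m ∈ x ^ b • P0 := by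
    rw [hmem] at hy1 ⊢
    convert hy1 using 1
    rw [← zpow_natCast]; group
  refine ⟨x ^ b • P0, hx2, hy2, ?_⟩
  generalize x ^ b • P0 = P at hx2 hy2
  have hxle : Subgroup.zpowers (x ^ m) ≤ P := by rwa [Subgroup.zpowers_le]
  have hyle : Subgroup.zpowers (y ^ m) ≤ P := by rwa [Subgroup.zpowers_le]
  let f : Subgroup.zpowers (x ^ m) × Subgroup.zpowers (y ^ m) → P :=
    fun z => ⟨(z.1 : G) * (z.2 : G), P.mul_mem (hxle z.1.2) (hyle z.2.2)⟩
  have hf : Function.Injective f := by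
    intro z w h
    apply H.prod_inj (Subgroup.zpowers (x ^ m)) (Subgroup.zpowers (y ^ m))
      (by rw [Subgroup.zpowers_le]; exact Subgroup.npow_mem_zpowers x m)
      (by rw [Subgroup.zpowers_le]; exact Subgroup.npow_mem_zpowers y m)
    exact congrArg Subtype.val h
  have hcard : Nat.card P ≤ Nat.card (Subgroup.zpowers (x ^ m) × Subgroup.zpowers (y ^ m)) := by
    rw [Nat.card_prod, Nat.card_zpowers, Nat.card_zpowers, ho x H.ox, ho y H.oy]
    apply Nat.le_of_dvd (by have := hp.out.pos; positivity)
    have h1 : Nat.card P ∣ n ^ 2 := by rw [← H.card]; exact Subgroup.card_subgroup_dvd_card _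
    obtain ⟨k, hk⟩ := P.isPGroup'.exists_card_eq
    change Nat.card P = _ at hk
    rw [hn, mul_pow, hk] at h1
    rw [hk, ← sq]
    exact ((hm.symm.pow_left k).pow_right 2).dvd_of_dvd_mul_right h1
  have hb := hf.bijective_of_nat_card_le hcard
  intro z hz
  obtain ⟨⟨⟨_, i, rfl⟩, ⟨_, j, rfl⟩⟩, h⟩ := hb.2 ⟨z, hz⟩
  exact ⟨i, j, (congrArg Subtype.val h).symm⟩

end IsoBi

namespace IsoBi

variable {G : Type*} [Group G] {n : ℕ} {x y : G} {α : G ≃* G}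

/-- The `k`-torsion subgroup of the (abelian) derived group. -/
def tors (H : IsoBi n x y α) (k : ℕ) : Subgroup G where
  carrier := {z | z ∈ commutator G ∧ z ^ k = 1}
  mul_mem' := by
    rintro a b ⟨ha, ha'⟩ ⟨hb, hb'⟩
    refine ⟨Subgroup.mul_mem _ ha hb, ?_⟩
    have : Commute a b := H.abel a ha b hb
    rw [this.mul_pow, ha', hb', one_mul]
  one_mem' := ⟨Subgroup.one_mem _, one_pow _⟩
  inv_mem' := by
    rintro a ⟨ha, ha'⟩
    exact ⟨Subgroup.inv_mem _ ha, by rw [inv_pow, ha', inv_one]⟩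

theorem mem_tors (H : IsoBi n x y α) (k : ℕ) (z : G) :
    z ∈ H.tors k ↔ z ∈ commutator G ∧ z ^ k = 1 := Iff.rfl

theorem tors_normal (H : IsoBi n x y α) (k : ℕ) : (H.tors k).Normal := by
  constructor
  rintro z ⟨hz, hz'⟩ g
  refine ⟨(inferInstance : (commutator G).Normal).conj_mem z hz g, ?_⟩
  rw [conj_pow, hz']; group

theorem alpha_comm (α : G ≃* G) (z : G) (hz : z ∈ commutator G) : α z ∈ commutator G := by
  have h : (commutator G).map α.toMonoidHom = commutator G :=
    Subgroup.characteristic_iff_map_eq.mp inferInstance α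
  rw [← h]
  exact Subgroup.mem_map_of_mem _ hz

theorem alpha_tors (H : IsoBi n x y α) (k : ℕ) : (H.tors k).map (α : G →* G) = H.tors k := by
  apply le_antisymm
  · rintro _ ⟨z, ⟨hz, hz'⟩, rfl⟩
    refine ⟨alpha_comm α z hz, ?_⟩
    rw [← map_pow, hz', map_one]
  · rintro z ⟨hz, hz'⟩
    refine ⟨α.symm z, ⟨alpha_comm α.symm z hz, ?_⟩, by simp⟩
    rw [← map_pow, hz', map_one]

theorem pow_card [Finite G] (H : IsoBi n x y α) (z : G) : z ^ (n ^ 2) = 1 := by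
  rw [← H.card]; exact pow_card_eq_one'

theorem tors_le_sylow [Finite G] (H : IsoBi n x y α) (p e : ℕ) (P : Sylow p G) :
    H.tors (p ^ e) ≤ P := by
  have := H.tors_normal (p ^ e)
  apply IsPGroup.le_sylow_of_normal
  rintro ⟨z, hz⟩
  exact ⟨e, Subtype.ext hz.2⟩

theorem comm_split [Finite G] (H : IsoBi n x y α) (a b : ℕ) (hab : n ^ 2 = a * b)
    (hc : Nat.Coprime a b) (z : G) (hz : z ∈ commutator G) :
    ∃ z1 ∈ H.tors a, ∃ z2 ∈ H.tors b, z = z1 * z2 := by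
  have h1 : (a : ℤ) * a.gcdA b + b * a.gcdB b = 1 := by
    rw [← Nat.gcd_eq_gcd_ab, hc.gcd_eq_one]; rfl
  have hn := H.pow_card z
  rw [hab] at hn
  have hn' : z ^ ((a : ℤ) * b) = 1 := by exact_mod_cast hn
  refine ⟨z ^ ((b : ℤ) * a.gcdB b), ⟨Subgroup.zpow_mem _ hz _, ?_⟩,
    z ^ ((a : ℤ) * a.gcdA b), ⟨Subgroup.zpow_mem _ hz _, ?_⟩, ?_⟩
  · rw [← zpow_natCast, ← zpow_mul, show (b : ℤ) * a.gcdB b * a = a * b * a.gcdB b by ring,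
      zpow_mul, hn', one_zpow]
  · rw [← zpow_natCast, ← zpow_mul, show (a : ℤ) * a.gcdA b * b = a * b * a.gcdA b by ring,
      zpow_mul, hn', one_zpow]
  · rw [← zpow_add, add_comm, h1, zpow_one]

theorem typeT [Finite G] (H : IsoBi n x y α) (p e m : ℕ) [hp : Fact p.Prime]
    (hn : n = p ^ e * m) (hm : Nat.Coprime m p)
    (hT : ∃ z ∈ H.tors (p ^ (2 * e)), x ^ p ^ e * z ≠ z * x ^ p ^ e) :
    x ^ m ∈ commutator G := by
  obtain ⟨P, hxP, hyP, hgen⟩ := H.exists_sylow p e m hn hm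
  have hn2 : n ^ 2 = p ^ (2 * e) * m ^ 2 := by rw [hn]; ring
  have hcop : Nat.Coprime (p ^ (2 * e)) (m ^ 2) := (hm.symm.pow_left _).pow_right _
  obtain ⟨z, hz, hzx⟩ := hT
  have hPO : ∀ w ∈ P, w ∈ H.tors (m ^ 2) → w = 1 := by
    rintro w hw ⟨_, hw'⟩
    obtain ⟨k, hk⟩ := P.isPGroup' ⟨w, hw⟩
    exact comm_pow_coprime (hm.pow_left 2) (congrArg Subtype.val hk) hw'
  have hOn := H.tors_normal (m ^ 2)
  set O := H.tors (m ^ 2) with hO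
  let π := QuotientGroup.mk' O
  have hπ : Function.Surjective π := QuotientGroup.mk'_surjective O
  have hker : ∀ w, π w = 1 ↔ w ∈ O := fun w => QuotientGroup.eq_one_iff w
  have hcomm : commutator (G ⧸ O) = (commutator G).map π := by
    rw [commutator_def, commutator_def, Subgroup.map_commutator,
      Subgroup.map_top_of_surjective _ hπ]
  have he : y ^ m ≠ 1 := by
    intro h
    have h1 := orderOf_dvd_of_pow_eq_one h
    rw [H.oy, hn] at h1
    have h0 : p ^ e ∣ m := dvd_trans (Dvd.intro _ rfl) h1
    have h2 : p ^ e = 1 := Nat.eq_one_of_dvd_coprimes (hm.pow_right e) h0 dvd_rfl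
    have h3 : z ^ p ^ (2 * e) = 1 := hz.2
    rw [mul_comm 2 e, pow_mul, h2, one_pow, pow_one] at h3
    rw [h3] at hzx
    simp at hzx
  let β : (G ⧸ O) ≃* (G ⧸ O) := QuotientGroup.congr O O α (H.alpha_tors (m ^ 2))
  have hβ : ∀ w, β (π w) = π (α w) := fun w => rfl
  have hxx : ∀ w : G, ∀ a b : ℕ, w ^ a * w ^ b = w ^ b * w ^ a := fun w a b => by
    rw [← pow_add, ← pow_add, add_comm]
  have := core_lemma p ((P : Subgroup G).map π) (P.isPGroup'.map π)
    (by
      rw [hcomm]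
      rintro _ ⟨c, hc, rfl⟩
      obtain ⟨z1, hz1, z2, hz2, rfl⟩ := H.comm_split _ _ hn2 hcop c hc
      refine ⟨z1, H.tors_le_sylow p _ P hz1, ?_⟩
      rw [map_mul, (hker z2).mpr hz2, mul_one])
    (by
      rw [hcomm]
      rintro _ ⟨a, ha, rfl⟩ _ ⟨b, hb, rfl⟩
      rw [← map_mul, H.abel a ha b hb, map_mul])
    (π (x ^ m)) (π (y ^ m)) (π (x ^ p ^ e)) (π (y ^ p ^ e))
    (Subgroup.mem_map_of_mem _ hxP) (Subgroup.mem_map_of_mem _ hyP)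
    (by
      rintro _ ⟨w, hw, rfl⟩
      obtain ⟨i, j, rfl⟩ := hgen w hw
      exact ⟨i, j, by simp⟩)
    (by
      rintro ⟨i, hi⟩
      have h1 : π ((x ^ m) ^ (-i) * y ^ m) = 1 := by
        rw [map_mul, map_zpow, ← hi]; simp
      have h2 := hPO _ (P.mul_mem (Subgroup.zpow_mem _ hxP (-i)) hyP) ((hker _).mp h1)
      have h3 := H.inter (m * -i) m (by rw [zpow_mul, zpow_natCast, zpow_natCast]; exact h2)
      exact he (by exact_mod_cast h3.2))
    (by rw [← map_mul, ← map_mul, hxx]) (by rw [← map_mul, ← map_mul, hxx]) m hm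
    (by rw [← map_pow, ← pow_mul, ← hn, ← H.ox, pow_orderOf_eq_one, map_one])
    β (by rw [hβ, map_pow, H.ax]) (by rw [hβ, map_pow, H.ay]) (by rw [hβ, map_pow, H.ax])
  rcases this with h | h
  · exfalso
    have h1 := h (π z) (Subgroup.mem_map_of_mem _ (H.tors_le_sylow p _ P hz))
    have h2 : π ((z)⁻¹ * (x ^ p ^ e)⁻¹ * z * x ^ p ^ e) = 1 := by
      simp only [map_mul, map_inv]
      rw [mul_assoc, ← h1]; group
    have h3 : z⁻¹ * (x ^ p ^ e)⁻¹ * z * x ^ p ^ e ∈ H.tors (p ^ (2 * e)) := by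
      have := (H.tors_normal (p ^ (2 * e))).conj_mem z hz (x ^ p ^ e)⁻¹
      have := Subgroup.mul_mem _ (Subgroup.inv_mem _ hz) this
      convert this using 1
      group
    have h4 := hPO _ (H.tors_le_sylow p _ P h3) ((hker _).mp h2)
    apply hzx
    calc x ^ p ^ e * z = x ^ p ^ e * z * (z⁻¹ * (x ^ p ^ e)⁻¹ * z * x ^ p ^ e) := by
          rw [h4, mul_one]
      _ = _ := by group
  · have h1 := h (Subgroup.mem_map_of_mem π hxP)
    rw [hcomm] at h1
    obtain ⟨c, hc, hcx⟩ := h1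
    obtain ⟨z1, hz1, z2, hz2, rfl⟩ := H.comm_split _ _ hn2 hcop c hc
    rw [map_mul, (hker z2).mpr hz2, mul_one] at hcx
    have h2 := hPO (z1⁻¹ * x ^ m) (P.mul_mem (P.inv_mem (H.tors_le_sylow p _ P hz1)) hxP)
      ((hker _).mp (by rw [map_mul, map_inv, hcx, inv_mul_cancel]))
    rw [inv_mul_eq_one] at h2
    rw [← h2]
    exact hz1.1

theorem noComm [Finite G] (H : IsoBi n x y α) (p e m : ℕ) [hp : Fact p.Prime]
    (hn : n = p ^ e * m) (hm : Nat.Coprime m p) (he : 0 < e)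
    (hT : ∃ z ∈ H.tors (p ^ (2 * e)), x ^ p ^ e * z ≠ z * x ^ p ^ e) :
    x ^ p ^ e * y ^ (n / p) ≠ y ^ (n / p) * x ^ p ^ e := by
  intro hcom
  have hxm := H.typeT p e m hn hm hT
  have hym : y ^ m ∈ commutator G := by
    have := alpha_comm α _ hxm
    rwa [map_pow, H.ax] at this
  obtain ⟨P, hxP, hyP, hgen⟩ := H.exists_sylow p e m hn hm
  obtain ⟨z, hz, hzx⟩ := hT
  set g := x ^ p ^ e with hg
  have hNn := H.tors_normal (p ^ (2 * e))
  set N := H.tors (p ^ (2 * e)) with hN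
  have hz' : g⁻¹ * z * g ∈ N := by
    have := hNn.conj_mem z hz g⁻¹
    rwa [inv_inv] at this
  have hd0 : z⁻¹ * (g⁻¹ * z * g) ∈ N := Subgroup.mul_mem _ (Subgroup.inv_mem _ hz) hz'
  have hd0' : z⁻¹ * (g⁻¹ * z * g) ≠ 1 := by
    intro h
    rw [inv_mul_eq_one] at h
    apply hzx
    calc g * z = g * (g⁻¹ * z * g) := by rw [← h]
      _ = z * g := by group
  obtain ⟨k, hk⟩ : ∃ k, orderOf ((z⁻¹ * (g⁻¹ * z * g)) ^ k) = p := by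
    obtain ⟨r, hr, hr'⟩ := (Nat.dvd_prime_pow hp.out).mp (orderOf_dvd_of_pow_eq_one hd0.2)
    have hr0 : r ≠ 0 := by
      rintro rfl
      exact hd0' (orderOf_eq_one_iff.mp (by simpa using hr'))
    obtain ⟨r, rfl⟩ := Nat.exists_eq_succ_of_ne_zero hr0
    refine ⟨p ^ r, ?_⟩
    rw [orderOf_pow_of_dvd (by have := hp.out.pos; positivity), hr', Nat.succ_eq_add_one, pow_succ,
      Nat.mul_div_cancel_left _ (by have := hp.out.pos; positivity)]
    rw [hr', Nat.succ_eq_add_one, pow_succ]; exact Dvd.intro _ rfl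
  set d := (z⁻¹ * (g⁻¹ * z * g)) ^ k with hd
  have hdN : d ∈ N := Subgroup.pow_mem _ hd0 k
  have hdp : d ^ p = 1 := by rw [← hk]; exact pow_orderOf_eq_one d
  have hd1 : g⁻¹ * z ^ k * g = z ^ k * d := by
    have e1 : Commute z⁻¹ (g⁻¹ * z * g) :=
      H.abel _ (Subgroup.inv_mem _ hz.1) _ hz'.1
    have e2 := conj_pow (a := g⁻¹) (b := z) (i := k)
    rw [inv_inv] at e2
    rw [hd, e1.mul_pow, e2]; group
  obtain ⟨i, j, hij⟩ := hgen d (H.tors_le_sylow p _ P hdN)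
  have hgd : Commute g d := by
    rw [hij]
    have c1 : Commute g ((x ^ m) ^ i) := by
      rw [hg]; exact ((Commute.pow_pow_self x _ _).zpow_right i)
    refine c1.mul_right ?_
    have e1 : Commute ((x ^ m) ^ i) ((y ^ m) ^ j) :=
      H.abel _ (Subgroup.zpow_mem _ hxm i) _ (Subgroup.zpow_mem _ hym j)
    rw [hij, e1.mul_pow] at hdp
    have e2 : y ^ ((m : ℤ) * j * p) = 1 := by
      have := (H.inter (m * i * p) (m * j * p) (by
        simpa only [zpow_mul, zpow_natCast] using hdp)).2
      exact this
    rw [← orderOf_dvd_iff_zpow_eq_one, H.oy, hn] at e2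
    obtain ⟨e', rfl⟩ := Nat.exists_eq_succ_of_ne_zero he.ne'
    have e3 : n / p = p ^ e' * m := by
      rw [hn, Nat.succ_eq_add_one, pow_succ, mul_right_comm, Nat.mul_div_cancel _ hp.out.pos]
    have e4 : ((p ^ e' * m : ℕ) : ℤ) ∣ m * j := by
      have hp0 : (p : ℤ) ≠ 0 := by exact_mod_cast hp.out.ne_zero
      apply Int.dvd_of_mul_dvd_mul_right hp0
      convert e2 using 1
      push_cast [Nat.succ_eq_add_one]; ring
    obtain ⟨l, hl⟩ := e4
    have e5 : (y ^ m) ^ j = (y ^ (n / p)) ^ l := by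
      rw [← zpow_natCast, ← zpow_mul, hl, zpow_mul, zpow_natCast, e3]
    rw [e5]
    exact Commute.zpow_right hcom l
  have hk2 : ∀ r : ℕ, (g ^ r)⁻¹ * z ^ k * g ^ r = z ^ k * d ^ r := by
    intro r
    induction r with
    | zero => simp
    | succ r ih =>
      have : (g ^ (r + 1))⁻¹ * z ^ k * g ^ (r + 1) = g⁻¹ * ((g ^ r)⁻¹ * z ^ k * g ^ r) * g := by
        rw [pow_succ]; group
      have e1 : g⁻¹ * d ^ r * g = d ^ r := by
        rw [mul_assoc, ← (hgd.pow_right r).eq, inv_mul_cancel_left]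
      have e2 : g⁻¹ * (z ^ k * d ^ r) * g = (g⁻¹ * z ^ k * g) * (g⁻¹ * d ^ r * g) := by group
      rw [this, ih, e2, hd1, e1, pow_succ', mul_assoc]
  have hgm : g ^ m = 1 := by rw [hg, ← pow_mul, ← hn, ← H.ox, pow_orderOf_eq_one]
  have h1 := hk2 m
  rw [hgm] at h1
  have h2 : d ^ m = 1 := by simpa using h1
  have h3 := comm_pow_coprime hm (k := 1) (by rwa [pow_one]) h2
  rw [h3, orderOf_one] at hk
  exact hp.out.one_lt.ne hk

end IsoBi

theorem pow_mem_of_primes {G : Type*} [Group G] (K : Subgroup G) (x : G) (n a b : ℕ)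
    (hn : n ≠ 0) (hx : x ^ n = 1) (hab : n = a * b)
    (h : ∀ p : ℕ, p.Prime → p ∣ b → x ^ (n / p ^ n.factorization p) ∈ K) : x ^ a ∈ K := by
  obtain ⟨k, hk⟩ := Int.subgroup_cyclic ((Subgroup.toAddSubgroup K).comap
    (zmultiplesHom (Additive G) (Additive.ofMul x)))
  have hmem : ∀ i : ℤ, x ^ i ∈ K ↔ k ∣ i := by
    intro i
    rw [← Int.mem_zmultiples_iff, ← AddSubgroup.zmultiples_eq_closure] at *
    rw [← hk]
    rfl
  have h1 : k.natAbs ∣ n := by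
    have := (hmem n).mp (by rw [zpow_natCast, hx]; exact K.one_mem)
    exact Int.natAbs_dvd_natAbs.mpr this
  have h2 : Nat.Coprime k.natAbs b := by
    apply Nat.coprime_of_dvd
    intro p hp hpk hpb
    have h3 := h p hp hpb
    rw [← zpow_natCast, hmem] at h3
    have h4 : k.natAbs ∣ n / p ^ n.factorization p := Int.natAbs_dvd_natAbs.mpr h3
    exact Nat.not_dvd_ordCompl hp hn (hpk.trans h4)
  rw [hab] at h1
  have h5 := h2.dvd_of_dvd_mul_right h1
  rw [← zpow_natCast, hmem]
  exact Int.natAbs_dvd.mp (by exact_mod_cast h5)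

/-- Iterated norm of `w` under conjugation by `a`. -/
def Nm {G : Type*} [Group G] (a w : G) : ℕ → G
  | 0 => 1
  | k + 1 => a⁻¹ * Nm a w k * a * w

theorem Nm_pow {G : Type*} [Group G] (a c : G) (k : ℕ) : (a * c) ^ k = a ^ k * Nm a c k := by
  induction k with
  | zero => simp [Nm]
  | succ k ih => rw [pow_succ, ih, Nm, pow_succ]; group

theorem Nm_mem {G : Type*} [Group G] (K : Subgroup G) (hK : K.Normal) (a w : G) (hw : w ∈ K)
    (k : ℕ) : Nm a w k ∈ K := by
  induction k with
  | zero => exact K.one_mem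
  | succ k ih =>
    have := hK.conj_mem _ ih a⁻¹
    rw [inv_inv] at this
    exact K.mul_mem this hw

theorem Nm_comm {G : Type*} [Group G] (a w : G) (h : a * w = w * a) (k : ℕ) :
    Nm a w k = w ^ k := by
  induction k with
  | zero => simp [Nm]
  | succ k ih =>
    have : Commute a (w ^ k) := Commute.pow_right h k
    rw [Nm, ih, pow_succ, mul_assoc a⁻¹, ← this.eq, inv_mul_cancel_left]

namespace IsoBi

variable {G : Type*} [Group G] {n : ℕ} {x y : G} {α : G ≃* G}

theorem Nm_mul (H : IsoBi n x y α) (a w v : G) (hw : w ∈ commutator G) (hv : v ∈ commutator G)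
    (k : ℕ) : Nm a (w * v) k = Nm a w k * Nm a v k := by
  induction k with
  | zero => simp [Nm]
  | succ k ih =>
    have h1 := (inferInstance : (commutator G).Normal).conj_mem _
      (Nm_mem _ inferInstance a v hv k) a⁻¹
    rw [inv_inv] at h1
    have h2 := H.abel _ h1 _ hw
    rw [Nm, Nm, Nm, ih]
    calc a⁻¹ * (Nm a w k * Nm a v k) * a * (w * v)
        = (a⁻¹ * Nm a w k * a) * ((a⁻¹ * Nm a v k * a) * w) * v := by group
      _ = _ := by rw [h2]; group

theorem Nm_npow (H : IsoBi n x y α) (a w : G) (hw : w ∈ commutator G) (M k : ℕ) :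
    Nm a (w ^ M) k = Nm a w k ^ M := by
  induction M with
  | zero => rw [pow_zero, pow_zero, Nm_comm a 1 (by simp), one_pow]
  | succ M ih => rw [pow_succ, H.Nm_mul _ _ _ (Subgroup.pow_mem _ hw M) hw, ih, pow_succ]

theorem Nm_commutator (H : IsoBi n x y α) (a b : G) (A M : ℕ) (hA : a ^ A = 1) :
    Nm a ((a⁻¹ * b⁻¹ * a * b) ^ M) A = 1 := by
  rw [H.Nm_npow _ _ (comm_mem a b)]
  have h1 := Nm_pow a (a⁻¹ * b⁻¹ * a * b) A
  have h2 : a * (a⁻¹ * b⁻¹ * a * b) = b⁻¹ * a * b⁻¹⁻¹ := by group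
  rw [h2, conj_pow, hA] at h1
  have h3 : Nm a (a⁻¹ * b⁻¹ * a * b) A = 1 := by simpa using h1.symm
  rw [h3, one_pow]

/-- Primes of type `T`. -/
def TT (H : IsoBi n x y α) (p : ℕ) : Prop :=
  ∃ z ∈ H.tors (p ^ (2 * n.factorization p)),
    x ^ p ^ n.factorization p * z ≠ z * x ^ p ^ n.factorization p

theorem TT_symm (H : IsoBi n x y α) (p : ℕ) : H.TT p → H.symm.TT p := by
  rintro ⟨z, ⟨hz, hz'⟩, hne⟩
  refine ⟨α z, ⟨alpha_comm α z hz, by rw [← map_pow, hz', map_one]⟩, fun h => hne ?_⟩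
  apply α.injective
  rwa [map_mul, map_mul, map_pow, H.ax]

theorem decomp (H : IsoBi n x y α) (p : ℕ) (hp : p.Prime) :
    n = p ^ n.factorization p * (n / p ^ n.factorization p) ∧
      Nat.Coprime (n / p ^ n.factorization p) p :=
  ⟨(Nat.ordProj_mul_ordCompl_eq_self n p).symm, (Nat.coprime_ordCompl hp H.npos.ne').symm⟩

theorem pow_n (H : IsoBi n x y α) : x ^ n = 1 := by rw [← H.ox, pow_orderOf_eq_one]

theorem xs_mem [Finite G] (H : IsoBi n x y α) (s t : ℕ) (hst : n = s * t)
    (hT : ∀ p : ℕ, p.Prime → p ∣ t → H.TT p) : x ^ s ∈ commutator G := by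
  refine pow_mem_of_primes _ x n s t H.npos.ne' H.pow_n hst ?_
  intro p hp hpt
  have : Fact p.Prime := ⟨hp⟩
  obtain ⟨h1, h2⟩ := H.decomp p hp
  exact H.typeT p _ _ h1 h2 (hT p hp hpt)

theorem no_fix [Finite G] (H : IsoBi n x y α) (s t : ℕ) (hst : n = s * t)
    (hT : ∀ p : ℕ, p.Prime → p ∣ t → H.TT p) (i : ℤ) (hi : x ^ (i * t) = 1)
    (hc : x ^ i * y = y * x ^ i) : x ^ i = 1 := by
  by_contra hne
  have hd : orderOf (x ^ i) ≠ 1 := fun h => hne (orderOf_eq_one_iff.mp h)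
  obtain ⟨p, hp, hpd⟩ := Nat.exists_prime_and_dvd hd
  have hdt : orderOf (x ^ i) ∣ t := by
    apply orderOf_dvd_of_pow_eq_one
    rw [← zpow_natCast, ← zpow_mul, hi]
  have : Fact p.Prime := ⟨hp⟩
  obtain ⟨h1, h2⟩ := H.symm.decomp p hp
  have hpn : p ∣ n := by rw [hst]; exact (hpd.trans hdt).trans (Dvd.intro_left _ rfl)
  have he : 0 < n.factorization p := hp.factorization_pos_of_dvd H.npos.ne' hpn
  apply H.symm.noComm p _ _ h1 h2 he (H.TT_symm p (hT p hp (hpd.trans hdt)))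
  -- `x ^ (n / p)` is a power of `x ^ i`
  have hmem : x ^ (n / p) ∈ Subgroup.zpowers (x ^ i) := by
    have hg : x ^ ((i.gcd n : ℕ) : ℤ) ∈ Subgroup.zpowers (x ^ i) := by
      rw [Int.gcd_eq_gcd_ab, zpow_add, zpow_mul, zpow_mul x (n : ℤ), zpow_natCast x n, H.pow_n,
        one_zpow, mul_one]
      exact Subgroup.zpow_mem_zpowers _ _
    have ho : orderOf (x ^ i) * i.gcd n ∣ n := by
      have hgn : i.gcd n ∣ n := by
        have := Int.gcd_dvd_right i n
        exact_mod_cast this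
      have h3 : orderOf (x ^ i) ∣ n / i.gcd n := by
        apply orderOf_dvd_of_pow_eq_one
        obtain ⟨l, hl⟩ := Int.gcd_dvd_left i n
        obtain ⟨r, hr⟩ := hgn
        have hg0 : 0 < i.gcd n := Int.gcd_pos_of_ne_zero_right _ (by exact_mod_cast H.npos.ne')
        have : n / i.gcd n = r := by
          exact Nat.div_eq_of_eq_mul_right hg0 hr
        rw [this, ← zpow_natCast, ← zpow_mul]
        have : i * r = n * l := by
          conv_lhs => rw [hl]
          conv_rhs => rw [hr]
          push_cast; ring
        rw [this, zpow_mul, zpow_natCast, H.pow_n, one_zpow]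
      rw [mul_comm]; exact Nat.mul_dvd_of_dvd_div hgn h3
    have h4 : i.gcd n ∣ n / p := by
      apply Nat.dvd_div_of_mul_dvd
      exact (Nat.mul_dvd_mul_right hpd _).trans ho
    obtain ⟨l, hl⟩ := h4
    rw [hl, pow_mul]
    exact Subgroup.pow_mem _ (by exact_mod_cast hg) l
  obtain ⟨l, hl⟩ := hmem
  rw [← hl]
  have c1 : Commute (x ^ i) y := hc
  exact ((c1.zpow_left l).pow_right _).symm

theorem conjY [Finite G] (H : IsoBi n x y α) (s t : ℕ) (hst : n = s * t)
    (hT : ∀ p : ℕ, p.Prime → p ∣ t → H.TT p) (g : G) :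
    g⁻¹ * y ^ s * g ∈ Subgroup.zpowers (y ^ s) := by
  have ht0 : (t : ℤ) ≠ 0 := by
    rintro h
    have : t = 0 := by exact_mod_cast h
    have h2 := H.npos
    rw [hst, this] at h2; simp at h2
  have hys : y ^ s ∈ commutator G := by
    have := alpha_comm α _ (H.xs_mem s t hst hT)
    rwa [map_pow, H.ax] at this
  have hw : g⁻¹ * y ^ s * g ∈ commutator G := by
    have := (inferInstance : (commutator G).Normal).conj_mem _ hys g⁻¹
    rwa [inv_inv] at this
  have hwy : y⁻¹ * (g⁻¹ * y ^ s * g) * y = g⁻¹ * y ^ s * g := by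
    have hc := comm_mem g y
    have h1 := H.abel _ hw _ hc
    have e1 : y⁻¹ * (g⁻¹ * y ^ s * g) * y
        = (g⁻¹ * y⁻¹ * g * y)⁻¹ * (g⁻¹ * (y⁻¹ * y ^ s * y) * g) * (g⁻¹ * y⁻¹ * g * y) := by group
    have e2 : y⁻¹ * y ^ s * y = y ^ s := by
      rw [mul_assoc, ← pow_succ, pow_succ', inv_mul_cancel_left]
    rw [e1, e2, mul_assoc, h1, inv_mul_cancel_left]
  obtain ⟨i, j, hij⟩ := H.gen (g⁻¹ * y ^ s * g)
  have hxi : x ^ i * y = y * x ^ i := by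
    rw [hij] at hwy
    have : y⁻¹ * x ^ i * y = x ^ i := by
      have e : y⁻¹ * (x ^ i * y ^ j) * y = y⁻¹ * x ^ i * y * y ^ j := by group
      rw [e] at hwy
      exact mul_right_cancel hwy
    calc x ^ i * y = y * (y⁻¹ * x ^ i * y) := by group
      _ = _ := by rw [this]
  have hwt : (x ^ i * y ^ j) ^ t = 1 := by
    rw [← hij]
    have := conj_pow (a := g⁻¹) (b := y ^ s) (i := t)
    rw [inv_inv] at this
    rw [this, ← pow_mul, ← hst, H.symm.pow_n]; group
  have hc : Commute (x ^ i) (y ^ j) := Commute.zpow_right hxi j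
  rw [hc.mul_pow] at hwt
  obtain ⟨h1, h2⟩ := H.inter (i * t) (j * t) (by
    simpa only [zpow_mul, zpow_natCast] using hwt)
  have h3 := H.no_fix s t hst hT i h1 hxi
  rw [hij, h3, one_mul]
  rw [← orderOf_dvd_iff_zpow_eq_one, H.oy, hst] at h2
  have h4 : (s : ℤ) ∣ j := by
    apply Int.dvd_of_mul_dvd_mul_right ht0
    exact_mod_cast h2
  obtain ⟨l, hl⟩ := h4
  exact ⟨l, by simp only [hl, zpow_mul, zpow_natCast]⟩

theorem normalY [Finite G] (H : IsoBi n x y α) (s t : ℕ) (hst : n = s * t)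
    (hT : ∀ p : ℕ, p.Prime → p ∣ t → H.TT p) : (Subgroup.zpowers (y ^ s)).Normal := by
  constructor
  rintro _ ⟨i, rfl⟩ g
  have := Subgroup.zpow_mem _ (H.conjY s t hst hT g⁻¹) i
  rw [inv_inv, conj_zpow] at this
  exact this

theorem half1 [Finite G] (H : IsoBi n x y α) (u : ℕ) (hu : u.Prime) (hS : ¬ H.TT u)
    (a b : G) (ha : a ∈ Subgroup.zpowers (x ^ u ^ n.factorization u)) (A : ℕ) (hA : a ^ A = 1)
    (hAu : Nat.Coprime A u) :
    (a⁻¹ * b⁻¹ * a * b) ^ ((n / u ^ n.factorization u) ^ 2) = 1 := by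
  obtain ⟨h1, h2⟩ := H.decomp u hu
  set e := n.factorization u with he
  set m := n / u ^ e with hm
  have hmem : (a⁻¹ * b⁻¹ * a * b) ^ (m ^ 2) ∈ H.tors (u ^ (2 * e)) := by
    refine ⟨Subgroup.pow_mem _ (comm_mem a b) _, ?_⟩
    rw [← pow_mul, show m ^ 2 * u ^ (2 * e) = (u ^ e * m) ^ 2 by ring, ← h1, H.pow_card]
  have hcomm : x ^ u ^ e * (a⁻¹ * b⁻¹ * a * b) ^ (m ^ 2)
      = (a⁻¹ * b⁻¹ * a * b) ^ (m ^ 2) * x ^ u ^ e := by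
    by_contra h
    exact hS ⟨_, hmem, h⟩
  obtain ⟨l, hl⟩ := ha
  have hca : a * (a⁻¹ * b⁻¹ * a * b) ^ (m ^ 2) = (a⁻¹ * b⁻¹ * a * b) ^ (m ^ 2) * a := by
    have c1 : Commute (x ^ u ^ e) ((a⁻¹ * b⁻¹ * a * b) ^ (m ^ 2)) := hcomm
    have c2 := c1.zpow_left l
    have hl' : (x ^ u ^ e) ^ l = a := hl
    rw [hl'] at c2
    exact c2
  have h3 := H.Nm_commutator a b A (m ^ 2) hA
  rw [Nm_comm _ _ hca] at h3
  exact comm_pow_coprime hAu hmem.2 h3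

theorem half2 [Finite G] (H : IsoBi n x y α) (s t : ℕ) (hst : n = s * t)
    (hT : ∀ p : ℕ, p.Prime → p ∣ t → H.TT p) (u : ℕ) (hu : u.Prime) (hut : u ∣ t)
    (hsu : s ∣ n / u ^ n.factorization u)
    (a b : G) (ha : a ∈ Subgroup.zpowers x) (A : ℕ) (hA : a ^ A = 1)
    (hAu : Nat.Coprime A u) :
    (a⁻¹ * b⁻¹ * a * b) ^ ((n / u ^ n.factorization u) ^ 2) ∈ Subgroup.zpowers y := by
  obtain ⟨h1, h2⟩ := H.decomp u hu
  have : Fact u.Prime := ⟨hu⟩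
  have hxm := H.typeT u _ _ h1 h2 (hT u hu hut)
  have hym : y ^ (n / u ^ n.factorization u) ∈ commutator G := by
    have := alpha_comm α _ hxm
    rwa [map_pow, H.ax] at this
  set e := n.factorization u with he
  set m := n / u ^ e with hm
  have hmem : (a⁻¹ * b⁻¹ * a * b) ^ (m ^ 2) ∈ H.tors (u ^ (2 * e)) := by
    refine ⟨Subgroup.pow_mem _ (comm_mem a b) _, ?_⟩
    rw [← pow_mul, show m ^ 2 * u ^ (2 * e) = (u ^ e * m) ^ 2 by ring, ← h1, H.pow_card]
  obtain ⟨P, hxP, hyP, hgen⟩ := H.exists_sylow u e m h1 h2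
  obtain ⟨i, j, hij⟩ := hgen _ (H.tors_le_sylow u _ P hmem)
  have h3 := H.Nm_commutator a b A (m ^ 2) hA
  have hax : a * (x ^ m) ^ i = (x ^ m) ^ i * a := by
    obtain ⟨l, rfl⟩ := ha
    exact (((Commute.refl x).pow_right m).zpow_zpow l i).eq
  rw [hij, H.Nm_mul _ _ _ (Subgroup.zpow_mem _ hxm i) (Subgroup.zpow_mem _ hym j),
    Nm_comm _ _ hax] at h3
  have h4 : Nm a ((y ^ m) ^ j) A ∈ Subgroup.zpowers (y ^ s) := by
    apply Nm_mem _ (H.normalY s t hst hT)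
    obtain ⟨l, hl⟩ := hsu
    rw [hl, pow_mul]
    exact Subgroup.zpow_mem _ (Subgroup.pow_mem _ (Subgroup.mem_zpowers _) l) j
  obtain ⟨k, hk⟩ := h4
  have hk' : (y ^ s) ^ k = Nm a ((y ^ m) ^ j) A := hk
  rw [← hk'] at h3
  have h5 := (H.inter (m * i * A) (s * k) (by
    simpa only [zpow_mul, zpow_natCast] using h3)).1
  have h6 : ((x ^ m) ^ i) ^ A = 1 := by simpa only [zpow_mul, zpow_natCast] using h5
  have h7 : ((x ^ m) ^ i) ^ u ^ e = 1 := by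
    rw [← zpow_natCast, zpow_comm, zpow_natCast, ← pow_mul, mul_comm, ← h1, H.pow_n, one_zpow]
  rw [hij, comm_pow_coprime hAu h7 h6, one_mul]
  exact Subgroup.zpow_mem _ (Subgroup.pow_mem _ (Subgroup.mem_zpowers _) m) j

theorem commS [Finite G] (H : IsoBi n x y α) (s t : ℕ) (hst : n = s * t)
    (hc : Nat.Coprime s t)
    (hT : ∀ p : ℕ, p.Prime → p ∣ t → H.TT p) (hS : ∀ p : ℕ, p.Prime → p ∣ s → ¬ H.TT p)
    (q r : ℕ) (hq : q.Prime) (hr : r.Prime) (hqr : q ≠ r) (hqs : q ∣ s) (hrs : r ∣ s) :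
    Commute (x ^ (n / q ^ n.factorization q)) (y ^ (n / r ^ n.factorization r)) := by
  set a := x ^ (n / q ^ n.factorization q) with ha
  set b := y ^ (n / r ^ n.factorization r) with hb
  have haA : a ^ q ^ n.factorization q = 1 := by
    rw [ha, ← pow_mul, mul_comm, ← (H.decomp q hq).1, H.pow_n]
  have hbB : b ^ r ^ n.factorization r = 1 := by
    rw [hb, ← pow_mul, mul_comm, ← (H.decomp r hr).1, H.symm.pow_n]
  have hdv : ∀ v w : ℕ, v.Prime → w.Prime → v ≠ w →
      v ^ n.factorization v ∣ n / w ^ n.factorization w := by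
    intro v w hv hw hvw
    have h1 : v ^ n.factorization v ∣ w ^ n.factorization w * (n / w ^ n.factorization w) := by
      rw [← (H.decomp w hw).1]; exact Nat.ordProj_dvd n v
    exact (((Nat.coprime_primes hv hw).mpr hvw).pow _ _).dvd_of_dvd_mul_left h1
  have hinv : b⁻¹ * a⁻¹ * b * a = (a⁻¹ * b⁻¹ * a * b)⁻¹ := by group
  suffices hone : a⁻¹ * b⁻¹ * a * b = 1 by
    calc a * b = b * a * (a⁻¹ * b⁻¹ * a * b) := by group
      _ = b * a := by rw [hone, mul_one]
  by_contra hne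
  have hd : orderOf (a⁻¹ * b⁻¹ * a * b) ≠ 1 := fun h => hne (orderOf_eq_one_iff.mp h)
  obtain ⟨u, hu, hud⟩ := Nat.exists_prime_and_dvd hd
  have hun : u ∣ n := by
    apply hu.dvd_of_dvd_pow (n := 2)
    rw [← H.card]
    exact hud.trans (orderOf_dvd_natCard _)
  suffices hpow : (a⁻¹ * b⁻¹ * a * b) ^ ((n / u ^ n.factorization u) ^ 2) = 1 by
    have h1 := hud.trans (orderOf_dvd_of_pow_eq_one hpow)
    exact Nat.not_dvd_ordCompl hu H.npos.ne' (hu.dvd_of_dvd_pow h1)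
  rw [hst] at hun
  rcases (Nat.Prime.dvd_mul hu).mp hun with hus | hut
  · have hSu := hS u hu hus
    have hSu' : ¬ H.symm.TT u := fun h => hSu (H.symm.TT_symm u h)
    by_cases huq : u = q
    · have hur : u ≠ r := huq ▸ hqr
      have := H.symm.half1 u hu hSu' b a (by
        obtain ⟨l, hl⟩ := hdv u r hu hr hur
        rw [hb, hl, pow_mul]; exact Subgroup.npow_mem_zpowers _ _) _ hbB
        (((Nat.coprime_primes hr hu).mpr hur.symm).pow_left _)
      rw [hinv, inv_pow, inv_eq_one] at this
      exact this
    · exact H.half1 u hu hSu a b (by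
        obtain ⟨l, hl⟩ := hdv u q hu hq huq
        rw [ha, hl, pow_mul]; exact Subgroup.npow_mem_zpowers _ _) _ haA
        (((Nat.coprime_primes hq hu).mpr (Ne.symm huq)).pow_left _)
  · have hus : Nat.Coprime u s := (Nat.Coprime.coprime_dvd_right hut hc).symm
    have huq : Nat.Coprime q u := (Nat.Coprime.coprime_dvd_right hqs hus).symm
    have hur : Nat.Coprime r u := (Nat.Coprime.coprime_dvd_right hrs hus).symm
    have hsu : s ∣ n / u ^ n.factorization u := by
      have h1 : s ∣ u ^ n.factorization u * (n / u ^ n.factorization u) := by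
        rw [← (H.decomp u hu).1, hst]; exact Dvd.intro _ rfl
      exact (hus.symm.pow_right _).dvd_of_dvd_mul_left h1
    have k1 := H.half2 s t hst hT u hu hut hsu a b (Subgroup.npow_mem_zpowers _ _) _ haA
      (huq.pow_left _)
    have k2 := H.symm.half2 s t hst (fun p hp h => H.TT_symm p (hT p hp h)) u hu hut hsu b a
      (Subgroup.npow_mem_zpowers _ _) _ hbB (hur.pow_left _)
    rw [hinv, inv_pow, Subgroup.inv_mem_iff] at k2
    obtain ⟨i, hi⟩ := k1
    obtain ⟨j, hj⟩ := k2
    have hi' : y ^ i = (a⁻¹ * b⁻¹ * a * b) ^ ((n / u ^ n.factorization u) ^ 2) := hi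
    have hj' : x ^ j = (a⁻¹ * b⁻¹ * a * b) ^ ((n / u ^ n.factorization u) ^ 2) := hj
    have := (H.inter j (-i) (by rw [hj', zpow_neg, hi', mul_inv_cancel])).1
    rw [← hj', this]

end IsoBi

namespace IsoBi
variable {G : Type*} [Group G] {n : ℕ} {x y : G} {α : G ≃* G}

theorem exists_nilp [Finite G] (H : IsoBi n x y α) (s t : ℕ) (hst : n = s * t)
    (hc : Nat.Coprime s t)
    (hT : ∀ p : ℕ, p.Prime → p ∣ t → H.TT p) (hS : ∀ p : ℕ, p.Prime → p ∣ s → ¬ H.TT p) :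
    ∃ K : Subgroup G, Group.IsNilpotent K ∧ Nat.Coprime (Nat.card K) t ∧ x ^ t ∈ K ∧
      y ^ t ∈ K := by
  classical
  have hs0 : s ≠ 0 := by
    rintro rfl
    have := H.npos
    simp [hst] at this
  have hpr : ∀ q : s.primeFactors, (q : ℕ).Prime := fun q => Nat.prime_of_mem_primeFactors q.2
  have hdv : ∀ q : s.primeFactors, (q : ℕ) ∣ s := fun q => Nat.dvd_of_mem_primeFactors q.2
  let P : s.primeFactors → Subgroup G := fun q => Subgroup.closure
    {x ^ (n / (q : ℕ) ^ n.factorization q), y ^ (n / (q : ℕ) ^ n.factorization q)}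
  have hP : ∀ q : s.primeFactors, IsPGroup (q : ℕ) (P q) := by
    intro q
    have : Fact (q : ℕ).Prime := ⟨hpr q⟩
    obtain ⟨h1, h2⟩ := H.decomp q (hpr q)
    obtain ⟨Q, hx, hy, -⟩ := H.exists_sylow q _ _ h1 h2
    have hle : P q ≤ Q := by
      rw [Subgroup.closure_le]
      rintro z (rfl | rfl)
      · exact hx
      · exact hy
    exact Q.isPGroup'.to_le hle
  have hnil : ∀ q, Group.IsNilpotent (P q) := fun q => by
    have : Fact (q : ℕ).Prime := ⟨hpr q⟩
    exact (hP q).isNilpotent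
  have hcomm : Pairwise fun q r => ∀ a b : G, a ∈ P q → b ∈ P r → Commute a b := by
    intro q r hqr a b ha hb
    have hqr' : (q : ℕ) ≠ r := fun h => hqr (Subtype.ext h)
    have hle : P q ≤ Subgroup.centralizer (P r : Set G) := by
      rw [Subgroup.centralizer_closure, Subgroup.closure_le]
      have c1 := H.commS s t hst hc hT hS q r (hpr q) (hpr r) hqr' (hdv q) (hdv r)
      have c2 := H.commS s t hst hc hT hS r q (hpr r) (hpr q) hqr'.symm (hdv r) (hdv q)
      rintro z (rfl | rfl)
      · rintro w (rfl | rfl)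
        · exact ((Commute.refl x).pow_pow _ _).eq
        · exact c1.symm.eq
      · rintro w (rfl | rfl)
        · exact c2.eq
        · exact ((Commute.refl y).pow_pow _ _).eq
    exact ((hle ha) b hb).symm
  have hr := Subgroup.noncommPiCoprod_range (hcomm := hcomm)
  refine ⟨(Subgroup.noncommPiCoprod hcomm).range, ?_, ?_, ?_, ?_⟩
  · exact Group.nilpotent_of_surjective _ (MonoidHom.rangeRestrict_surjective _)
  · have h1 := Subgroup.card_range_dvd (Subgroup.noncommPiCoprod hcomm)
    refine Nat.Coprime.coprime_dvd_left h1 ?_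
    rw [Nat.card_pi]
    apply Nat.Coprime.prod_left
    intro q _
    have : Fact (q : ℕ).Prime := ⟨hpr q⟩
    obtain ⟨k, hk⟩ := (IsPGroup.iff_card).mp (hP q)
    rw [hk]
    exact Nat.Coprime.pow_left _ (Nat.Coprime.coprime_dvd_left (hdv q) hc)
  · rw [hr]
    refine pow_mem_of_primes _ x n t s H.npos.ne' H.pow_n (by rw [hst, mul_comm]) ?_
    intro p hp hps
    have hm : p ∈ s.primeFactors := Nat.mem_primeFactors.mpr ⟨hp, hps, hs0⟩
    exact Subgroup.mem_iSup_of_mem (⟨p, hm⟩ : s.primeFactors)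
      (Subgroup.subset_closure (Or.inl rfl))
  · rw [hr]
    refine pow_mem_of_primes _ y n t s H.npos.ne' H.symm.pow_n (by rw [hst, mul_comm]) ?_
    intro p hp hps
    have hm : p ∈ s.primeFactors := Nat.mem_primeFactors.mpr ⟨hp, hps, hs0⟩
    exact Subgroup.mem_iSup_of_mem (⟨p, hm⟩ : s.primeFactors)
      (Subgroup.subset_closure (Or.inr rfl))

theorem exists_split (H : IsoBi n x y α) : ∃ s t : ℕ, n = s * t ∧ Nat.Coprime s t ∧
    (∀ p : ℕ, p.Prime → p ∣ t → H.TT p) ∧ (∀ p : ℕ, p.Prime → p ∣ s → ¬ H.TT p) := by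
  classical
  have key : ∀ (Q : ℕ → Prop) [DecidablePred Q] (p : ℕ), p.Prime →
      p ∣ ∏ q ∈ n.primeFactors.filter Q, q ^ n.factorization q → Q p := by
    intro Q _ p hp h
    obtain ⟨q, hq, hd⟩ := (Prime.dvd_finsetProd_iff hp.prime _).mp h
    rw [Finset.mem_filter] at hq
    have h1 := hp.dvd_of_dvd_pow hd
    rw [(Nat.prime_dvd_prime_iff_eq hp (Nat.prime_of_mem_primeFactors hq.1)).mp h1]
    exact hq.2
  have hT := key H.TT
  have hS := key (fun p => ¬ H.TT p)
  refine ⟨∏ q ∈ n.primeFactors.filter (fun p => ¬ H.TT p), q ^ n.factorization q,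
    ∏ q ∈ n.primeFactors.filter H.TT, q ^ n.factorization q, ?_, ?_, hT, hS⟩
  · rw [mul_comm, Finset.prod_filter_mul_prod_filter_not]
    exact (Nat.prod_factorization_pow_eq_self H.npos.ne').symm
  · apply Nat.coprime_of_dvd
    intro p hp h1 h2
    exact hS p hp h1 (hT p hp h2)

/-- coprime part -/
theorem part (H : IsoBi n x y α) (s t : ℕ) (hst : n = s * t) (a b : ℤ)
    (hab : s * a + t * b = 1) : orderOf (x ^ (s * a)) = t ∧
    Subgroup.zpowers (x ^ (s * a)) = Subgroup.zpowers (x ^ s) := by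
  have hz : Subgroup.zpowers (x ^ (s * a)) = Subgroup.zpowers (x ^ s) := by
    apply le_antisymm
    · rw [Subgroup.zpowers_le, zpow_mul, zpow_natCast]
      exact Subgroup.zpow_mem_zpowers _ _
    · rw [Subgroup.zpowers_le]
      refine ⟨s, ?_⟩
      have h1 : (s : ℤ) * a * s = s + n * (-b) := by
        rw [hst]; push_cast
        linear_combination (s : ℤ) * hab
      simp only [← zpow_mul]
      rw [h1, zpow_add, zpow_mul x (n : ℤ), zpow_natCast x n, H.pow_n, one_zpow, mul_one,
        zpow_natCast]
  refine ⟨?_, hz⟩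
  have hs0 : s ≠ 0 := by
    rintro rfl
    have := H.npos
    simp [hst] at this
  rw [← Nat.card_zpowers, hz, Nat.card_zpowers, orderOf_pow_of_dvd hs0 (by rw [H.ox, hst]; simp),
    H.ox, hst, Nat.mul_div_cancel_left _ (Nat.pos_of_ne_zero hs0)]

theorem main [Finite G] (H : IsoBi n x y α) :
    ∃ (s t : ℕ) (xS xT yS yT : G) (lam : ℤ),
      0 < s ∧ 0 < t ∧ Nat.Coprime s t ∧ n = s * t ∧
      xS ∈ Subgroup.zpowers x ∧ xT ∈ Subgroup.zpowers x ∧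
      yS ∈ Subgroup.zpowers y ∧ yT ∈ Subgroup.zpowers y ∧
      x = xS * xT ∧ y = yS * yT ∧
      orderOf xS = s ∧ orderOf yS = s ∧ orderOf xT = t ∧ orderOf yT = t ∧
      (Subgroup.closure {xT, yT} : Subgroup G).Normal ∧
      (∀ a ∈ Subgroup.closure ({xT, yT} : Set G), ∀ b ∈ Subgroup.closure ({xT, yT} : Set G),
        a * b = b * a) ∧
      Nat.card (Subgroup.closure ({xT, yT} : Set G)) = t ^ 2 ∧
      Group.IsNilpotent (Subgroup.closure ({xS, yS} : Set G)) ∧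
      Nat.card (Subgroup.closure ({xS, yS} : Set G)) = s ^ 2 ∧
      Subgroup.closure ({xS, yS} : Set G) ⊓ Subgroup.closure ({xT, yT} : Set G) = ⊥ ∧
      xS⁻¹ * xT * xS = xT ∧ yS⁻¹ * yT * yS = yT ∧
      xS⁻¹ * yT * xS = yT ^ lam ∧ yS⁻¹ * xT * yS = xT ^ lam := by
  obtain ⟨s, t, hst, hc, hT, hS⟩ := H.exists_split
  have hn := H.npos
  have hs0 : 0 < s := Nat.pos_of_ne_zero (by rintro rfl; simp [hst] at hn)
  have ht0 : 0 < t := Nat.pos_of_ne_zero (by rintro rfl; simp [hst] at hn)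
  have hts : n = t * s := by rw [hst, mul_comm]
  obtain ⟨K, hKn, hKc, hxK, hyK⟩ := H.exists_nilp s t hst hc hT hS
  have hTs : ∀ p : ℕ, p.Prime → p ∣ t → H.symm.TT p := fun p hp h => H.TT_symm p (hT p hp h)
  have nY := H.normalY s t hst hT
  have nX := H.symm.normalY s t hst hTs
  have hxs := H.xs_mem s t hst hT
  have hys := H.symm.xs_mem s t hst hTs
  obtain ⟨a, b, hab⟩ : ∃ a b : ℤ, (s : ℤ) * a + t * b = 1 := by
    refine ⟨s.gcdA t, s.gcdB t, ?_⟩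
    rw [← Nat.gcd_eq_gcd_ab, hc.gcd_eq_one]; rfl
  have hba : (t : ℤ) * b + s * a = 1 := by rw [add_comm]; exact hab
  obtain ⟨oxT, zxT⟩ := H.part s t hst a b hab
  obtain ⟨oyT, zyT⟩ := H.symm.part s t hst a b hab
  obtain ⟨oxS, zxS⟩ := H.part t s hts b a hba
  obtain ⟨oyS, zyS⟩ := H.symm.part t s hts b a hba
  have exT : α (x ^ (s * a)) = y ^ (s * a) := by rw [map_zpow, H.ax]
  have eyT : α (y ^ (s * a)) = x ^ (s * a) := by rw [map_zpow, H.ay]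
  have exS : α (x ^ (t * b)) = y ^ (t * b) := by rw [map_zpow, H.ax]
  have ex : x = x ^ (t * b) * x ^ (s * a) := by rw [← zpow_add, hba, zpow_one]
  have ey : y = y ^ (t * b) * y ^ (s * a) := by rw [← zpow_add, hba, zpow_one]
  have cx : Commute (x ^ (s * a)) (x ^ (t * b)) := (Commute.refl x).zpow_zpow _ _
  have cy : Commute (y ^ (s * a)) (y ^ (t * b)) := (Commute.refl y).zpow_zpow _ _
  have mxT : x ^ (s * a) ∈ Subgroup.zpowers x := Subgroup.zpow_mem_zpowers _ _
  have myT : y ^ (s * a) ∈ Subgroup.zpowers y := Subgroup.zpow_mem_zpowers _ _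
  have mxS : x ^ (t * b) ∈ Subgroup.zpowers x := Subgroup.zpow_mem_zpowers _ _
  have myS : y ^ (t * b) ∈ Subgroup.zpowers y := Subgroup.zpow_mem_zpowers _ _
  rw [← zxT] at nX
  rw [← zyT] at nY
  have kx : x ^ (t * b) ∈ K := by rw [zpow_mul, zpow_natCast]; exact K.zpow_mem hxK _
  have ky : y ^ (t * b) ∈ K := by rw [zpow_mul, zpow_natCast]; exact K.zpow_mem hyK _
  have dx : x ^ (s * a) ∈ commutator G := by
    rw [zpow_mul, zpow_natCast]; exact Subgroup.zpow_mem _ hxs _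
  have dy : y ^ (s * a) ∈ commutator G := by
    rw [zpow_mul, zpow_natCast]; exact Subgroup.zpow_mem _ hys _
  generalize x ^ (s * a) = xT at *
  generalize y ^ (s * a) = yT at *
  generalize x ^ (t * b) = xS at *
  generalize y ^ (t * b) = yS at *
  have hTsup : Subgroup.closure ({xT, yT} : Set G)
      = Subgroup.zpowers xT ⊔ Subgroup.zpowers yT := by
    rw [Set.insert_eq, Subgroup.closure_union, Subgroup.zpowers_eq_closure,
      Subgroup.zpowers_eq_closure]
  have hTn : (Subgroup.closure ({xT, yT} : Set G)).Normal := by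
    rw [hTsup]; exact Subgroup.sup_normal _ _
  have hTc : Subgroup.closure ({xT, yT} : Set G) ≤ commutator G := by
    rw [Subgroup.closure_le]
    rintro z (rfl | rfl)
    · exact dx
    · exact dy
  have hcardT : Nat.card (Subgroup.closure ({xT, yT} : Set G)) = t ^ 2 := by
    have h1 := H.prod_inj (Subgroup.zpowers xT) (Subgroup.zpowers yT)
      (by rw [Subgroup.zpowers_le]; exact mxT) (by rw [Subgroup.zpowers_le]; exact myT)
    have h2 : Set.range (fun z : Subgroup.zpowers xT × Subgroup.zpowers yT => (z.1 : G) * z.2)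
        = (Subgroup.closure ({xT, yT} : Set G) : Set G) := by
      rw [hTsup, Subgroup.mul_normal]
      ext z
      simp only [Set.mem_range, Set.mem_mul, Prod.exists, Subtype.exists, SetLike.mem_coe]
      constructor
      · rintro ⟨u, hu, v, hv, rfl⟩; exact ⟨u, hu, v, hv, rfl⟩
      · rintro ⟨u, hu, v, hv, rfl⟩; exact ⟨u, hu, v, hv, rfl⟩
    have h3 := Nat.card_range_of_injective h1
    rw [h2, Nat.card_prod, Nat.card_zpowers, Nat.card_zpowers, oxT, oyT] at h3
    rw [sq]; exact h3
  have hSK : Subgroup.closure ({xS, yS} : Set G) ≤ K := by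
    rw [Subgroup.closure_le]
    rintro z (rfl | rfl)
    · exact kx
    · exact ky
  have hcopST : Nat.Coprime (Nat.card (Subgroup.closure ({xS, yS} : Set G)))
      (Nat.card (Subgroup.closure ({xT, yT} : Set G))) := by
    rw [hcardT]
    exact (Nat.Coprime.coprime_dvd_left (Subgroup.card_dvd_of_le hSK) hKc).pow_right _
  have hbot := Subgroup.inf_eq_bot_of_coprime hcopST
  have htop : Subgroup.closure ({xS, yS} : Set G) ⊔ Subgroup.closure ({xT, yT} : Set G) = ⊤ := by
    rw [eq_top_iff]
    have m1 : xS ∈ Subgroup.closure ({xS, yS} : Set G) := Subgroup.subset_closure (Or.inl rfl)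
    have m2 : yS ∈ Subgroup.closure ({xS, yS} : Set G) := Subgroup.subset_closure (Or.inr rfl)
    have m3 : xT ∈ Subgroup.closure ({xT, yT} : Set G) := Subgroup.subset_closure (Or.inl rfl)
    have m4 : yT ∈ Subgroup.closure ({xT, yT} : Set G) := Subgroup.subset_closure (Or.inr rfl)
    intro g _
    obtain ⟨i, j, rfl⟩ := H.gen g
    refine Subgroup.mul_mem _ (Subgroup.zpow_mem _ ?_ _) (Subgroup.zpow_mem _ ?_ _)
    · rw [ex]; exact Subgroup.mul_mem_sup m1 m3
    · rw [ey]; exact Subgroup.mul_mem_sup m2 m4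
  have hcardS : Nat.card (Subgroup.closure ({xS, yS} : Set G)) = s ^ 2 := by
    have h1 : Subgroup.IsComplement' (Subgroup.closure ({xS, yS} : Set G))
        (Subgroup.closure ({xT, yT} : Set G)) := by
      apply Subgroup.isComplement'_of_disjoint_and_mul_eq_univ (disjoint_iff.mpr hbot)
      rw [← Subgroup.mul_normal, htop, Subgroup.coe_top]
    have h2 := h1.card_mul_card
    rw [hcardT, H.card, hst, mul_pow] at h2
    exact Nat.eq_of_mul_eq_mul_right (pow_pos ht0 2) h2
  obtain ⟨lam, hlam⟩ : ∃ lam : ℤ, yT ^ lam = xS⁻¹ * yT * xS := by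
    have := nY.conj_mem yT (Subgroup.mem_zpowers yT) xS⁻¹
    rw [inv_inv] at this
    exact this
  have hSn : Group.IsNilpotent (Subgroup.closure ({xS, yS} : Set G)) := by
    have h1 : Group.IsNilpotent ((Subgroup.closure ({xS, yS} : Set G)).subgroupOf K) :=
      inferInstance
    exact Group.nilpotent_of_surjective (Subgroup.subgroupOfEquivOfLe hSK).toMonoidHom
      (Subgroup.subgroupOfEquivOfLe hSK).surjective
  refine ⟨s, t, xS, xT, yS, yT, lam, hs0, ht0, hc, hst, mxS, mxT, myS, myT, ex, ey, oxS, oyS, oxT,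
    oyT, hTn, fun u hu v hv => H.abel u (hTc hu) v (hTc hv), hcardT, hSn, hcardS, hbot, ?_, ?_,
    hlam.symm, ?_⟩
  · rw [mul_assoc, cx.eq, inv_mul_cancel_left]
  · rw [mul_assoc, cy.eq, inv_mul_cancel_left]
  · have := congrArg α hlam
    rw [map_zpow, map_mul, map_mul, map_inv, eyT, exS] at this
    exact this.symm

end IsoBi


/-- Every `n`-isobicyclic group `G` with canonical generators `x, y`
decomposes as an internal semidirect product `T ⋊ S`, where `T = ⟨x_T, y_T⟩` is an abelian
normal subgroup of order `t²`, `S = ⟨x_S, y_S⟩` is a nilpotent subgroup of order `s²`,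
`n = st` with `s, t` coprime, `x = x_S x_T`, `y = y_S y_T`, and `S` acts diagonally on `T`
with eigenvalue `λ`. -/
theorem isobicyclic_decomposition
    {G : Type*} [Group G] [Finite G] (n : ℕ) (hn : 0 < n) (x y : G)
    (hx : orderOf x = n) (hy : orderOf y = n)
    (hprod : (↑(Subgroup.zpowers x) * ↑(Subgroup.zpowers y) : Set G) = Set.univ)
    (hinter : Subgroup.zpowers x ⊓ Subgroup.zpowers y = ⊥)
    (α : G ≃* G) (hαx : α x = y) (hαy : α y = x) :
    ∃ (s t : ℕ) (xS xT yS yT : G) (lam : ℤ),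
      0 < s ∧ 0 < t ∧ Nat.Coprime s t ∧ n = s * t ∧
      xS ∈ Subgroup.zpowers x ∧ xT ∈ Subgroup.zpowers x ∧
      yS ∈ Subgroup.zpowers y ∧ yT ∈ Subgroup.zpowers y ∧
      x = xS * xT ∧ y = yS * yT ∧
      orderOf xS = s ∧ orderOf yS = s ∧ orderOf xT = t ∧ orderOf yT = t ∧
      -- (i) `T := ⟨x_T, y_T⟩` is an abelian normal subgroup of order `t²`
      (Subgroup.closure {xT, yT} : Subgroup G).Normal ∧
      (∀ a ∈ Subgroup.closure ({xT, yT} : Set G), ∀ b ∈ Subgroup.closure ({xT, yT} : Set G),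
        a * b = b * a) ∧
      Nat.card (Subgroup.closure ({xT, yT} : Set G)) = t ^ 2 ∧
      -- (ii) `S := ⟨x_S, y_S⟩` is a nilpotent subgroup of order `s²` with `S ∩ T = 1`
      Group.IsNilpotent (Subgroup.closure ({xS, yS} : Set G)) ∧
      Nat.card (Subgroup.closure ({xS, yS} : Set G)) = s ^ 2 ∧
      Subgroup.closure ({xS, yS} : Set G) ⊓ Subgroup.closure ({xT, yT} : Set G) = ⊥ ∧
      -- (iii) the diagonal action with eigenvalue `λ`
      xS⁻¹ * xT * xS = xT ∧ yS⁻¹ * yT * yS = yT ∧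
      xS⁻¹ * yT * xS = yT ^ lam ∧ yS⁻¹ * xT * yS = xT ^ lam := by

  have H : IsoBi n x y α :=
    { npos := hn
      ox := hx
      oy := hy
      gen := by
        intro g
        have hg : g ∈ (↑(Subgroup.zpowers x) * ↑(Subgroup.zpowers y) : Set G) := by
          rw [hprod]; trivial
        obtain ⟨_, ⟨i, rfl⟩, _, ⟨j, rfl⟩, h⟩ := Set.mem_mul.mp hg
        exact ⟨i, j, h.symm⟩
      inter := by
        intro i j h
        have h1 : x ^ i = (y ^ j)⁻¹ := eq_inv_of_mul_eq_one_left h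
        have h2 : x ^ i ∈ Subgroup.zpowers x ⊓ Subgroup.zpowers y := by
          refine ⟨Subgroup.zpow_mem_zpowers _ _, ?_⟩
          rw [h1]
          exact Subgroup.inv_mem _ (Subgroup.zpow_mem_zpowers _ _)
        rw [hinter, Subgroup.mem_bot] at h2
        rw [h2, one_mul] at h
        exact ⟨h2, h⟩
      ax := hαx
      ay := hαy }
  exact H.main
end

section
/- Let G be an n-isobicyclic group with canonical generators x and y and an automorphism α of G transposing x and y. Let π be a set of primes, and write n = s·t where s is the largest divisor of n all of whose prime factors lie in π and t = n/s. Then the subgroup H := ⟨x^t, y^t⟩ of G satisfies: H equals the set product ⟨x^t⟩⟨y^t⟩, the elements x^t and y^t both have order s, ⟨x^t⟩ ∩ ⟨y^t⟩ = 1 (so |H| = s², and H is a Hall π-subgroup of G), and α(x^t) = y^t, α(y^t) = x^t; in particular H is s-isobicyclic with canonical generators x^t and y^t. -/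
open scoped Pointwise

open scoped commutatorElement in
/-- The theorem of Ito: a product of two abelian subgroups is metabelian. -/
theorem ito_commute {G : Type*} [Group G] (A B : Subgroup G)
    (hA : ∀ a ∈ A, ∀ a' ∈ A, a * a' = a' * a) (hB : ∀ a ∈ B, ∀ a' ∈ B, a * a' = a' * a)
    (hAB : ∀ g : G, ∃ a ∈ A, ∃ b ∈ B, g = a * b) :
    ∀ g ∈ commutator G, ∀ h ∈ commutator G, g * h = h * g := by
  have hBA : ∀ g : G, ∃ b ∈ B, ∃ a ∈ A, g = b * a := by
    intro g
    obtain ⟨a, ha, b, hb, h⟩ := hAB g⁻¹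
    exact ⟨b⁻¹, B.inv_mem hb, a⁻¹, A.inv_mem ha, by rw [← mul_inv_rev, ← h, inv_inv]⟩
  have e1 : ∀ a ∈ A, ∀ a2 ∈ A, ∀ b2 : G, ⁅a, b2 * a2⁆ = ⁅a, b2⁆ := by
    intro a ha a2 ha2 b2
    have h := hA a ha a2 ha2
    simp only [commutatorElement_def, mul_inv_rev]
    have : a2 * a⁻¹ * a2⁻¹ = a⁻¹ := by
      rw [mul_inv_eq_iff_eq_mul, eq_inv_mul_iff_mul_eq, ← mul_assoc, h, mul_inv_cancel_right]
    calc _ = a * b2 * (a2 * a⁻¹ * a2⁻¹) * b2⁻¹ := by group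
      _ = _ := by rw [this]
  have e2 : ∀ b ∈ B, ∀ b3 ∈ B, ∀ a3 : G, ⁅a3 * b3, b⁆ = ⁅a3, b⁆ := by
    intro b hb b3 hb3 a3
    have h := hB b3 hb3 b hb
    simp only [commutatorElement_def, mul_inv_rev]
    have : b3 * b * b3⁻¹ = b := by rw [h, mul_inv_cancel_right]
    calc _ = a3 * (b3 * b * b3⁻¹) * a3⁻¹ * b⁻¹ := by group
      _ = _ := by rw [this]
  have c1 : ∀ a ∈ A, ∀ a1 ∈ A, ∀ b : G, a1 * ⁅a, b⁆ * a1⁻¹ = ⁅a, a1 * b * a1⁻¹⁆ := by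
    intro a ha a1 ha1 b
    have h : a1 * a * a1⁻¹ = a := by rw [hA a1 ha1 a ha, mul_inv_cancel_right]
    calc _ = ⁅a1 * a * a1⁻¹, a1 * b * a1⁻¹⁆ := by simp only [commutatorElement_def]; group
      _ = _ := by rw [h]
  have c2 : ∀ b ∈ B, ∀ b1 ∈ B, ∀ a : G, b1 * ⁅a, b⁆ * b1⁻¹ = ⁅b1 * a * b1⁻¹, b⁆ := by
    intro b hb b1 hb1 a
    have h : b1 * b * b1⁻¹ = b := by rw [hB b1 hb1 b hb, mul_inv_cancel_right]
    calc _ = ⁅b1 * a * b1⁻¹, b1 * b * b1⁻¹⁆ := by simp only [commutatorElement_def]; group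
      _ = _ := by rw [h]
  let S : Set G := {g | ∃ a ∈ A, ∃ b ∈ B, g = ⁅a, b⁆}
  have hS : ∀ g ∈ S, ∀ h ∈ S, g * h = h * g := by
    rintro _ ⟨a', ha', b', hb', rfl⟩ _ ⟨a, ha, b, hb, rfl⟩
    obtain ⟨a1, rfl⟩ : ∃ a1, a' = a1⁻¹ := ⟨a'⁻¹, by simp⟩
    obtain ⟨b1, rfl⟩ : ∃ b1, b' = b1⁻¹ := ⟨b'⁻¹, by simp⟩
    have ha1 : a1 ∈ A := by simpa using ha'
    have hb1 : b1 ∈ B := by simpa using hb'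
    obtain ⟨b2, hb2, a2, ha2, h2⟩ := hBA (a1 * b * a1⁻¹)
    obtain ⟨a3, ha3, b3, hb3, h3⟩ := hAB (b1 * a * b1⁻¹)
    have k1 : a1 * (b1 * ⁅a, b⁆ * b1⁻¹) * a1⁻¹ = ⁅a3, b2⁆ := by
      rw [c2 b hb b1 hb1, h3, e2 b hb b3 hb3, c1 a3 ha3 a1 ha1, h2, e1 a3 ha3 a2 ha2]
    have k2 : b1 * (a1 * ⁅a, b⁆ * a1⁻¹) * b1⁻¹ = ⁅a3, b2⁆ := by
      rw [c1 a ha a1 ha1, h2, e1 a ha a2 ha2, c2 b2 hb2 b1 hb1, h3, e2 b2 hb2 b3 hb3]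
    have k := k1.trans k2.symm
    generalize ⁅a, b⁆ = c at k
    calc _ = a1⁻¹ * b1⁻¹ * (a1 * (b1 * c * b1⁻¹) * a1⁻¹) * a1 * b1 := by
            simp only [commutatorElement_def]; group
      _ = a1⁻¹ * b1⁻¹ * (b1 * (a1 * c * a1⁻¹) * b1⁻¹) * a1 * b1 := by rw [k]
      _ = _ := by simp only [commutatorElement_def]; group
  have hN : (Subgroup.closure S).Normal := by
    have hconj : ∀ g : G, ∀ h ∈ S, g * h * g⁻¹ ∈ S := by
      rintro g _ ⟨a, ha, b, hb, rfl⟩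
      obtain ⟨a1, ha1, b1, hb1, rfl⟩ := hAB g
      obtain ⟨a3, ha3, b3, hb3, h3⟩ := hAB (b1 * a * b1⁻¹)
      obtain ⟨b2, hb2, a2, ha2, h2⟩ := hBA (a1 * b * a1⁻¹)
      refine ⟨a3, ha3, b2, hb2, ?_⟩
      calc _ = a1 * (b1 * ⁅a, b⁆ * b1⁻¹) * a1⁻¹ := by group
        _ = _ := by
          rw [c2 b hb b1 hb1, h3, e2 b hb b3 hb3, c1 a3 ha3 a1 ha1, h2, e1 a3 ha3 a2 ha2]
    constructor
    intro n hn g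
    have : Subgroup.closure S ≤ (Subgroup.closure S).comap (MulAut.conj g).toMonoidHom := by
      rw [Subgroup.closure_le]
      intro h hh
      exact Subgroup.subset_closure (hconj g h hh)
    exact this hn
  have hle : commutator G ≤ Subgroup.closure S := by
    rw [commutator_def, Subgroup.commutator_le]
    have hq : ∀ a ∈ A, ∀ b ∈ B, (QuotientGroup.mk' (Subgroup.closure S) a) *
        (QuotientGroup.mk' (Subgroup.closure S) b) = QuotientGroup.mk' (Subgroup.closure S) b *
        QuotientGroup.mk' (Subgroup.closure S) a := by
      intro a ha b hb
      rw [← commutatorElement_eq_one_iff_mul_comm, ← map_commutatorElement]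
      exact (QuotientGroup.eq_one_iff _).2 (Subgroup.subset_closure ⟨a, ha, b, hb, rfl⟩)
    intro g _ h _
    rw [← QuotientGroup.eq_one_iff]
    change QuotientGroup.mk' (Subgroup.closure S) _ = 1
    rw [map_commutatorElement, commutatorElement_eq_one_iff_mul_comm]
    obtain ⟨a, ha, b, hb, rfl⟩ := hAB g
    obtain ⟨a', ha', b', hb', rfl⟩ := hAB h
    have q1 := hq a ha b' hb'
    have q2 := hq a' ha' b hb
    have q3 := congrArg (QuotientGroup.mk' (Subgroup.closure S)) (hA a ha a' ha')
    have q4 := congrArg (QuotientGroup.mk' (Subgroup.closure S)) (hB b hb b' hb')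
    simp only [map_mul] at q3 q4 ⊢
    generalize QuotientGroup.mk' (Subgroup.closure S) a = u at *
    generalize QuotientGroup.mk' (Subgroup.closure S) b = v at *
    generalize QuotientGroup.mk' (Subgroup.closure S) a' = u' at *
    generalize QuotientGroup.mk' (Subgroup.closure S) b' = v' at *
    calc u * v * (u' * v') = u * (v * u') * v' := by group
      _ = u * u' * (v * v') := by rw [← q2]; group
      _ = u' * (u * v') * v := by rw [q3, q4]; group
      _ = _ := by rw [q1]; group
  have hcl : ∀ g ∈ Subgroup.closure S, ∀ h ∈ Subgroup.closure S, g * h = h * g := by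
    have h1 : Subgroup.closure S ≤ Subgroup.centralizer S := by
      rw [Subgroup.closure_le]
      intro g hg
      rw [SetLike.mem_coe, Subgroup.mem_centralizer_iff]
      intro h hh
      exact hS h hh g hg
    have h2 : Subgroup.closure S ≤ Subgroup.centralizer (Subgroup.closure S : Set G) := by
      rw [Subgroup.closure_le]
      intro g hg
      rw [SetLike.mem_coe, Subgroup.mem_centralizer_iff]
      intro h hh
      exact (Subgroup.mem_centralizer_iff.1 (h1 hh) g hg).symm
    intro g hg h hh
    exact Subgroup.mem_centralizer_iff.1 (h2 hh) g hg
  exact fun g hg h hh => hcl g (hle hg) h (hle hh)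

/-- Cohomological averaging: two elements congruent modulo an abelian normal subgroup of
coprime exponent are conjugate. -/
theorem conj_of_coprime {G : Type*} [Group G] (Q : Subgroup G) [Q.Normal]
    (hQ : ∀ a ∈ Q, ∀ b ∈ Q, a * b = b * a) (s m : ℕ) (hsm : Nat.Coprime s m)
    (hm : ∀ a ∈ Q, a ^ m = 1) (a l : G) (ha : a ^ s = 1) (hl : l ^ s = 1)
    (hal : l * a⁻¹ ∈ Q) : ∃ r ∈ Q, r * a * r⁻¹ = l := by
  let _ : CommGroup Q := { (inferInstance : Group Q) with
    mul_comm := fun u v => Subtype.ext (hQ u u.2 v v.2) }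
  have hf : ∀ i : ℕ, l ^ i * (a ^ i)⁻¹ ∈ Q := by
    intro i
    rw [← QuotientGroup.eq_one_iff] at hal ⊢
    have : (l : G ⧸ Q) = a := by simpa [mul_inv_eq_one] using hal
    simp [this]
  let f : ℕ → Q := fun i => ⟨l ^ i * (a ^ i)⁻¹, hf i⟩
  let φ : Q →* Q := ((MulAut.conjNormal l : MulAut Q) : Q ≃* Q).toMonoidHom
  have hφ : ∀ q : Q, ((φ q : Q) : G) = l * q * l⁻¹ := fun q => by
    simp [φ, MulAut.conjNormal_apply]
  have hstep : ∀ i, φ (f i) = f (i + 1) * (f 1)⁻¹ := by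
    intro i
    apply Subtype.ext
    rw [hφ]
    simp only [f, Subgroup.coe_mul, Subgroup.coe_inv, pow_one, pow_succ' l, pow_succ' a]
    have : (a * a ^ i)⁻¹ = (a ^ i)⁻¹ * a⁻¹ := by group
    rw [this]; group
  let R : Q := ∏ i ∈ Finset.range s, f i
  have hR : φ R = R * ((f 1) ^ s)⁻¹ := by
    simp only [R, map_prod, hstep, Finset.prod_mul_distrib, Finset.prod_const, Finset.card_range,
      inv_pow]
    congr 1
    have h1 := Finset.prod_range_succ f s
    have h2 := Finset.prod_range_succ' f s
    have h0 : f 0 = 1 := Subtype.ext (by simp [f])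
    have hs : f s = 1 := Subtype.ext (by simp [f, ha, hl])
    rw [hs, mul_one] at h1
    rw [h0, mul_one, h1] at h2
    exact h2.symm
  obtain ⟨k, hk⟩ : ∃ k : ℕ, ∀ q : Q, (q ^ s) ^ k = q := by
    by_cases hm1 : m = 1
    · exact ⟨0, fun q => Subtype.ext (by simpa [hm1] using (hm q q.2).symm)⟩
    by_cases hm0 : m = 0
    · have : s = 1 := by simpa [hm0] using hsm
      exact ⟨1, fun q => by simp [this]⟩
    obtain ⟨k, hk⟩ := Nat.exists_mul_mod_eq_one_of_coprime hsm (by omega)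
    refine ⟨k, fun q => Subtype.ext ?_⟩
    have h3 : (q : G) ^ (s * k) = (q : G) ^ ((s * k) % m) := by
      conv_lhs => rw [← Nat.div_add_mod (s * k) m, pow_add, pow_mul, hm q q.2, one_pow, one_mul]
    rw [← pow_mul]
    simp [h3, hk.2]
  have hRk : φ (R ^ k) = R ^ k * (f 1)⁻¹ := by
    rw [map_pow, hR, mul_pow, inv_pow, hk]
  refine ⟨(R ^ k : Q), (R ^ k).2, ?_⟩
  have h4 := congrArg (Subtype.val) hRk
  rw [hφ] at h4
  generalize R ^ k = r at h4
  simp only [f, Subgroup.coe_mul, Subgroup.coe_inv, pow_one, mul_inv_rev, inv_inv] at h4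
  have h5 : l * (r : G) = r * a := by
    calc l * (r : G) = l * r * l⁻¹ * l := by group
      _ = _ := by rw [h4]; group
  rw [← h5]; group

theorem coprime_card_of_pow {G : Type*} [Group G] [Finite G] (m k : ℕ) (hk : Nat.Coprime m k)
    (h : ∀ g : G, g ^ m = 1) : Nat.Coprime (Nat.card G) k := by
  rw [Nat.coprime_iff_gcd_eq_one]
  by_contra hne
  obtain ⟨p, hp, hpd⟩ := Nat.exists_prime_and_dvd hne
  haveI : Fact p.Prime := ⟨hp⟩
  obtain ⟨g, hg⟩ := exists_prime_orderOf_dvd_card' (G := G) p (hpd.trans (Nat.gcd_dvd_left _ _))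
  have h1 : p ∣ m := hg ▸ orderOf_dvd_of_pow_eq_one (h g)
  exact hp.one_lt.ne' (Nat.dvd_one.1 (hk ▸ Nat.dvd_gcd h1 (hpd.trans (Nat.gcd_dvd_right _ _))))

/-- The subgroup generated by the two parts has exponent dividing `s ^ 3`. -/
theorem pow_closure_eq_one {G : Type*} [Group G] [Finite G] (A B : Subgroup G)
    (hA : ∀ a ∈ A, ∀ a' ∈ A, a * a' = a' * a) (hB : ∀ a ∈ B, ∀ a' ∈ B, a * a' = a' * a)
    (hAB : ∀ g : G, ∃ a ∈ A, ∃ b ∈ B, g = a * b) (s t : ℕ) (hst : Nat.Coprime s t)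
    (hcard : Nat.card G = s ^ 2 * t ^ 2) (a b : G) (ha : a ∈ A) (hb : b ∈ B)
    (has : a ^ s = 1) (hbs : b ^ s = 1) :
    ∀ h ∈ Subgroup.closure {a, b}, h ^ (s ^ 3) = 1 := by
  have hcomm := ito_commute A B hA hB hAB
  let Q : Subgroup G :=
    { carrier := {g | g ∈ commutator G ∧ g ^ (t ^ 2) = 1}
      one_mem' := ⟨one_mem _, one_pow _⟩
      mul_mem' := fun {u v} hu hv => ⟨mul_mem hu.1 hv.1, by
        rw [(show Commute u v from hcomm u hu.1 v hv.1).mul_pow, hu.2, hv.2, one_mul]⟩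
      inv_mem' := fun {u} hu => ⟨inv_mem hu.1, by rw [inv_pow, hu.2, inv_one]⟩ }
  have hQmem : ∀ g, g ∈ Q ↔ g ∈ commutator G ∧ g ^ (t ^ 2) = 1 := fun g => Iff.rfl
  haveI hQn : Q.Normal := ⟨fun u hu g => ⟨(inferInstance : (commutator G).Normal).conj_mem u hu.1 g,
    by rw [conj_pow, hu.2]; simp⟩⟩
  have hcs : ∀ g ∈ commutator G, g ^ (s ^ 2) ∈ Q := fun g hg =>
    ⟨pow_mem hg _, by rw [← pow_mul, ← hcard, pow_card_eq_one']⟩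
  let M : Subgroup G := ((powMonoidHom s : Abelianization G →* Abelianization G).comp
    Abelianization.of).ker
  have hMmem : ∀ g, g ∈ M ↔ g ^ s ∈ commutator G := by
    intro g
    rw [← Abelianization.ker_of G, MonoidHom.mem_ker, MonoidHom.mem_ker]
    simp
  have hQM : Q ≤ M := fun g hg => (hMmem g).2 (pow_mem hg.1 _)
  have haM : a ∈ M := (hMmem a).2 (by rw [has]; exact one_mem _)
  have hbM : b ∈ M := (hMmem b).2 (by rw [hbs]; exact one_mem _)
  have hM3 : ∀ g ∈ M, g ^ (s ^ 3) ∈ Q := by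
    intro g hg
    have := hcs _ ((hMmem g).1 hg)
    rwa [← pow_mul, ← pow_succ'] at this
  let N : Subgroup M := Q.subgroupOf M
  have hcop : Nat.Coprime (Nat.card N) N.index := by
    have h1 : Nat.Coprime (Nat.card N) s := by
      refine coprime_card_of_pow (t ^ 2) s (Nat.Coprime.pow_left 2 hst.symm) ?_
      intro g
      apply Subtype.ext; apply Subtype.ext
      simpa using (Subgroup.mem_subgroupOf.1 g.2).2
    have h2 : Nat.Coprime (Nat.card (M ⧸ N)) (Nat.card N) := by
      refine coprime_card_of_pow (s ^ 3) _ (Nat.Coprime.pow_left 3 h1.symm) ?_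
      intro g
      induction g using QuotientGroup.induction_on with
      | H g =>
        rw [← QuotientGroup.mk_pow, QuotientGroup.eq_one_iff]
        exact Subgroup.mem_subgroupOf.2 (by simpa using hM3 g g.2)
    exact h2.symm
  obtain ⟨L, hL⟩ := Subgroup.exists_right_complement'_of_coprime hcop
  have hLpow : ∀ l ∈ L, ∀ k : ℕ, ((l : G) ^ k) ∈ Q → l ^ k = 1 := by
    intro l hl k hk
    have h1 : l ^ k ∈ N := Subgroup.mem_subgroupOf.2 (by simpa using hk)
    exact Subgroup.disjoint_def.1 hL.disjoint h1 (pow_mem hl k)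
  have hconj : ∀ c ∈ M, c ^ s = 1 → ∃ r : G, ∃ l ∈ L, r * c * r⁻¹ = (l : G) := by
    intro c hc hcs
    obtain ⟨⟨q, l⟩, hql⟩ := hL.surjective ⟨c, hc⟩
    have hql' : ((q : M) : G) * ((l : M) : G) = c := congrArg Subtype.val hql
    have hq : ((q : M) : G) ∈ Q := Subgroup.mem_subgroupOf.1 q.2
    have hlQ : ((l : M) : G) * c⁻¹ ∈ Q := by
      rw [← hql']; simpa using hq
    have hls : ((l : M) : G) ^ s = 1 := by
      have h1 : ((l : M) : G) ^ s ∈ Q := by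
        have h2 := hlQ
        rw [← QuotientGroup.eq_one_iff] at h2 ⊢
        have : (((l : M) : G) : G ⧸ Q) = c := by simpa [mul_inv_eq_one] using h2
        rw [QuotientGroup.mk_pow, this, ← QuotientGroup.mk_pow, hcs, QuotientGroup.mk_one]
      simpa using congrArg Subtype.val (hLpow l l.2 s h1)
    obtain ⟨r, _, hr⟩ := conj_of_coprime Q (fun u hu v hv => hcomm u hu.1 v hv.1) s (t ^ 2)
      (Nat.Coprime.pow_right 2 hst) (fun u hu => hu.2) c l hcs hls hlQ
    exact ⟨r, l, l.2, hr⟩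
  obtain ⟨r1, l1, hl1, hr1⟩ := hconj a haM has
  obtain ⟨r2, l2, hl2, hr2⟩ := hconj b hbM hbs
  obtain ⟨u, hu, v, hv, huv⟩ := hAB (r1⁻¹ * r2)
  have hg : r1 * u = r2 * v⁻¹ := by
    rw [eq_mul_inv_iff_mul_eq, mul_assoc, ← huv]; group
  let K : Subgroup G := (L.map M.subtype).comap (MulAut.conj (r1 * u)).toMonoidHom
  have hle : Subgroup.closure {a, b} ≤ K := by
    rw [Subgroup.closure_le]
    rintro z (rfl | rfl)
    · refine ⟨l1, hl1, ?_⟩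
      have : u * z * u⁻¹ = z := by rw [hA u hu z ha, mul_inv_cancel_right]
      change (l1 : G) = (r1 * u) * z * (r1 * u)⁻¹
      rw [← hr1]
      calc _ = r1 * (u * z * u⁻¹) * r1⁻¹ := by rw [this]
        _ = _ := by group
    · refine ⟨l2, hl2, ?_⟩
      have : v⁻¹ * z * v = z := by rw [hB v⁻¹ (inv_mem hv) z hb, inv_mul_cancel_right]
      change (l2 : G) = (r1 * u) * z * (r1 * u)⁻¹
      rw [← hr2, hg]
      calc _ = r2 * (v⁻¹ * z * v) * r2⁻¹ := by rw [this]
        _ = _ := by group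
  intro h hh
  obtain ⟨l, hl, hlh⟩ := hle hh
  have h1 : l ^ (s ^ 3) = 1 := hLpow l hl _ (hM3 l l.2)
  have h2 : (MulAut.conj (r1 * u)) h = (l : G) := hlh.symm
  have h3 : (MulAut.conj (r1 * u)) (h ^ (s ^ 3)) = 1 := by
    rw [map_pow, h2]; simpa using congrArg Subtype.val h1
  exact (MulEquiv.map_eq_one_iff _).1 h3

/-- If `G` is `n`-isobicyclic with canonical generators `x, y` and canonical
automorphism `α`, `π` is a set of primes, and `n = s·t` where `s` is the part of `n` supported
on the primes of `π` and `t` the part supported off `π`, then `H = ⟨x^t, y^t⟩` is an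
`s`-isobicyclic Hall `π`-subgroup of `G` with canonical generators `x^t, y^t`, transposed by `α`. -/
theorem isobicyclic_hall_subgroup
    {G : Type*} [Group G] [Finite G] (n : ℕ) (hn : 0 < n) (x y : G)
    (hx : orderOf x = n) (hy : orderOf y = n)
    (hprod : (↑(Subgroup.zpowers x) * ↑(Subgroup.zpowers y) : Set G) = Set.univ)
    (hinter : Subgroup.zpowers x ⊓ Subgroup.zpowers y = ⊥)
    (α : G ≃* G) (hαx : α x = y) (hαy : α y = x)
    (π : Set ℕ) (s t : ℕ) (hst : n = s * t)
    (hsπ : ∀ p : ℕ, p.Prime → p ∣ s → p ∈ π)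
    (htπ : ∀ p : ℕ, p.Prime → p ∣ t → p ∉ π) :
    ((Subgroup.closure ({x ^ t, y ^ t} : Set G) : Subgroup G) : Set G) =
      (↑(Subgroup.zpowers (x ^ t)) * ↑(Subgroup.zpowers (y ^ t)) : Set G) ∧
    orderOf (x ^ t) = s ∧ orderOf (y ^ t) = s ∧
    Subgroup.zpowers (x ^ t) ⊓ Subgroup.zpowers (y ^ t) = ⊥ ∧
    Nat.card (Subgroup.closure ({x ^ t, y ^ t} : Set G)) = s ^ 2 ∧
    -- `H` is a Hall `π`-subgroup of `G`
    (∀ p : ℕ, p.Prime → p ∣ Nat.card (Subgroup.closure ({x ^ t, y ^ t} : Set G)) → p ∈ π) ∧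
    (∀ p : ℕ, p.Prime → p ∈ π →
      ¬ p ∣ (Subgroup.closure ({x ^ t, y ^ t} : Set G)).index) ∧
    -- `α` transposes the canonical generators `x^t` and `y^t`
    α (x ^ t) = y ^ t ∧ α (y ^ t) = x ^ t ∧
    -- so `H` is `s`-isobicyclic with canonical generators `x^t` and `y^t`
    ∃ β : (Subgroup.closure ({x ^ t, y ^ t} : Set G)) ≃*
        (Subgroup.closure ({x ^ t, y ^ t} : Set G)),
      β ⟨x ^ t, Subgroup.subset_closure (by simp)⟩ = ⟨y ^ t, Subgroup.subset_closure (by simp)⟩ ∧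
      β ⟨y ^ t, Subgroup.subset_closure (by simp)⟩ = ⟨x ^ t, Subgroup.subset_closure (by simp)⟩ := by
  have hs0 : 0 < s := Nat.pos_of_ne_zero (by rintro rfl; simp at hst; omega)
  have ht0 : 0 < t := Nat.pos_of_ne_zero (by rintro rfl; simp at hst; omega)
  have hcop : Nat.Coprime s t := by
    rw [Nat.coprime_iff_gcd_eq_one]
    by_contra hne
    obtain ⟨p, hp, hpd⟩ := Nat.exists_prime_and_dvd hne
    exact htπ p hp (hpd.trans (Nat.gcd_dvd_right _ _)) (hsπ p hp (hpd.trans (Nat.gcd_dvd_left _ _)))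
  have hox : orderOf (x ^ t) = s := by
    rw [orderOf_pow_of_dvd ht0.ne' (by rw [hx, hst]; exact dvd_mul_left _ _), hx, hst,
      Nat.mul_div_cancel _ ht0]
  have hoy : orderOf (y ^ t) = s := by
    rw [orderOf_pow_of_dvd ht0.ne' (by rw [hy, hst]; exact dvd_mul_left _ _), hy, hst,
      Nat.mul_div_cancel _ ht0]
  have hxle : Subgroup.zpowers (x ^ t) ≤ Subgroup.zpowers x := by
    rw [Subgroup.zpowers_le]; exact Subgroup.npow_mem_zpowers x t
  have hyle : Subgroup.zpowers (y ^ t) ≤ Subgroup.zpowers y := by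
    rw [Subgroup.zpowers_le]; exact Subgroup.npow_mem_zpowers y t
  have hint : Subgroup.zpowers (x ^ t) ⊓ Subgroup.zpowers (y ^ t) = ⊥ :=
    le_bot_iff.1 (hinter ▸ inf_le_inf hxle hyle)
  have hcardG : Nat.card G = s ^ 2 * t ^ 2 := by
    have hc := Subgroup.isComplement'_of_disjoint_and_mul_eq_univ (disjoint_iff.2 hinter) hprod
    have := hc.card_mul_card
    rw [Nat.card_zpowers, Nat.card_zpowers, hx, hy, hst] at this
    rw [← this]; ring
  have hcz : ∀ z : G, ∀ a ∈ Subgroup.zpowers z, ∀ a' ∈ Subgroup.zpowers z, a * a' = a' * a := by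
    rintro z _ ⟨i, rfl⟩ _ ⟨j, rfl⟩
    exact zpow_mul_comm z i j
  have hAB : ∀ g : G, ∃ a ∈ Subgroup.zpowers x, ∃ b ∈ Subgroup.zpowers y, g = a * b := by
    intro g
    have : g ∈ (↑(Subgroup.zpowers x) * ↑(Subgroup.zpowers y) : Set G) := by
      rw [hprod]; trivial
    obtain ⟨a, ha, b, hb, h⟩ := Set.mem_mul.1 this
    exact ⟨a, ha, b, hb, h.symm⟩
  have hpow := pow_closure_eq_one _ _ (hcz x) (hcz y) hAB s t hcop hcardG (x ^ t) (y ^ t)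
    (Subgroup.npow_mem_zpowers x t) (Subgroup.npow_mem_zpowers y t)
    (by rw [← hox]; exact pow_orderOf_eq_one _) (by rw [← hoy]; exact pow_orderOf_eq_one _)
  have hαxt : α (x ^ t) = y ^ t := by rw [map_pow, hαx]
  have hαyt : α (y ^ t) = x ^ t := by rw [map_pow, hαy]
  have hsub : (↑(Subgroup.zpowers (x ^ t)) * ↑(Subgroup.zpowers (y ^ t)) : Set G) ⊆
      ((Subgroup.closure ({x ^ t, y ^ t} : Set G) : Subgroup G) : Set G) := by
    rintro _ ⟨a, ha, b, hb, rfl⟩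
    refine mul_mem ?_ ?_
    · exact (Subgroup.zpowers_le.2 (Subgroup.subset_closure (by simp))) ha
    · exact (Subgroup.zpowers_le.2 (Subgroup.subset_closure (by simp))) hb
  have hncard : (↑(Subgroup.zpowers (x ^ t)) * ↑(Subgroup.zpowers (y ^ t)) : Set G).ncard
      = s ^ 2 := by
    have hinj := Subgroup.mul_injective_of_disjoint (disjoint_iff.2 hint)
    have hr : (↑(Subgroup.zpowers (x ^ t)) * ↑(Subgroup.zpowers (y ^ t)) : Set G) =
        Set.range (fun g : Subgroup.zpowers (x ^ t) × Subgroup.zpowers (y ^ t) =>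
          (g.1 : G) * (g.2 : G)) := by
      ext g
      constructor
      · rintro ⟨a, ha, b, hb, rfl⟩
        exact ⟨(⟨a, ha⟩, ⟨b, hb⟩), rfl⟩
      · rintro ⟨⟨a, b⟩, rfl⟩
        exact Set.mul_mem_mul a.2 b.2
    rw [hr, ← Nat.card_coe_set_eq, Nat.card_range_of_injective hinj, Nat.card_prod,
      Nat.card_zpowers, Nat.card_zpowers, hox, hoy, sq]
  have hHcop : Nat.Coprime (Nat.card (Subgroup.closure ({x ^ t, y ^ t} : Set G))) (t ^ 2) := by
    refine coprime_card_of_pow (s ^ 3) _ (Nat.Coprime.pow 3 2 hcop) ?_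
    intro g
    exact Subtype.ext (by simpa using hpow g g.2)
  have hHdvd : Nat.card (Subgroup.closure ({x ^ t, y ^ t} : Set G)) ∣ s ^ 2 :=
    hHcop.dvd_of_dvd_mul_right (hcardG ▸ Subgroup.card_subgroup_dvd_card _)
  have hHle := Nat.le_of_dvd (by positivity) hHdvd
  have heq := Set.eq_of_subset_of_ncard_le hsub (by
    rw [hncard, ← Nat.card_coe_set_eq]; exact hHle) (Set.toFinite _)
  have hHcard : Nat.card (Subgroup.closure ({x ^ t, y ^ t} : Set G)) = s ^ 2 := by
    rw [← hncard, heq, ← Nat.card_coe_set_eq]; rfl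
  refine ⟨heq.symm, hox, hoy, hint, hHcard, ?_, ?_, hαxt, hαyt, ?_⟩
  · intro p hp hpd
    rw [hHcard] at hpd
    exact hsπ p hp (hp.dvd_of_dvd_pow hpd)
  · intro p hp hpπ hpd
    have h1 := (Subgroup.closure ({x ^ t, y ^ t} : Set G)).card_mul_index
    rw [hHcard, hcardG] at h1
    rw [Nat.eq_of_mul_eq_mul_left (by positivity) h1] at hpd
    exact htπ p hp (hp.dvd_of_dvd_pow hpd) hpπ
  · have hmap : (Subgroup.closure ({x ^ t, y ^ t} : Set G)).map (α : G →* G) =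
        Subgroup.closure ({x ^ t, y ^ t} : Set G) := by
      rw [MonoidHom.map_closure, Set.image_pair]
      simp only [MonoidHom.coe_coe, hαxt, hαyt]
      rw [Set.pair_comm]
    refine ⟨(α.subgroupMap _).trans (MulEquiv.subgroupCongr hmap), ?_, ?_⟩
    · exact Subtype.ext hαxt
    · exact Subtype.ext hαyt
end

section
/- Let G be an n-isobicyclic group, let p be a prime dividing n, let P be a normal Sylow p-subgroup of G, and let K be a Sylow p-complement of G (a subgroup with |K| = |G|/|P| and gcd(|K|, p) = 1). Then the quotient P/Φ(P) is elementary abelian of order p² (isomorphic to C_p × C_p), and the kernel of the homomorphism K → Aut(P/Φ(P)) induced by conjugation is exactly the centraliser C_K(P) = K ∩ C_G(P); hence K/C_K(P) embeds into Aut(P/Φ(P)) ≅ GL₂(F_p). -/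
open scoped Pointwise

theorem coatom_quot {P : Type*} [Group P] [Finite P] {p : ℕ} (hp : p.Prime) (hP : IsPGroup p P)
    (M : Subgroup P) (hM : IsCoatom M) :
    (∀ a b : P, a * b * (b * a)⁻¹ ∈ M) ∧ ∀ a : P, a ^ p ∈ M := by
  have := Fact.mk hp
  have : Group.IsNilpotent P := hP.isNilpotent
  have hMn : M.Normal := Subgroup.NormalizerCondition.normal_of_coatom M Group.normalizerCondition_of_isNilpotent hM
  have hnt : Nontrivial (P ⧸ M) := QuotientGroup.nontrivial_iff.mpr hM.1
  have : IsSimpleGroup (P ⧸ M) := by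
    refine ⟨fun H _ => ?_⟩
    have h1 : M ≤ H.comap (QuotientGroup.mk' M) := by
      intro x hx
      rw [Subgroup.mem_comap, QuotientGroup.mk'_apply, (QuotientGroup.eq_one_iff x).mpr hx]
      exact H.one_mem
    rcases hM.le_iff.mp h1 with h | h
    · right
      rw [eq_top_iff]
      intro q _
      obtain ⟨x, rfl⟩ := QuotientGroup.mk'_surjective M q
      have : x ∈ H.comap (QuotientGroup.mk' M) := h ▸ Subgroup.mem_top x
      exact this
    · left
      rw [eq_bot_iff]
      intro q hq
      obtain ⟨x, rfl⟩ := QuotientGroup.mk'_surjective M q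
      have : x ∈ H.comap (QuotientGroup.mk' M) := hq
      rw [h] at this
      exact (QuotientGroup.eq_one_iff x).mpr this
  have hs : Group.IsSolvable (P ⧸ M) := inferInstance
  have hc : ∀ a b : P ⧸ M, a * b = b * a := IsSimpleGroup.comm_iff_isSolvable.mpr hs
  let : CommGroup (P ⧸ M) := { (inferInstance : Group (P ⧸ M)) with mul_comm := hc }
  have hpr : (Nat.card (P ⧸ M)).Prime := CommGroup.is_simple_iff_prime_card.mp ‹_›
  have hcard : Nat.card (P ⧸ M) = p := by
    obtain ⟨k, hk⟩ := IsPGroup.iff_card.mp (hP.to_quotient M)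
    rw [hk] at hpr ⊢
    rw [Nat.Prime.eq_one_of_pow hpr, pow_one]
  refine ⟨fun a b => ?_, fun a => ?_⟩
  · rw [← QuotientGroup.eq_one_iff]
    change (a : P ⧸ M) * b * (b * a : P ⧸ M)⁻¹ = 1
    rw [hc a b, mul_inv_cancel]
  · rw [← QuotientGroup.eq_one_iff]
    change (a : P ⧸ M) ^ p = 1
    rw [← hcard]
    exact pow_card_eq_one'

theorem frattini_pgroup {P : Type*} [Group P] [Finite P] {p : ℕ} (hp : p.Prime)
    (hP : IsPGroup p P) :
    (∀ a b : P ⧸ frattini P, a * b = b * a) ∧ ∀ a : P ⧸ frattini P, a ^ p = 1 := by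
  have key : ∀ z : P, (∀ M : Subgroup P, IsCoatom M → z ∈ M) → z ∈ frattini P := by
    intro z hz
    simp only [frattini, Order.radical, Subgroup.mem_iInf]
    exact hz
  constructor
  · intro a b
    obtain ⟨a, rfl⟩ := QuotientGroup.mk_surjective a
    obtain ⟨b, rfl⟩ := QuotientGroup.mk_surjective b
    rw [← mul_inv_eq_one]
    exact (QuotientGroup.eq_one_iff _).mpr (key (a * b * (b * a)⁻¹) fun M hM => (coatom_quot hp hP M hM).1 a b)
  · intro a
    obtain ⟨a, rfl⟩ := QuotientGroup.mk_surjective a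
    exact (QuotientGroup.eq_one_iff _).mpr (key (a ^ p) fun M hM => (coatom_quot hp hP M hM).2 a)

/-- prime order case of Burnside's coprime action theorem -/
theorem burnside_prime {P : Type*} [Group P] [Finite P] {p : ℕ} (hp : p.Prime)
    (hP : IsPGroup p P) (σ : MulAut P) (q : ℕ) (hq : q.Prime) (hqp : q ≠ p) (ho : orderOf σ = q)
    (hσ : ∀ g, σ g * g⁻¹ ∈ frattini P) : σ = 1 := by
  have := Fact.mk hp
  have := Fact.mk hq
  let Q : Subgroup (MulAut P) := Subgroup.zpowers σ
  have hQ : IsPGroup q Q := IsPGroup.of_card (n := 1) (by rw [Nat.card_zpowers, ho, pow_one])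
  let F : Subgroup P :=
    { carrier := {g | σ g = g}
      mul_mem' := by intro a b ha hb; simp only [Set.mem_ofPred_eq] at *; rw [map_mul, ha, hb]
      one_mem' := map_one σ
      inv_mem' := by intro a ha; simp only [Set.mem_ofPred_eq] at *; rw [map_inv, ha] }
  have hinv : ∀ τ ∈ Q, ∀ g, τ g * g⁻¹ ∈ frattini P := by
    let A : Subgroup (MulAut P) :=
      { carrier := {τ | ∀ g, τ g * g⁻¹ ∈ frattini P}
        mul_mem' := by
          intro a b ha hb g
          have := mul_mem (ha (b g)) (hb g)
          simpa [mul_assoc] using this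
        one_mem' := by intro g; simp [one_mem]
        inv_mem' := by
          intro a ha g
          have := inv_mem (ha (a⁻¹ g))
          simpa using this }
    have : Q ≤ A := Subgroup.zpowers_le.mpr hσ
    intro τ hτ; exact this hτ
  have hF : F = ⊤ := by
    apply frattini_nongenerating
    rw [eq_top_iff]
    intro g _
    let S : Type _ := {z : P // z * g⁻¹ ∈ frattini P}
    let : MulAction Q S :=
      { smul := fun τ z => ⟨(τ : MulAut P) z.1, by
          have := mul_mem (hinv τ τ.2 z.1) z.2
          simpa [mul_assoc] using this⟩
        one_smul := fun z => Subtype.ext rfl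
        mul_smul := fun a b z => Subtype.ext rfl }
    have hS : Nat.card S = Nat.card (frattini P) :=
      Nat.card_congr
        { toFun := fun z => ⟨z.1 * g⁻¹, z.2⟩
          invFun := fun z => ⟨z.1 * g, by simp⟩
          left_inv := fun z => by simp
          right_inv := fun z => by simp }
    have hnd : ¬ q ∣ Nat.card S := by
      obtain ⟨k, hk⟩ := IsPGroup.iff_card.mp (hP.to_subgroup (frattini P))
      rw [hS, hk]
      intro h
      exact hqp ((Nat.prime_dvd_prime_iff_eq hq hp).mp (hq.dvd_of_dvd_pow h))
    obtain ⟨z, hz⟩ := hQ.nonempty_fixed_point_of_prime_not_dvd_card S hnd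
    have hz' : z.1 ∈ F := congrArg Subtype.val (hz ⟨σ, Subgroup.mem_zpowers σ⟩)
    have h3 := inv_mem ((inferInstance : (frattini P).Normal).conj_mem _ z.2 z.1⁻¹)
    have h4 : g = z.1 * (z.1⁻¹ * (z.1 * g⁻¹) * z.1⁻¹⁻¹)⁻¹ := by group
    rw [h4]
    exact mul_mem (Subgroup.mem_sup_left hz') (Subgroup.mem_sup_right h3)
  ext g
  have : g ∈ F := hF ▸ Subgroup.mem_top g
  exact this

theorem burnside_coprime {P : Type*} [Group P] [Finite P] {p : ℕ} (hp : p.Prime)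
    (hP : IsPGroup p P) (σ : MulAut P) (ho : (orderOf σ).Coprime p)
    (hσ : ∀ g, σ g * g⁻¹ ∈ frattini P) : σ = 1 := by
  by_contra hne
  have h1 : orderOf σ ≠ 1 := by rwa [Ne, orderOf_eq_one_iff]
  obtain ⟨q, hq, d, hd⟩ := Nat.exists_prime_and_dvd h1
  have hpos : 0 < orderOf σ := orderOf_pos σ
  have hd0 : d ≠ 0 := by rintro rfl; omega
  have ho2 : orderOf (σ ^ d) = q := by
    rw [orderOf_pow_of_dvd hd0 ⟨q, by rw [hd, mul_comm]⟩, hd, Nat.mul_div_cancel _ (Nat.pos_of_ne_zero hd0)]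
  have hqp : q ≠ p := by
    rintro rfl
    rw [hd] at ho
    exact hq.one_lt.ne' (Nat.Coprime.eq_one_of_dvd (Nat.Coprime.coprime_mul_right ho) dvd_rfl)
  have hall : ∀ d : ℕ, ∀ g, (σ ^ d) g * g⁻¹ ∈ frattini P := by
    intro d
    induction d with
    | zero => intro g; simp [one_mem]
    | succ k ih =>
      intro g
      rw [pow_succ']
      have := mul_mem (hσ ((σ ^ k) g)) (ih g)
      simpa [mul_assoc] using this
  have := burnside_prime hp hP (σ ^ d) q hq hqp ho2 (hall d)
  rw [this, orderOf_one] at ho2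
  exact hq.one_lt.ne ho2

/-- a finite `p`-group which is generated by `a, b` of order `p^e` and has order `p^(2e)` -/
theorem frattini_card {P : Type*} [Group P] [Finite P] {p : ℕ} (hp : p.Prime)
    (hP : IsPGroup p P) (a b : P) (e : ℕ) (he : 0 < e) (ha : a ^ (p ^ e) = 1) (hb : b ^ (p ^ e) = 1)
    (hc : Nat.card P = p ^ (2 * e)) (hgen : ∀ g : P, ∃ i j : ℕ, g = a ^ i * b ^ j) :
    Nat.card (P ⧸ frattini P) = p ^ 2 := by
  have := Fact.mk hp
  obtain ⟨hcomm, hpow⟩ := frattini_pgroup hp hP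
  obtain ⟨k, hk⟩ := IsPGroup.iff_card.mp (hP.to_quotient (frattini P))
  have hle : Nat.card (P ⧸ frattini P) ≤ p ^ 2 := by
    let f : Fin p × Fin p → P ⧸ frattini P := fun ij =>
      (a : P ⧸ frattini P) ^ (ij.1 : ℕ) * (b : P ⧸ frattini P) ^ (ij.2 : ℕ)
    have hf : Function.Surjective f := by
      intro q
      obtain ⟨g, rfl⟩ := QuotientGroup.mk_surjective q
      obtain ⟨i, j, rfl⟩ := hgen g
      refine ⟨(⟨i % p, Nat.mod_lt _ hp.pos⟩, ⟨j % p, Nat.mod_lt _ hp.pos⟩), ?_⟩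
      simp only [f]
      have hm : ∀ (q : P ⧸ frattini P) (i : ℕ), q ^ (i % p) = q ^ i := fun q i =>
        ((pow_eq_pow_iff_modEq).mpr ((Nat.mod_modEq i p).of_dvd (orderOf_dvd_of_pow_eq_one (hpow q))))
      rw [hm, hm]
      rfl
    calc _ ≤ Nat.card (Fin p × Fin p) := Nat.card_le_card_of_surjective f hf
      _ = p ^ 2 := by simp [sq]
  rw [hk] at hle
  have hk2 : k ≤ 2 := (Nat.pow_le_pow_iff_right hp.one_lt).mp hle
  rcases Nat.lt_or_ge k 2 with h | h
  · exfalso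
    have : IsCyclic (P ⧸ frattini P) := by
      interval_cases k
      · rw [pow_zero] at hk
        have := (Nat.card_eq_one_iff_unique.mp hk).1
        infer_instance
      · rw [pow_one] at hk
        exact isCyclic_of_prime_card hk
    obtain ⟨q, hq⟩ := IsCyclic.exists_generator (α := P ⧸ frattini P)
    obtain ⟨g, rfl⟩ := QuotientGroup.mk_surjective q
    have hz : Subgroup.zpowers g = ⊤ := by
      apply frattini_nongenerating
      rw [eq_top_iff]
      intro z _
      obtain ⟨m, hm⟩ := Subgroup.mem_zpowers_iff.mp (hq z)
      have : (g ^ m)⁻¹ * z ∈ frattini P := QuotientGroup.eq.mp (by simpa using hm)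
      rw [show z = g ^ m * ((g ^ m)⁻¹ * z) by group]
      exact mul_mem (Subgroup.mem_sup_left (Subgroup.zpow_mem_zpowers g m)) (Subgroup.mem_sup_right this)
    have hcab : Commute a b := by
      have h1 : a ∈ Subgroup.zpowers g := hz ▸ Subgroup.mem_top a
      have h2 : b ∈ Subgroup.zpowers g := hz ▸ Subgroup.mem_top b
      obtain ⟨i, rfl⟩ := Subgroup.mem_zpowers_iff.mp h1
      obtain ⟨j, rfl⟩ := Subgroup.mem_zpowers_iff.mp h2
      exact Commute.zpow_zpow_self g i j
    have hg : g ^ (p ^ e) = 1 := by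
      obtain ⟨i, j, rfl⟩ := hgen g
      rw [(hcab.pow_pow i j).mul_pow, ← pow_mul, ← pow_mul, mul_comm i, mul_comm j, pow_mul, pow_mul, ha, hb]
      simp
    have h5 : orderOf g = p ^ (2 * e) := by
      rw [← hc, ← Nat.card_zpowers, hz, Subgroup.card_top]
    have h6 := Nat.le_of_dvd (pow_pos hp.pos _) (orderOf_dvd_of_pow_eq_one hg)
    rw [h5] at h6
    have := (Nat.pow_le_pow_iff_right hp.one_lt).mp h6
    omega
  · rw [hk, show k = 2 by omega]

theorem mulAut_embed {Q : Type*} [CommGroup Q] [Finite Q] {p : ℕ} (hp : p.Prime)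
    (hpow : ∀ a : Q, a ^ p = 1) (hc : Nat.card Q = p ^ 2) :
    ∃ f : MulAut Q →* Matrix.GeneralLinearGroup (Fin 2) (ZMod p), Function.Injective f := by
  have := Fact.mk hp
  let _ : Module (ZMod p) (Additive Q) := AddCommGroup.zmodModule (n := p) fun z => hpow z.toMul
  have hfin : Module.Finite (ZMod p) (Additive Q) := Module.Finite.of_finite
  have hr : Module.finrank (ZMod p) (Additive Q) = 2 := by
    have h1 := Module.natCard_eq_pow_finrank (K := ZMod p) (V := Additive Q)
    rw [Nat.card_zmod] at h1
    have h2 : Nat.card (Additive Q) = p ^ 2 := hc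
    rw [h2] at h1
    exact (Nat.pow_right_injective hp.two_le h1).symm
  let b := Module.finBasisOfFinrankEq (ZMod p) (Additive Q) hr
  let f0 : MulAut Q →* Matrix (Fin 2) (Fin 2) (ZMod p) :=
    { toFun := fun σ => LinearMap.toMatrixAlgEquiv b
        (AddMonoidHom.toZModLinearMap p (MonoidHom.toAdditive σ.toMonoidHom))
      map_one' := by
        rw [← map_one (LinearMap.toMatrixAlgEquiv b)]
        rfl
      map_mul' := fun σ τ => by
        rw [← map_mul (LinearMap.toMatrixAlgEquiv b)]
        rfl }
  refine ⟨f0.toHomUnits, fun σ τ h => ?_⟩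
  have h1 : f0 σ = f0 τ := congrArg Units.val h
  have h2 := (LinearMap.toMatrixAlgEquiv b).injective h1
  ext q
  exact congrArg Additive.toMul (LinearMap.congr_fun h2 (Additive.ofMul q))

theorem mulAut_embed' {Q : Type*} [hG : Group Q] [Finite Q] {p : ℕ} (hp : p.Prime)
    (hcomm : ∀ a b : Q, a * b = b * a)
    (hpow : ∀ a : Q, a ^ p = 1) (hc : Nat.card Q = p ^ 2) :
    ∃ f : MulAut Q →* Matrix.GeneralLinearGroup (Fin 2) (ZMod p), Function.Injective f :=
  @mulAut_embed Q { hG with mul_comm := hcomm } _ p hp hpow hc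

/-- The action on `P / Φ(P)`. -/
def autFrattini (P : Type*) [Group P] : MulAut P →* MulAut (P ⧸ frattini P) where
  toFun σ := QuotientGroup.congr (frattini P) (frattini P) σ
    (Subgroup.characteristic_iff_map_eq.mp inferInstance σ)
  map_one' := by
    ext q
    obtain ⟨g, rfl⟩ := QuotientGroup.mk_surjective q
    rfl
  map_mul' σ τ := by
    ext q
    obtain ⟨g, rfl⟩ := QuotientGroup.mk_surjective q
    rfl

theorem autFrattini_eq_one {P : Type*} [Group P] (σ : MulAut P) :
    autFrattini P σ = 1 ↔ ∀ g, σ g * g⁻¹ ∈ frattini P := by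
  have key : ∀ g : P, (σ g : P ⧸ frattini P) = g ↔ σ g * g⁻¹ ∈ frattini P := by
    intro g
    rw [← QuotientGroup.eq_one_iff, ← mul_inv_eq_one]
    rfl
  constructor
  · intro h g
    exact (key g).mp (DFunLike.congr_fun h (g : P ⧸ frattini P))
  · intro h
    ext q
    obtain ⟨g, rfl⟩ := QuotientGroup.mk_surjective q
    exact (key g).mpr (h g)

theorem conjNormal_eq_one {G : Type*} [Group G] (P : Subgroup G) [P.Normal] (k : G) :
    (MulAut.conjNormal k : MulAut P) = 1 ↔ k ∈ Subgroup.centralizer (P : Set G) := by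
  rw [Subgroup.mem_centralizer_iff]
  constructor
  · intro h g hg
    have h1 : (MulAut.conjNormal k : MulAut P) ⟨g, hg⟩ = ⟨g, hg⟩ := by rw [h]; rfl
    have h2 := congrArg Subtype.val h1
    rw [MulAut.conjNormal_apply] at h2
    exact (mul_inv_eq_iff_eq_mul.mp h2).symm
  · intro h
    ext g
    rw [MulAut.conjNormal_apply, ← h g g.2]
    simp

theorem sylow_gen {G : Type*} [Group G] [Finite G] (n : ℕ) (hn : 0 < n) (x y : G)
    (hx : orderOf x = n) (hy : orderOf y = n)
    (hprod : (↑(Subgroup.zpowers x) * ↑(Subgroup.zpowers y) : Set G) = Set.univ)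
    (hinter : Subgroup.zpowers x ⊓ Subgroup.zpowers y = ⊥)
    (p : ℕ) (hp : p.Prime) (hpn : p ∣ n)
    (P : Sylow p G) (hPnormal : (P : Subgroup G).Normal) :
    Nat.card ((P : Subgroup G) ⧸ frattini (P : Subgroup G)) = p ^ 2 := by
  have := Fact.mk hp
  have hG : Nat.card G = n * n := by
    have := (Subgroup.isComplement'_of_disjoint_and_mul_eq_univ
      (disjoint_iff.mpr hinter) hprod).card_mul_card
    rw [Nat.card_zpowers, Nat.card_zpowers, hx, hy] at this
    exact this.symm
  let e := n.factorization p
  have he : 0 < e := hp.factorization_pos_of_dvd hn.ne' hpn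
  have hPc : Nat.card (P : Subgroup G) = p ^ (2 * e) := by
    have h := P.card_eq_multiplicity
    rw [hG, Nat.factorization_mul hn.ne' hn.ne', Finsupp.add_apply, ← two_mul] at h
    exact h
  let m := n / p ^ e
  have hdvd : p ^ e ∣ n := Nat.ordProj_dvd n p
  have hnm : n = m * p ^ e := (Nat.div_mul_cancel hdvd).symm
  have hm0 : m ≠ 0 := by intro h; rw [h] at hnm; omega
  have hord : ∀ z : G, orderOf z = n → orderOf (z ^ m) = p ^ e := by
    intro z hz
    rw [orderOf_pow_of_dvd hm0 (by rw [hz]; exact ⟨_, hnm⟩), hz]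
    exact Nat.div_eq_of_eq_mul_right (Nat.pos_of_ne_zero hm0) hnm
  have hmem : ∀ z : G, orderOf z = n → z ^ m ∈ (P : Subgroup G) := by
    intro z hz
    have h1 : IsPGroup p (Subgroup.zpowers (z ^ m)) :=
      IsPGroup.of_card (n := e) (by rw [Nat.card_zpowers, hord z hz])
    have h2 := IsPGroup.to_sup_of_normal_right h1 P.isPGroup'
    have h3 := P.is_maximal' h2 le_sup_right
    rw [← h3]
    exact Subgroup.mem_sup_left (Subgroup.mem_zpowers _)
  let a : (P : Subgroup G) := ⟨x ^ m, hmem x hx⟩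
  let b : (P : Subgroup G) := ⟨y ^ m, hmem y hy⟩
  have ha : orderOf a = p ^ e := by rw [← hord x hx]; exact Subgroup.orderOf_mk _ _
  have hb : orderOf b = p ^ e := by rw [← hord y hy]; exact Subgroup.orderOf_mk _ _
  have hdis : Disjoint (Subgroup.zpowers a) (Subgroup.zpowers b) := by
    rw [Subgroup.disjoint_def]
    intro z hza hzb
    obtain ⟨i, hi⟩ := Subgroup.mem_zpowers_iff.mp hza
    obtain ⟨j, hj⟩ := Subgroup.mem_zpowers_iff.mp hzb
    have h1 : (z : G) ∈ Subgroup.zpowers x := by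
      rw [← hi]
      exact zpow_mem (pow_mem (Subgroup.mem_zpowers x) m) i
    have h2 : (z : G) ∈ Subgroup.zpowers y := by
      rw [← hj]
      exact zpow_mem (pow_mem (Subgroup.mem_zpowers y) m) j
    have h3 : (z : G) ∈ (⊥ : Subgroup G) := hinter ▸ Subgroup.mem_inf.mpr ⟨h1, h2⟩
    exact Subtype.ext (Subgroup.mem_bot.mp h3)
  have hcompl := Subgroup.isComplement'_of_card_mul_and_disjoint
    (by rw [Nat.card_zpowers, Nat.card_zpowers, ha, hb, hPc, two_mul, pow_add]) hdis
  refine frattini_card hp P.isPGroup' a b e he (ha ▸ pow_orderOf_eq_one a)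
    (hb ▸ pow_orderOf_eq_one b) hPc fun g => ?_
  obtain ⟨⟨⟨u, hu⟩, ⟨v, hv⟩⟩, huv⟩ := hcompl.2 g
  obtain ⟨i, hi⟩ := mem_powers_iff_mem_zpowers.mpr hu
  obtain ⟨j, hj⟩ := mem_powers_iff_mem_zpowers.mpr hv
  refine ⟨i, j, ?_⟩
  rw [← huv]
  simp only at hi hj ⊢
  rw [hi, hj]



/-- If `G` is `n`-isobicyclic, `P` is a normal Sylow `p`-subgroup and `K` a
Sylow `p`-complement, then `P/Φ(P)` is elementary abelian of order `p²`, the kernel of the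
conjugation action of `K` on `P/Φ(P)` is exactly `C_K(P)`, and hence `K/C_K(P)` embeds into
`Aut(P/Φ(P)) ≅ GL₂(F_p)`. -/
theorem isobicyclic_complement_action_kernel
    {G : Type*} [Group G] [Finite G] (n : ℕ) (hn : 0 < n) (x y : G)
    (hx : orderOf x = n) (hy : orderOf y = n)
    (hprod : (↑(Subgroup.zpowers x) * ↑(Subgroup.zpowers y) : Set G) = Set.univ)
    (hinter : Subgroup.zpowers x ⊓ Subgroup.zpowers y = ⊥)
    (α : G ≃* G) (hαx : α x = y) (hαy : α y = x)
    (p : ℕ) (hp : p.Prime) (hpn : p ∣ n)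
    (P : Sylow p G) (hPnormal : (P : Subgroup G).Normal)
    (K : Subgroup G) (hKcard : Nat.card K = Nat.card G / Nat.card (P : Subgroup G))
    (hKp : (Nat.card K).Coprime p) :
    -- `P/Φ(P)` is elementary abelian of order `p²` (so `≅ C_p × C_p`)
    (∀ a b : (P : Subgroup G) ⧸ frattini (P : Subgroup G), a * b = b * a) ∧
    (∀ a : (P : Subgroup G) ⧸ frattini (P : Subgroup G), a ^ p = 1) ∧
    Nat.card ((P : Subgroup G) ⧸ frattini (P : Subgroup G)) = p ^ 2 ∧
    -- kernel of the conjugation action of `K` on `P/Φ(P)` is exactly `C_K(P)`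
    (∀ k ∈ K,
      ((∀ g ∈ (P : Subgroup G),
          k⁻¹ * g * k * g⁻¹ ∈ (frattini (P : Subgroup G)).map (P : Subgroup G).subtype) ↔
        k ∈ Subgroup.centralizer ((P : Subgroup G) : Set G))) ∧
    -- hence `K/C_K(P)` embeds into `GL₂(F_p)`
    ∃ ι : K →* Matrix.GeneralLinearGroup (Fin 2) (ZMod p),
      ∀ k : K, ι k = 1 ↔ (k : G) ∈ Subgroup.centralizer ((P : Subgroup G) : Set G) := by
  have hPc := sylow_gen n hn x y hx hy hprod hinter p hp hpn P hPnormal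
  obtain ⟨hcomm, hpow⟩ := frattini_pgroup hp P.isPGroup'
  have main : ∀ k ∈ K, autFrattini (P : Subgroup G) (MulAut.conjNormal k) = 1 ↔
      k ∈ Subgroup.centralizer ((P : Subgroup G) : Set G) := by
    intro k hk
    rw [← conjNormal_eq_one]
    constructor
    · intro h
      refine burnside_coprime hp P.isPGroup' _ ?_ ((autFrattini_eq_one _).mp h)
      refine Nat.Coprime.coprime_dvd_left ?_ hKp
      exact (orderOf_map_dvd MulAut.conjNormal k).trans (Subgroup.orderOf_dvd_natCard K hk)
    · intro h
      rw [h, map_one]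
  refine ⟨hcomm, hpow, hPc, ?_, ?_⟩
  · intro k hk
    have h1 := main k⁻¹ (inv_mem hk)
    rw [inv_mem_iff, autFrattini_eq_one] at h1
    rw [← h1]
    constructor
    · intro h g
      obtain ⟨z, hz, hz2⟩ := Subgroup.mem_map.mp (h g g.2)
      have : MulAut.conjNormal k⁻¹ g * g⁻¹ = z := by
        apply Subtype.ext
        rw [Subgroup.coe_mul, MulAut.conjNormal_apply, inv_inv]
        exact hz2.symm
      rw [this]
      exact hz
    · intro h g hg
      refine Subgroup.mem_map.mpr ⟨_, h ⟨g, hg⟩, ?_⟩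
      rw [Subgroup.coe_subtype, Subgroup.coe_mul, MulAut.conjNormal_apply, inv_inv]
      rfl
  · obtain ⟨f, hf⟩ := mulAut_embed' hp hcomm hpow hPc
    refine ⟨f.comp ((autFrattini (P : Subgroup G)).comp (MulAut.conjNormal.comp K.subtype)), ?_⟩
    intro k
    rw [← main k k.2]
    exact map_eq_one_iff f hf
end

section
/- Let p be a prime and let P be a nonabelian finite p-group that is p^e-isobicyclic with canonical generators x, y and automorphism α of P transposing x and y. Let β be an automorphism of P with β(x) = x, and let A be the subgroup of Aut(P) generated by β and α∘β∘α⁻¹. If the order of A is coprime to p, then A is the trivial group (so β is the identity automorphism). -/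
open scoped Pointwise commutatorElement

theorem ib_frattini {P : Type*} [Group P] [Finite P] {p : ℕ} [Fact p.Prime] (hP : IsPGroup p P) :
    (∀ a b : P, a * b * a⁻¹ * b⁻¹ ∈ frattini P) ∧ ∀ a : P, a ^ p ∈ frattini P := by
  have hnil : Group.IsNilpotent P := hP.isNilpotent
  have key : ∀ H : Subgroup P, IsCoatom H →
      (∀ a b : P, a * b * a⁻¹ * b⁻¹ ∈ H) ∧ ∀ a : P, a ^ p ∈ H := by
    intro H hH
    have hq := (Group.isNilpotent_of_finite_tfae (G := P)).out 0 2
    have hn : H.Normal := hq.mp hnil H hH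
    have hnt : Nontrivial (P ⧸ H) := QuotientGroup.nontrivial_iff.mpr hH.1
    have hs : IsSimpleGroup (P ⧸ H) := by
      refine ⟨fun N hN => ?_⟩
      have hle : H ≤ N.comap (QuotientGroup.mk' H) := by
        intro h hh
        have : (QuotientGroup.mk' H) h = 1 := by simpa using hh
        rw [Subgroup.mem_comap, this]; exact N.one_mem
      rcases hH.le_iff.mp hle with h | h
      · right
        rw [← Subgroup.map_comap_eq_self_of_surjective (QuotientGroup.mk'_surjective H) N, h]
        exact Subgroup.map_top_of_surjective _ (QuotientGroup.mk'_surjective H)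
      · left
        rw [← Subgroup.map_comap_eq_self_of_surjective (QuotientGroup.mk'_surjective H) N, h]
        simp
    have hcomm : ∀ a b : P ⧸ H, a * b = b * a := IsSimpleGroup.comm_iff_isSolvable.mpr inferInstance
    have hpr : (Nat.card (P ⧸ H)).Prime := by
      let _ : CommGroup (P ⧸ H) := { (inferInstance : Group (P ⧸ H)) with mul_comm := hcomm }
      exact CommGroup.is_simple_iff_prime_card.mp hs
    have hcard : Nat.card (P ⧸ H) = p := by
      obtain ⟨n, hn⟩ := (hP.to_quotient H).exists_card_eq
      rw [hn] at hpr ⊢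
      have := hpr.eq_one_of_pow
      subst this
      simp
    constructor
    · intro a b
      rw [← QuotientGroup.eq_one_iff]
      rw [QuotientGroup.mk_mul, QuotientGroup.mk_mul, QuotientGroup.mk_mul, hcomm a b,
        QuotientGroup.mk_inv, QuotientGroup.mk_inv]
      group
    · intro a
      rw [← QuotientGroup.eq_one_iff]
      rw [QuotientGroup.mk_pow, ← hcard, pow_card_eq_one']
  constructor
  · intro a b
    simp only [frattini, Order.radical, Subgroup.mem_iInf]
    exact fun H hH => (key H hH).1 a b
  · intro a
    simp only [frattini, Order.radical, Subgroup.mem_iInf]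
    exact fun H hH => (key H hH).2 a

theorem ib_char {P : Type*} [Group P] (K : Subgroup P) [hK : K.Characteristic] (δ : MulAut P)
    {g : P} (hg : g ∈ K) : δ g ∈ K :=
  (Subgroup.characteristic_iff_le_comap.mp hK δ) hg

theorem ib_char_eq {P V : Type*} [Group P] [Group V] (π : P →* V) (hK : π.ker.Characteristic)
    (δ : MulAut P) {g h : P} (hg : π g = π h) : π (δ g) = π (δ h) := by
  have h1 : h⁻¹ * g ∈ π.ker := by simp [MonoidHom.mem_ker, hg]
  have h2 := ib_char π.ker δ h1
  rw [MonoidHom.mem_ker, map_mul, map_mul, map_inv, map_inv] at h2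
  exact (inv_mul_eq_one.mp h2).symm

theorem ib_fixed {P : Type*} [Group P] [Finite P] {p r : ℕ} [Fact p.Prime] [Fact r.Prime]
    (hP : IsPGroup p P) (hr : r ≠ p) (δ : MulAut P) (hδ : δ ^ r = 1) (N : Subgroup P)
    (hN : ∀ n ∈ N, δ n ∈ N) (g : P) (hg : g⁻¹ * δ g ∈ N) : ∃ n ∈ N, δ (g * n) = g * n := by
  classical
  have := Fintype.ofFinite N
  let f : Function.End N := fun n => ⟨g⁻¹ * δ (g * n), by
    have : g⁻¹ * δ (g * n) = (g⁻¹ * δ g) * δ n := by rw [map_mul]; group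
    rw [this]; exact N.mul_mem hg (hN _ n.2)⟩
  have hf : ∀ k : ℕ, ∀ n : N, ((f ^ k) n : P) = g⁻¹ * (δ ^ k) (g * n) := by
    intro k
    induction k with
    | zero =>
      intro n
      have h1 : (f ^ 0) n = n := by rw [pow_zero]; rfl
      rw [h1]; simp
    | succ k ih =>
      intro n
      have : (f ^ (k + 1)) n = f ((f ^ k) n) := by rw [pow_succ']; rfl
      rw [this]
      show g⁻¹ * δ (g * ((f ^ k) n : P)) = _
      rw [ih, pow_succ']
      simp
  have hf1 : f ^ r ^ 1 = 1 := by
    funext n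
    apply Subtype.ext
    have h1 : (1 : Function.End N) n = n := rfl
    rw [hf, pow_one, hδ, h1]
    simp
  have hm := Equiv.Perm.card_fixedPoints_modEq hf1
  by_contra hcon
  push Not at hcon
  have hem : IsEmpty f.fixedPoints := by
    refine ⟨fun n => ?_⟩
    have h1 : f n.1 = n.1 := n.2
    have h2 := congrArg (fun m : N => g * (m : P)) h1
    exact hcon n.1 n.1.2 (by simpa [f] using h2)
  rw [Fintype.card_eq_zero (α := f.fixedPoints)] at hm
  have hd : r ∣ Fintype.card N := (Nat.modEq_zero_iff_dvd).mp hm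
  obtain ⟨n, hn⟩ := (hP.to_subgroup N).exists_card_eq
  rw [← Nat.card_eq_fintype_card, hn] at hd
  exact hr ((Nat.prime_dvd_prime_iff_eq Fact.out Fact.out).mp
    ((Fact.out : r.Prime).dvd_of_dvd_pow hd))

theorem ib_trivial {P V : Type*} [Group P] [Finite P] [CommGroup V] {p : ℕ} [Fact p.Prime]
    (hP : IsPGroup p P) (π : P →* V) (hker : π.ker = frattini P) (δ : MulAut P)
    (hδ : (orderOf δ).Coprime p) (M : Subgroup P) (hM : ∀ m ∈ M, δ m ∈ M) (s t : P)
    (hs : s⁻¹ * δ s ∈ M) (ht : π (δ t) = π t) (hMt : ∀ m ∈ M, π m ∈ Subgroup.zpowers (π t))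
    (hgen : ∀ g, ∃ i j : ℤ, π g = π s ^ i * π t ^ j) : δ = 1 := by
  have hfin : Finite (MulAut P) := DFunLike.finite _
  by_contra hne
  have hone : orderOf δ ≠ 1 := by rwa [Ne, orderOf_eq_one_iff]
  obtain ⟨r, hr, hrd⟩ := Nat.exists_prime_and_dvd hone
  have : Fact r.Prime := ⟨hr⟩
  have hrp : r ≠ p := by
    rintro rfl
    have := Nat.dvd_gcd hrd dvd_rfl
    rw [hδ] at this
    exact hr.one_lt.ne' (Nat.dvd_one.mp this)
  obtain ⟨k, hk⟩ := hrd
  have hkpos : 0 < orderOf δ := orderOf_pos δ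
  have hchar : π.ker.Characteristic := by rw [hker]; infer_instance
  have hpow : ∀ k : ℕ, (∀ m ∈ M, (δ ^ k) m ∈ M) ∧ s⁻¹ * (δ ^ k) s ∈ M ∧ π ((δ ^ k) t) = π t := by
    intro k
    induction k with
    | zero => simp
    | succ k ih =>
      obtain ⟨h1, h2, h3⟩ := ih
      refine ⟨fun m hm => ?_, ?_, ?_⟩
      · rw [pow_succ']; exact hM _ (h1 m hm)
      · rw [pow_succ', MulAut.mul_apply]
        have : s⁻¹ * δ ((δ ^ k) s) = (s⁻¹ * δ s) * δ (s⁻¹ * (δ ^ k) s) := by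
          rw [map_mul, map_inv]; group
        rw [this]; exact M.mul_mem hs (hM _ h2)
      · rw [pow_succ', MulAut.mul_apply, ib_char_eq π hchar δ h3, ht]
  have hkr : (δ ^ k) ^ r = 1 := by rw [← pow_mul, mul_comm, ← hk, pow_orderOf_eq_one]
  have hk1 : δ ^ k ≠ 1 := by
    intro h
    have h1 := orderOf_dvd_of_pow_eq_one h
    have hk0 : 0 < k := by
      rcases Nat.eq_zero_or_pos k with h | h
      · subst h; omega
      · exact h
    have := Nat.le_of_dvd hk0 h1
    have := hr.two_le
    nlinarith
  obtain ⟨h1, h2, h3⟩ := hpow k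
  apply hk1
  generalize δ ^ k = ε at *
  obtain ⟨m, hm, hsm⟩ := ib_fixed hP hrp ε hkr M h1 s h2
  obtain ⟨φ, hφ, htφ⟩ := ib_fixed hP hrp ε hkr (frattini P)
    (fun n hn => ib_char _ ε hn) t (by
      rw [← hker, MonoidHom.mem_ker, map_mul, map_inv, h3, inv_mul_cancel])
  let F : Subgroup P := ε.toMonoidHom.eqLocus (MonoidHom.id P)
  have hF : F ⊔ frattini P = ⊤ := by
    rw [eq_top_iff]
    intro g _
    obtain ⟨i, j, hij⟩ := hgen g
    obtain ⟨l, hl⟩ := Subgroup.mem_zpowers_iff.mp (hMt m hm)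
    have hφ1 : π φ = 1 := by rw [← MonoidHom.mem_ker, hker]; exact hφ
    have hh : (s * m) ^ i * (t * φ) ^ (j - i * l) ∈ F :=
      F.mul_mem (F.zpow_mem hsm i) (F.zpow_mem htφ _)
    generalize hdef : (s * m) ^ i * (t * φ) ^ (j - i * l) = h at hh
    have hπ : π h = π g := by
      rw [← hdef, hij]
      simp only [map_mul, map_zpow, hφ1, ← hl, mul_one, mul_zpow, ← zpow_mul]
      rw [mul_assoc, ← zpow_add]
      congr 2; ring
    have : g = h * (h⁻¹ * g) := by group
    rw [this]
    refine Subgroup.mul_mem_sup hh ?_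
    rw [← hker, MonoidHom.mem_ker, map_mul, map_inv, hπ, inv_mul_cancel]
  have hFt := frattini_nongenerating hF
  ext g
  have : g ∈ F := by rw [hFt]; trivial
  exact this

theorem ib_comm_pow {R : Type*} [Group R] {x y c : R} (hxc : Commute x c) (hyc : Commute y c)
    (h : x * y = y * x * c) (i j : ℤ) : x ^ i * y ^ j = y ^ j * x ^ i * c ^ (i * j) := by
  have h1 : SemiconjBy y (x * c) x := by
    rw [SemiconjBy, h, mul_assoc]
  have h2 := h1.zpow_right i
  rw [hxc.mul_zpow] at h2
  have h3 : SemiconjBy (x ^ i) y (y * c ^ i) := by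
    rw [SemiconjBy, ← h2.eq, mul_assoc, ((hxc.zpow_zpow i i)).eq]
  have h4 := h3.zpow_right j
  rw [(hyc.zpow_right i).mul_zpow, ← zpow_mul] at h4
  rw [h4.eq, mul_assoc, mul_assoc, (hxc.zpow_zpow i (i * j)).eq]

theorem ib_zpow_eq_one {R : Type*} [Group R] {p : ℕ} [hp : Fact p.Prime] (hR : IsPGroup p R)
    {c : R} {n : ℤ} (hn : ¬ (p : ℤ) ∣ n) (h : c ^ n = 1) : c = 1 := by
  obtain ⟨k, hk⟩ := hR c
  have hco : IsCoprime ((p : ℤ) ^ k) n :=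
    IsCoprime.pow_left ((Nat.prime_iff_prime_int.mp hp.out).coprime_iff_not_dvd.mpr hn)
  obtain ⟨a, b, hab⟩ := hco
  have hk' : c ^ ((p : ℤ) ^ k) = 1 := by exact_mod_cast hk
  rw [← zpow_one c, ← hab, zpow_add, mul_comm a, mul_comm b, zpow_mul, zpow_mul, hk', h]
  simp

theorem ib_case_one {P : Type*} [Group P] [Finite P] {p : ℕ} [hp : Fact p.Prime]
    (hP : IsPGroup p P) (hnab : ¬ ∀ a b : P, a * b = b * a) (x y : P)
    (hrep : ∀ g : P, ∃ i j : ℤ, g = x ^ i * y ^ j)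
    (α : MulAut P) (hαx : α x = y) (hαy : α y = x) (β : MulAut P) (hβx : β x = x)
    (a b : ℤ) (hc : x⁻¹ * y⁻¹ * x * y = x ^ a * y ^ b) (ha : x ^ a ∈ commutator P) :
    ∃ i j : ℤ, β y = x ^ i * y ^ j ∧ (p : ℤ) ∣ j - 1 := by
  have hnil : Group.IsNilpotent P := hP.isNilpotent
  have hCC : (commutator P).Characteristic := inferInstance
  let K : Subgroup P := ⁅commutator P, ⊤⁆
  have hK : K.Characteristic := by
    show (⁅commutator P, (⊤ : Subgroup P)⁆).Characteristic
    infer_instance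
  have hKn : K.Normal := inferInstance
  let ρ : P →* P ⧸ K := QuotientGroup.mk' K
  have hker : ρ.ker = K := QuotientGroup.ker_mk' K
  have hkc : ρ.ker.Characteristic := by rw [hker]; exact hK
  have hR : IsPGroup p (P ⧸ K) := hP.to_quotient K
  set c := x⁻¹ * y⁻¹ * x * y with hcdef
  have hcC : c ∈ commutator P := by
    have : c = ⁅x⁻¹, y⁻¹⁆ := by rw [commutatorElement_def, hcdef]; group
    rw [this]
    exact Subgroup.commutator_mem_commutator (Subgroup.mem_top _) (Subgroup.mem_top _)
  have hcen : ∀ g ∈ commutator P, ∀ h : P, Commute (ρ h) (ρ g) := by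
    intro g hg h
    have h1 : ⁅g, h⁆ ∈ K := Subgroup.commutator_mem_commutator hg (Subgroup.mem_top _)
    rw [← hker, MonoidHom.mem_ker, map_commutatorElement, commutatorElement_eq_one_iff_commute] at h1
    exact h1.symm
  have hxy : ρ x * ρ y = ρ y * ρ x * ρ c := by
    rw [← map_mul, ← map_mul, ← map_mul, hcdef]; congr 1; group
  have hpw := ib_comm_pow (hcen c hcC x) (hcen c hcC y) hxy
  -- the image of the commutator subgroup is generated by the image of `c`
  have hcenz : ∀ (n : ℤ) (u : P ⧸ K), u * ρ c ^ n = ρ c ^ n * u := by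
    intro n u
    obtain ⟨h, rfl⟩ := QuotientGroup.mk'_surjective K u
    exact ((hcen c hcC h).zpow_right n).eq
  have hgen : ∀ g ∈ commutator P, ∃ s : ℤ, ρ g = ρ c ^ s := by
    have : commutator P ≤ (Subgroup.zpowers (ρ c)).comap ρ := by
      rw [commutator_def, Subgroup.commutator_le]
      intro g _ h _
      obtain ⟨i, j, rfl⟩ := hrep g
      obtain ⟨k, l, rfl⟩ := hrep h
      rw [Subgroup.mem_comap, Subgroup.mem_zpowers_iff]
      refine ⟨i * l - k * j, ?_⟩
      rw [map_commutatorElement, commutatorElement_def, eq_mul_inv_iff_mul_eq, eq_mul_inv_iff_mul_eq]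
      simp only [map_mul, map_zpow]
      have e1 := hpw k j
      have e2 := hpw i l
      have L : ρ x ^ i * ρ y ^ j * (ρ x ^ k * ρ y ^ l) * ρ c ^ (k * j)
          = ρ x ^ k * ρ y ^ l * (ρ x ^ i * ρ y ^ j) * ρ c ^ (i * l) := by
        calc ρ x ^ i * ρ y ^ j * (ρ x ^ k * ρ y ^ l) * ρ c ^ (k * j)
            = ρ x ^ i * (ρ y ^ j * ρ x ^ k * ρ c ^ (k * j)) * ρ y ^ l := by
              rw [mul_assoc _ _ (ρ c ^ (k * j)), mul_assoc _ (ρ y ^ l) (ρ c ^ (k * j)), hcenz]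
              simp only [mul_assoc]
          _ = ρ x ^ k * (ρ x ^ i * ρ y ^ l) * ρ y ^ j := by
              rw [← e1]
              simp only [mul_assoc]
              rw [((Commute.refl (ρ y)).zpow_zpow j l).eq]
              simp only [← mul_assoc]
              rw [((Commute.refl (ρ x)).zpow_zpow i k).eq]
          _ = _ := by
              rw [e2]
              simp only [mul_assoc]
              rw [hcenz]
      rw [mul_assoc, ← hcenz, zpow_sub, ← mul_assoc, ← L, mul_inv_cancel_right]
    intro g hg
    obtain ⟨s, hs⟩ := Subgroup.mem_zpowers_iff.mp (this hg)
    exact ⟨s, hs.symm⟩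
  have hc1 : ρ c ≠ 1 := by
    intro h1
    have hle : commutator P ≤ K := by
      intro g hg
      obtain ⟨s, hs⟩ := hgen g hg
      rw [← hker, MonoidHom.mem_ker, hs, h1, one_zpow]
    have hall : ∀ n, commutator P ≤ (⊤ : Subgroup P).lowerCentralSeries n := by
      intro n
      induction n with
      | zero => exact le_top
      | succ n ih =>
        rw [Subgroup.lowerCentralSeries_succ]
        exact hle.trans (Subgroup.commutator_mono ih le_rfl)
    obtain ⟨n, hn⟩ := Subgroup.nilpotent_iff_lowerCentralSeries.mp hnil
    have hbot : commutator P = ⊥ := le_bot_iff.mp ((hall n).trans hn.le)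
    apply hnab
    intro g h
    have : ⁅g, h⁆ ∈ commutator P :=
      Subgroup.commutator_mem_commutator (Subgroup.mem_top _) (Subgroup.mem_top _)
    rw [hbot, Subgroup.mem_bot, commutatorElement_eq_one_iff_mul_comm] at this
    exact this
  have hb : y ^ b ∈ commutator P := by
    have : y ^ b = (x ^ a)⁻¹ * c := by rw [hc]; group
    rw [this]; exact mul_mem (inv_mem ha) hcC
  have hαc : α c = c⁻¹ := by
    simp only [hcdef, map_mul, map_inv, hαx, hαy]; group
  obtain ⟨s, hs⟩ := hgen _ ha
  obtain ⟨t, ht⟩ := hgen _ hb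
  have hxb : ρ (x ^ b) = ρ c ^ (-t) := by
    rw [← map_zpow] at ht
    have := ib_char_eq ρ hkc α ht
    rw [map_zpow α, map_zpow α, hαy, hαc] at this
    rw [this]; simp
  have hcst : ρ c = ρ c ^ s * ρ c ^ t := by
    rw [← hs, ← ht, ← map_mul, ← hc]
  have hcx : ρ c = ρ (x ^ (a - b)) := by
    rw [zpow_sub, map_mul ρ (x ^ a), map_inv ρ (x ^ b), hs, hxb, zpow_neg, inv_inv]; exact hcst
  have hβc : ρ (β c) = ρ c := by
    rw [ib_char_eq ρ hkc β hcx, map_zpow β, hβx, ← hcx]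
  obtain ⟨i, j, hij⟩ := hrep (β y)
  refine ⟨i, j, hij, ?_⟩
  by_contra hnd
  refine hc1 (ib_zpow_eq_one hR hnd ?_)
  have e := hpw 1 j
  rw [zpow_one, one_mul] at e
  have : ρ (β c) = ρ c ^ j := by
    have h0 : β c = x⁻¹ * (x ^ i * y ^ j)⁻¹ * x * (x ^ i * y ^ j) := by
      simp only [hcdef, map_mul, map_inv, hβx, hij]
    rw [h0]
    simp only [map_mul, map_inv, map_zpow, mul_inv_rev]
    have : (ρ x)⁻¹ * ((ρ y ^ j)⁻¹ * (ρ x ^ i)⁻¹) * ρ x * (ρ x ^ i * ρ y ^ j)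
      = (ρ x)⁻¹ * (ρ y ^ j)⁻¹ * (ρ x * ρ y ^ j) := by group
    rw [this, e]; group
  rw [zpow_sub, zpow_one, ← this, hβc, mul_inv_cancel]

theorem ib_core {P V : Type*} [Group P] [Finite P] [CommGroup V] {p : ℕ} [hp : Fact p.Prime]
    (hP : IsPGroup p P) (hnab : ¬ ∀ a b : P, a * b = b * a) (x y : P)
    (hrep : ∀ g : P, ∃ i j : ℤ, g = x ^ i * y ^ j)
    (α : MulAut P) (hαx : α x = y) (hαy : α y = x) (β : MulAut P) (hβx : β x = x)
    (π : P →* V) (hker : π.ker = frattini P) (hpp : ∀ g, π g ^ p = 1)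
    (h1 : (orderOf β).Coprime p) (h2 : (orderOf (β⁻¹ * (α * β * α⁻¹))).Coprime p) : β = 1 := by
  have hkc : π.ker.Characteristic := by rw [hker]; infer_instance
  have hpz : ∀ (g : P) (n : ℤ), (p : ℤ) ∣ n → π g ^ n = 1 := by
    rintro g n ⟨k, rfl⟩
    rw [zpow_mul, zpow_natCast, hpp, one_zpow]
  have hCC : (commutator P).Characteristic := inferInstance
  obtain ⟨a, b, hc⟩ := hrep (x⁻¹ * y⁻¹ * x * y)
  by_cases ha : x ^ a ∈ commutator P
  · obtain ⟨i, j, hij, hj⟩ := ib_case_one hP hnab x y hrep α hαx hαy β hβx a b hc ha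
    refine ib_trivial hP π hker β h1 ((Subgroup.zpowers (π x)).comap π) ?_ y x ?_ (by rw [hβx])
      (fun m hm => hm) ?_
    · intro m hm
      obtain ⟨n, hn⟩ := Subgroup.mem_zpowers_iff.mp (Subgroup.mem_comap.mp hm)
      rw [← map_zpow] at hn
      rw [Subgroup.mem_comap, ← ib_char_eq π hkc β hn, map_zpow β, hβx, map_zpow]
      exact Subgroup.zpow_mem _ (Subgroup.mem_zpowers _) n
    · rw [Subgroup.mem_comap, Subgroup.mem_zpowers_iff]
      refine ⟨i, ?_⟩
      have := hpz y _ hj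
      rw [zpow_sub, zpow_one] at this
      rw [hij, map_mul, map_mul, map_inv, map_zpow, map_zpow, mul_left_comm, mul_comm (π y)⁻¹, this,
        mul_one]
    · intro g
      obtain ⟨i, j, rfl⟩ := hrep g
      exact ⟨j, i, by rw [map_mul, map_zpow, map_zpow, mul_comm]⟩
  -- second case
  have ha0 : a ≠ 0 := by rintro rfl; apply ha; rw [zpow_zero]; exact one_mem _
  have hd : 0 < Int.gcd a b := Int.gcd_pos_of_ne_zero_left b ha0
  obtain ⟨u, v, huv, hau, hbv⟩ := Int.exists_gcd_one hd
  generalize (Int.gcd a b : ℤ) = d at hau hbv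
  let Z : Subgroup P := ((zpowGroupHom d : Abelianization P →* Abelianization P).ker).comap
    Abelianization.of
  have hZ : ∀ q, q ∈ Z ↔ q ^ d ∈ commutator P := by
    intro q
    show (Abelianization.of q) ^ d = 1 ↔ _
    rw [← map_zpow, ← MonoidHom.mem_ker, Abelianization.ker_of]
  have hZc : ∀ (δ : MulAut P), ∀ q ∈ Z, δ q ∈ Z := by
    intro δ q hq
    rw [hZ] at hq ⊢
    rw [← map_zpow]; exact ib_char _ δ hq
  let M : Subgroup P := Z ⊔ frattini P
  have hMc : ∀ (δ : MulAut P), ∀ q ∈ M, δ q ∈ M := by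
    intro δ
    have : M ≤ M.comap δ.toMonoidHom := by
      refine sup_le ?_ ?_
      · exact fun q hq => (le_sup_left : Z ≤ M) (hZc δ q hq)
      · exact fun q hq => (le_sup_right : frattini P ≤ M) (ib_char _ δ hq)
    exact this
  have hΦM : ∀ g, π g = 1 → g ∈ M := by
    intro g hg
    apply (le_sup_right : frattini P ≤ M)
    rw [← hker]; exact hg
  have hMπ : ∀ g h, π g = π h → g ∈ M → h ∈ M := by
    intro g h hgh hg
    have h1 : g⁻¹ * h ∈ M := hΦM _ (by rw [map_mul, map_inv, hgh, inv_mul_cancel])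
    have : h = g * (g⁻¹ * h) := by group
    rw [this]; exact mul_mem hg h1
  have hxM : x ∉ M := by
    intro hx
    have hy : y ∈ M := by rw [← hαx]; exact hMc α x hx
    have hMt : M = ⊤ := by
      rw [eq_top_iff]
      intro g _
      obtain ⟨i, j, rfl⟩ := hrep g
      exact mul_mem (zpow_mem hx i) (zpow_mem hy j)
    have hZt := frattini_nongenerating hMt
    have : x ∈ Z := by rw [hZt]; trivial
    rw [hZ] at this
    apply ha
    rw [hau, mul_comm, zpow_mul]
    exact zpow_mem this u
  have hyM : y ∉ M := by
    intro hy
    apply hxM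
    rw [← hαy]; exact hMc α y hy
  have hinv : ∀ (n : ℤ), ¬ (p : ℤ) ∣ n → ∃ k l : ℤ, k * n = 1 + l * p := by
    intro n hn
    obtain ⟨r, s, hrs⟩ := (Nat.prime_iff_prime_int.mp hp.out).coprime_iff_not_dvd.mpr hn
    exact ⟨s, -r, by linarith⟩
  have hdvd : ∀ g, g ∉ M → ∀ n : ℤ, g ^ n ∈ M → (p : ℤ) ∣ n := by
    intro g hg n hn
    by_contra hnd
    obtain ⟨k, l, hkl⟩ := hinv n hnd
    apply hg
    refine hMπ (g ^ (k * n)) g ?_ ?_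
    · rw [hkl, map_zpow, zpow_add, zpow_one, hpz g (l * p) (Dvd.intro_left l rfl), mul_one]
    · rw [mul_comm, zpow_mul]; exact zpow_mem hn k
  set z := x ^ u * y ^ v with hz
  have hzM : z ∈ M := by
    apply (le_sup_left : Z ≤ M)
    rw [hZ, ← Abelianization.ker_of, MonoidHom.mem_ker, hz, map_zpow, map_mul, mul_zpow, map_zpow,
      map_zpow, ← zpow_mul, ← zpow_mul, ← hau, ← hbv, ← map_zpow, ← map_zpow, ← map_mul, ← hc]
    simp [mul_comm]
  have hpv : ¬ (p : ℤ) ∣ v := by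
    intro hv
    have hu : x ^ u ∈ M := hMπ z _ (by
      rw [hz, map_mul, map_zpow _ y, hpz y v hv, mul_one]) hzM
    have hu := hdvd x hxM u hu
    have := Int.dvd_coe_gcd hu hv
    rw [huv] at this
    have h1 : p ∣ 1 := by exact_mod_cast this
    exact hp.out.one_lt.ne' (Nat.dvd_one.mp h1)
  obtain ⟨k, l, hkl⟩ := hinv v hpv
  have hgen : ∀ g, ∃ i j : ℤ, π g = π x ^ i * π z ^ j := by
    intro g
    obtain ⟨i, j, rfl⟩ := hrep g
    refine ⟨i - u * (k * j), k * j, ?_⟩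
    have e : π y ^ (v * (k * j)) = π y ^ j := by
      have : v * (k * j) = j + p * (l * j) := by
        calc v * (k * j) = (k * v) * j := by ring
          _ = _ := by rw [hkl]; ring
      rw [this, zpow_add, hpz y _ (Dvd.intro _ rfl), mul_one]
    rw [hz, map_mul, map_mul, map_zpow, map_zpow, map_zpow, map_zpow, mul_zpow, ← zpow_mul,
      ← zpow_mul, e, ← mul_assoc, ← zpow_add]
    congr 2; ring
  have hMz : ∀ m ∈ M, π m ∈ Subgroup.zpowers (π z) := by
    intro m hm
    obtain ⟨i, j, hij⟩ := hgen m
    have hi : x ^ i ∈ M := by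
      refine hMπ (m * z ^ (-j)) _ ?_ (mul_mem hm (zpow_mem hzM _))
      rw [map_mul, hij, map_zpow, map_zpow, zpow_neg, mul_inv_cancel_right]
    rw [hij, hpz x i (hdvd x hxM i hi), one_mul]
    exact Subgroup.zpow_mem _ (Subgroup.mem_zpowers _) j
  -- `β` acts on `M` modulo the Frattini subgroup as a power map
  obtain ⟨n, hn⟩ := Subgroup.mem_zpowers_iff.mp (hMz _ (hMc β z hzM))
  have hβM : ∀ m ∈ M, π (β m) = π (m ^ n) := by
    intro m hm
    obtain ⟨i, hi⟩ := Subgroup.mem_zpowers_iff.mp (hMz _ hm)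
    rw [← map_zpow] at hi
    rw [← ib_char_eq π hkc β hi, map_zpow, map_zpow, ← hn, map_zpow, ← hi, map_zpow, ← zpow_mul,
      ← zpow_mul, mul_comm]
  set γ := α * β * α⁻¹ with hγ
  have hγz : π (γ z) = π (z ^ n) := by
    have h := ib_char_eq π hkc α (hβM _ (hMc α⁻¹ z hzM))
    rw [hγ, MulAut.mul_apply, MulAut.mul_apply, h, map_zpow α, MulAut.apply_inv_self]
  have hγy : γ y = y := by
    have : α⁻¹ y = x := by rw [← hαx]; exact MulAut.inv_apply_self _ _ _
    rw [hγ, MulAut.mul_apply, MulAut.mul_apply, this, hβx, hαx]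
  have hγx : x⁻¹ * γ x ∈ M := by
    -- `x` is a power of `y` modulo `M`
    have hpu : ¬ (p : ℤ) ∣ u := by
      intro hu
      have hv : y ^ v ∈ M := hMπ z _ (by
        rw [hz, map_mul, map_zpow _ x, hpz x u hu, one_mul]) hzM
      exact hpv (hdvd y hyM v hv)
    obtain ⟨k, l, hkl⟩ := hinv u hpu
    have hm : x * y ^ (k * v) ∈ M := by
      refine hMπ (z ^ k) _ ?_ (zpow_mem hzM k)
      rw [hz, map_zpow, map_mul, map_mul, mul_zpow, map_zpow, map_zpow, map_zpow, ← zpow_mul,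
        ← zpow_mul, mul_comm u k, hkl, zpow_add, zpow_one, hpz x (l * p) (Dvd.intro_left l rfl),
        mul_one, mul_comm v k]
    generalize k * v = w at hm
    have h1 : (x * y ^ w)⁻¹ * γ (x * y ^ w) ∈ M := mul_mem (inv_mem hm) (hMc γ _ hm)
    have h2 := hMc (MulAut.conj (y ^ w)) _ h1
    rw [map_mul γ, map_zpow γ, hγy, MulAut.conj_apply] at h2
    have e : y ^ w * ((x * y ^ w)⁻¹ * (γ x * y ^ w)) * (y ^ w)⁻¹ = x⁻¹ * γ x := by group
    rwa [e] at h2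
  have hδ : β⁻¹ * γ = 1 := by
    refine ib_trivial hP π hker _ h2 M (hMc _) x z ?_ ?_ hMz hgen
    · have := hMc β⁻¹ _ hγx
      have e : β⁻¹ x = x := by
        have h := MulAut.inv_apply_self P β x
        rwa [hβx] at h
      rw [map_mul, map_inv, e] at this
      exact this
    · rw [← hβM z hzM] at hγz
      have := ib_char_eq π hkc β⁻¹ hγz
      rw [MulAut.inv_apply_self] at this
      exact this
  have hβγ : γ = β := by rwa [inv_mul_eq_one, eq_comm] at hδ
  have hβy : β y = y := by rw [← hβγ]; exact hγy
  ext g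
  obtain ⟨i, j, rfl⟩ := hrep g
  simp [hβx, hβy]

/-- Lemma 6.3. Let `P` be a nonabelian `p^e`-isobicyclic `p`-group with
canonical generators `x, y` and canonical automorphism `α`. If `β` is an automorphism of `P`
fixing `x`, and the subgroup `A = ⟨β, αβα⁻¹⟩` of `Aut P` has order coprime to `p`,
then `A = 1` (so `β` is the identity). -/
theorem nonabelian_isobicyclic_coprime_automorphism_trivial
    {P : Type*} [Group P] [Finite P] (p e : ℕ) (hp : p.Prime)
    (hnab : ¬ ∀ a b : P, a * b = b * a)
    (x y : P) (hx : orderOf x = p ^ e) (hy : orderOf y = p ^ e)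
    (hprod : (↑(Subgroup.zpowers x) * ↑(Subgroup.zpowers y) : Set P) = Set.univ)
    (hinter : Subgroup.zpowers x ⊓ Subgroup.zpowers y = ⊥)
    (α : MulAut P) (hαx : α x = y) (hαy : α y = x)
    (β : MulAut P) (hβx : β x = x)
    (hA : (Nat.card (Subgroup.closure ({β, α * β * α⁻¹} : Set (MulAut P)))).Coprime p) :
    Subgroup.closure ({β, α * β * α⁻¹} : Set (MulAut P)) = ⊥ ∧ β = 1 := by
  have : Fact p.Prime := ⟨hp⟩
  have hP : IsPGroup p P := by
    have h1 := Subgroup.isComplement'_of_disjoint_and_mul_eq_univ (disjoint_iff.mpr hinter) hprod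
    have h2 := h1.card_mul_card
    rw [Nat.card_zpowers, Nat.card_zpowers, hx, hy, ← pow_add] at h2
    exact IsPGroup.of_card h2.symm
  have hrep : ∀ g : P, ∃ i j : ℤ, g = x ^ i * y ^ j := by
    intro g
    have hg : g ∈ (↑(Subgroup.zpowers x) * ↑(Subgroup.zpowers y) : Set P) := by
      rw [hprod]; trivial
    obtain ⟨_, ⟨i, rfl⟩, _, ⟨j, rfl⟩, h⟩ := Set.mem_mul.mp hg
    exact ⟨i, j, h.symm⟩
  obtain ⟨hf1, hf2⟩ := ib_frattini hP
  have hcop : ∀ δ ∈ Subgroup.closure ({β, α * β * α⁻¹} : Set (MulAut P)),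
      (orderOf δ).Coprime p := by
    intro δ hδ
    exact Nat.Coprime.coprime_dvd_left (Subgroup.orderOf_dvd_natCard _ hδ) hA
  have hb : β ∈ Subgroup.closure ({β, α * β * α⁻¹} : Set (MulAut P)) :=
    Subgroup.subset_closure (by simp)
  have hg : α * β * α⁻¹ ∈ Subgroup.closure ({β, α * β * α⁻¹} : Set (MulAut P)) :=
    Subgroup.subset_closure (by simp)
  have hβ : β = 1 := by
    let _ : CommGroup (P ⧸ frattini P) :=
      { (inferInstance : Group (P ⧸ frattini P)) with
        mul_comm := by
          intro u v
          obtain ⟨u, rfl⟩ := QuotientGroup.mk'_surjective _ u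
          obtain ⟨v, rfl⟩ := QuotientGroup.mk'_surjective _ v
          have h : QuotientGroup.mk' (frattini P) (u * v * u⁻¹ * v⁻¹) = 1 :=
            (QuotientGroup.eq_one_iff _).mpr (hf1 u v)
          rw [map_mul, map_mul, map_mul, map_inv, map_inv, mul_inv_eq_one, mul_inv_eq_iff_eq_mul] at h
          exact h }
    refine ib_core hP hnab x y hrep α hαx hαy β hβx (QuotientGroup.mk' (frattini P))
      (QuotientGroup.ker_mk' _) ?_ (hcop β hb) (hcop _ (mul_mem (inv_mem hb) hg))
    intro g
    rw [← map_pow]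
    exact (QuotientGroup.eq_one_iff _).mpr (hf2 g)
  refine ⟨?_, hβ⟩
  subst hβ
  simp
end
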